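/- For fixed q, as g → ∞ one has (1/#I_{g+1})·Σ_{u ∈ I_{g+1}} h_u ∼ ζ_A(2)·P(2)·q^{g} and (1/#F'_{g+1})·Σ_{u ∈ F'_{g+1}} h_u ∼ 2·ζ_A(3)·P(2)·q^{g} (meaning each ratio of the two sides tends to 1). -/

import Mathlib

open Polynomial

noncomputable section

namespace EvenChar

variable {Fq : Type} [Field Fq] [Fintype Fq]

variable (Fq) in
/-- The family `F_n` of real quadratic `u`'s. -/
def Ffam (n : ℕ) : Set (RatFunc Fq) :=
  { u | ∃ (S : Finset (Polynomial Fq)) (e : Polynomial Fq → ℕ)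
        (a : Polynomial Fq → ℕ → Polynomial Fq),
      (∀ P ∈ S, P.Monic ∧ Irreducible P) ∧
      (∀ P ∈ S, 1 ≤ e P) ∧
      (∀ P ∈ S, ∀ i, 1 ≤ i → i ≤ e P → (a P i).degree < P.degree) ∧
      (∀ P ∈ S, a P (e P) ≠ 0) ∧
      (∑ P ∈ S, e P * P.natDegree) = n ∧
      u = ∑ P ∈ S, ∑ i ∈ Finset.Icc 1 (e P),
            algebraMap (Polynomial Fq) (RatFunc Fq) (a P i) /
              algebraMap (Polynomial Fq) (RatFunc Fq) P ^ (2 * i - 1) }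

/-- The family `G_s` of odd polynomial parts. -/
def Gfam (ξ : Fq) (s : ℕ) : Set (Polynomial Fq) :=
  { G | ∃ (α : Fq) (c : ℕ → Fq), (α = 0 ∨ α = ξ) ∧ c s ≠ 0 ∧
      G = Polynomial.C α + ∑ i ∈ Finset.Icc 1 s, Polynomial.C (c i) * Polynomial.X ^ (2 * i - 1) }

/-- The family `I_{(r,s)}`. -/
def Irs (ξ : Fq) (r s : ℕ) : Set (RatFunc Fq) :=
  { u | ∃ v ∈ Ffam Fq r, ∃ G ∈ Gfam ξ s,
      u = v + algebraMap (Polynomial Fq) (RatFunc Fq) G }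

/-- The family `I_n` of ramified imaginary `u`'s. -/
def Ifam (ξ : Fq) (n : ℕ) : Set (RatFunc Fq) :=
  ⋃ (r : ℕ) (s : ℕ) (_ : 1 ≤ s) (_ : r + s = n), Irs ξ r s

/-- The family `F'_n` of inert imaginary `u`'s. -/
def F'fam (ξ : Fq) (n : ℕ) : Set (RatFunc Fq) :=
  (fun u => u + RatFunc.C ξ) '' Ffam Fq n

/-- `ζ_A(s) = (1 - q^{1-s})⁻¹`, real version. -/
def zetaR (q : ℕ) (s : ℝ) : ℝ := (1 - (q : ℝ) ^ ((1 : ℝ) - s))⁻¹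

variable (Fq) in
/-- The Euler product `P(s) = ∏_P (1 - 1/(|P|^s (|P|+1)))`, real version. -/
def eulerPR (s : ℝ) : ℝ :=
  ∏' P : {P : Polynomial Fq // P.Monic ∧ Irreducible P},
    (1 - (((Fintype.card Fq : ℝ) ^ (P.1.natDegree : ℝ)) ^ s *
          ((Fintype.card Fq : ℝ) ^ (P.1.natDegree : ℝ) + 1))⁻¹)

open Polynomial in
open scoped Classical in
/-- The ideal class number `h_u` of the integral closure `O_u` of `Fq[T]` in
`K_u = k(x_u)`, where `x_u² + x_u = u`. -/
def hClass (u : RatFunc Fq) : ℕ :=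
  if hirr : Irreducible (X ^ 2 + X + C u : Polynomial (RatFunc Fq)) then
    letI : IsDomain (AdjoinRoot (X ^ 2 + X + C u : Polynomial (RatFunc Fq))) :=
      AdjoinRoot.isDomain_of_prime hirr.prime
    letI : IsDomain (integralClosure (Polynomial Fq)
        (AdjoinRoot (X ^ 2 + X + C u : Polynomial (RatFunc Fq)))) := Subalgebra.isDomain _
    Nat.card (ClassGroup (integralClosure (Polynomial Fq)
      (AdjoinRoot (X ^ 2 + X + C u : Polynomial (RatFunc Fq)))))
  else 0

end EvenChar

namespace EvenChar
section M1
open scoped Classical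
set_option linter.unusedSectionVars false
set_option linter.unusedSimpArgs false
variable {F : Type} [Field F] [Fintype F]

lemma finite_degLT (m : ℕ) : {p : F[X] | p.degree < m}.Finite := by
  have : {p : F[X] | p.degree < m} = (Polynomial.degreeLT F m : Set F[X]) := by
    ext p; simp [Polynomial.mem_degreeLT]
  rw [this]
  have e := (Polynomial.degreeLTEquiv F m).toEquiv
  have : Finite (Polynomial.degreeLT F m) := Finite.of_equiv _ e.symm
  exact Set.toFinite _

variable (F) in
/-- Polynomials of degree `< m`. -/
def polyLT (m : ℕ) : Finset F[X] := (finite_degLT (F := F) m).toFinset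

lemma mem_polyLT {m : ℕ} {p : F[X]} : p ∈ polyLT F m ↔ p.degree < m := by
  simp [polyLT]

lemma card_polyLT (m : ℕ) : (polyLT F m).card = Fintype.card F ^ m := by
  have e := (Polynomial.degreeLTEquiv F m).toEquiv
  have h1 : Nat.card (Polynomial.degreeLT F m) = Fintype.card F ^ m := by
    rw [Nat.card_congr e]; simp
  rw [← h1, polyLT, ← Set.ncard_eq_toFinset_card _ (finite_degLT m)]
  have : {p : F[X] | p.degree < m} = (Polynomial.degreeLT F m : Set F[X]) := by
    ext p; simp [Polynomial.mem_degreeLT]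
  rw [this]; rfl

/-- Shifted box `x₀ + {deg < m}`. -/
def sbox (x₀ : F[X]) (m : ℕ) : Finset F[X] := (polyLT F m).image (fun z => x₀ + z)

lemma mem_sbox {x₀ : F[X]} {m : ℕ} {p : F[X]} : p ∈ sbox x₀ m ↔ (p - x₀).degree < m := by
  simp only [sbox, Finset.mem_image, mem_polyLT]
  constructor
  · rintro ⟨z, hz, rfl⟩; simpa using hz
  · intro h; exact ⟨p - x₀, h, by ring⟩

lemma card_sbox (x₀ : F[X]) (m : ℕ) : (sbox x₀ m).card = Fintype.card F ^ m := by
  rw [sbox, Finset.card_image_of_injective _ (add_right_injective x₀), card_polyLT]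

lemma degree_mul_lt_iff {M z : F[X]} (hM : M ≠ 0) {m : ℕ} (h : M.natDegree ≤ m) :
    (M * z).degree < m ↔ z.degree < ((m - M.natDegree : ℕ) : WithBot ℕ) := by
  by_cases hz : z = 0
  · simp [hz, WithBot.bot_lt_coe]
  rw [degree_eq_natDegree (mul_ne_zero hM hz), degree_eq_natDegree hz, natDegree_mul hM hz]
  norm_cast
  omega

lemma card_sbox_res {M : F[X]} (hM : M ≠ 0) {m : ℕ} (h : M.natDegree ≤ m) (x₀ a : F[X]) :
    ((sbox x₀ m).filter (fun p => M ∣ p - a)).card = Fintype.card F ^ (m - M.natDegree) := by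
  rw [← card_polyLT (F := F)]
  symm
  set c : F[X] := (a - x₀) % M with hc
  have hcdeg : c.degree < m := lt_of_lt_of_le (EuclideanDomain.mod_lt (a - x₀) hM)
    (degree_le_natDegree.trans (by exact_mod_cast h))
  have hcdvd : M ∣ (x₀ + c) - a := by
    have := EuclideanDomain.div_add_mod (a - x₀) M
    refine ⟨-((a - x₀) / M), ?_⟩
    rw [hc]; linear_combination this
  refine Finset.card_bij (fun z _ => x₀ + (c + M * z)) ?_ ?_ ?_
  · intro z hz
    rw [mem_polyLT] at hz
    rw [Finset.mem_filter, mem_sbox]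
    refine ⟨?_, ?_⟩
    · rw [add_sub_cancel_left]
      exact lt_of_le_of_lt (degree_add_le _ _) (max_lt hcdeg ((degree_mul_lt_iff hM h).2 hz))
    · have : x₀ + (c + M * z) - a = (x₀ + c - a) + M * z := by ring
      rw [this]; exact dvd_add hcdvd (dvd_mul_right _ _)
  · intro z _ z' _ he
    have : M * z = M * z' := by simpa using he
    exact mul_left_cancel₀ hM this
  · intro p hp
    rw [Finset.mem_filter, mem_sbox] at hp
    have : M ∣ p - (x₀ + c) := by
      have := dvd_sub hp.2 hcdvd
      convert this using 1; ring
    obtain ⟨z, hz⟩ := this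
    refine ⟨z, ?_, ?_⟩
    · rw [mem_polyLT, ← degree_mul_lt_iff hM h, ← hz]
      have : p - (x₀ + c) = (p - x₀) - c := by ring
      rw [this]
      exact lt_of_le_of_lt (degree_sub_le _ _) (max_lt hp.1 hcdeg)
    · show x₀ + (c + M * z) = p
      rw [← hz]; ring

lemma card_sbox_res_le_one {M : F[X]} {m : ℕ} (h : m ≤ M.natDegree) (hM : M ≠ 0) (x₀ a : F[X]) :
    ((sbox x₀ m).filter (fun p => M ∣ p - a)).card ≤ 1 := by
  rw [Finset.card_le_one]
  intro p hp p' hp'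
  rw [Finset.mem_filter, mem_sbox] at hp hp'
  have h1 : M ∣ p - p' := by
    have := dvd_sub hp.2 hp'.2
    convert this using 1; ring
  have h2 : (p - p').degree < M.degree := by
    have : p - p' = (p - x₀) - (p' - x₀) := by ring
    rw [this]
    refine lt_of_lt_of_le (lt_of_le_of_lt (degree_sub_le _ _) (max_lt hp.1 hp'.1)) ?_
    rw [degree_eq_natDegree hM]; exact_mod_cast h
  exact sub_eq_zero.1 (eq_zero_of_dvd_of_degree_lt h1 h2)

end M1
end EvenChar

namespace EvenChar
section M2
open scoped Classical
set_option linter.unusedSectionVars false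
set_option linter.unusedSimpArgs false
variable {F : Type} [Field F] [Fintype F]

/-- box of triples -/
def tbox (x : F[X] × F[X] × F[X]) (m : ℕ × ℕ × ℕ) : Finset (F[X] × F[X] × F[X]) :=
  sbox x.1 m.1 ×ˢ sbox x.2.1 m.2.1 ×ˢ sbox x.2.2 m.2.2

/-- congruence of triples -/
def tcong (M : F[X]) (a x : F[X] × F[X] × F[X]) : Prop :=
  M ∣ x.1 - a.1 ∧ M ∣ x.2.1 - a.2.1 ∧ M ∣ x.2.2 - a.2.2

lemma tcong.symm {M : F[X]} {a x : F[X] × F[X] × F[X]} (h : tcong M a x) : tcong M x a :=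
  ⟨(dvd_sub_comm).1 h.1, (dvd_sub_comm).1 h.2.1, (dvd_sub_comm).1 h.2.2⟩

lemma tcong.trans {M : F[X]} {a x y : F[X] × F[X] × F[X]} (h : tcong M a x) (h' : tcong M x y) :
    tcong M a y := by
  refine ⟨?_, ?_, ?_⟩
  · have := dvd_add h.1 h'.1; convert this using 1; ring
  · have := dvd_add h.2.1 h'.2.1; convert this using 1; ring
  · have := dvd_add h.2.2 h'.2.2; convert this using 1; ring

lemma card_tbox (x : F[X] × F[X] × F[X]) (m : ℕ × ℕ × ℕ) :
    (tbox x m).card = Fintype.card F ^ m.1 * (Fintype.card F ^ m.2.1 * Fintype.card F ^ m.2.2) := by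
  simp [tbox, Finset.card_product, card_sbox]

lemma card_tbox_cong {M : F[X]} (hM : M ≠ 0) (x a : F[X] × F[X] × F[X]) (m : ℕ × ℕ × ℕ)
    (h1 : M.natDegree ≤ m.1) (h2 : M.natDegree ≤ m.2.1) (h3 : M.natDegree ≤ m.2.2) :
    (((tbox x m).filter (fun y => tcong M a y)).card : ℝ) =
      (tbox x m).card / (Fintype.card F : ℝ) ^ (3 * M.natDegree) := by
  have e : (tbox x m).filter (fun y => tcong M a y) =
      ((sbox x.1 m.1).filter (fun p => M ∣ p - a.1)) ×ˢ
      ((sbox x.2.1 m.2.1).filter (fun p => M ∣ p - a.2.1)) ×ˢ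
      ((sbox x.2.2 m.2.2).filter (fun p => M ∣ p - a.2.2)) := by
    ext y
    rw [Finset.mem_filter]
    simp only [tbox, tcong, Finset.mem_filter, Finset.mem_product]
    tauto
  rw [e, Finset.card_product, Finset.card_product, card_sbox_res hM h1, card_sbox_res hM h2,
    card_sbox_res hM h3, card_tbox]
  have hq : (Fintype.card F : ℝ) ≠ 0 := by simp
  rw [eq_div_iff (pow_ne_zero _ hq)]
  push_cast
  rw [← pow_add, ← pow_add, ← pow_add, ← pow_add, ← pow_add]
  congr 1
  omega

/-- density of a set of triples modulo `M` -/
def dens (M : F[X]) (φ : F[X] × F[X] × F[X] → Prop) : ℝ :=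
  (((tbox (0, 0, 0) (M.natDegree, M.natDegree, M.natDegree)).filter φ).card : ℝ) /
    (Fintype.card F : ℝ) ^ (3 * M.natDegree)

lemma dens_main (x : F[X] × F[X] × F[X]) (m : ℕ × ℕ × ℕ) (md : F[X] → F[X])
    (φ : F[X] → F[X] × F[X] × F[X] → Prop) (S : Finset F[X]) :
    (∀ P ∈ S, md P ≠ 0) → (∀ P ∈ S, ∀ Q ∈ S, P ≠ Q → IsCoprime (md P) (md Q)) →
    (∀ P ∈ S, ∀ y z, tcong (md P) y z → (φ P y → φ P z)) →
    ∀ (M : F[X]) (a : F[X] × F[X] × F[X]), M ≠ 0 → (∀ P ∈ S, IsCoprime M (md P)) →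
    (M.natDegree + ∑ P ∈ S, (md P).natDegree ≤ m.1) →
    (M.natDegree + ∑ P ∈ S, (md P).natDegree ≤ m.2.1) →
    (M.natDegree + ∑ P ∈ S, (md P).natDegree ≤ m.2.2) →
    (((tbox x m).filter (fun y => tcong M a y ∧ ∀ P ∈ S, φ P y)).card : ℝ) =
      (tbox x m).card / (Fintype.card F : ℝ) ^ (3 * M.natDegree) * ∏ P ∈ S, dens (md P) (φ P) := by
  induction S using Finset.induction_on with
  | empty =>
    intro _ _ _ M a hM _ h1 h2 h3
    simp only [Finset.sum_empty, add_zero] at h1 h2 h3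
    simpa using card_tbox_cong hM x a m h1 h2 h3
  | insert P S hP ih =>
    intro hne hcop hper M a hM hMc h1 h2 h3
    rw [Finset.sum_insert hP] at h1 h2 h3
    have hmP : md P ≠ 0 := hne P (Finset.mem_insert_self _ _)
    set d := (md P).natDegree with hd
    set R := (tbox (0, 0, 0) (d, d, d)).filter (φ P) with hR
    let r : F[X] × F[X] × F[X] → F[X] × F[X] × F[X] :=
      fun y => (y.1 % md P, y.2.1 % md P, y.2.2 % md P)
    have hdv : ∀ p : F[X], md P ∣ p - p % md P := fun p =>
      ⟨p / md P, by
        have := EuclideanDomain.div_add_mod p (md P)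
        linear_combination -this⟩
    have hrc : ∀ y, tcong (md P) (r y) y := fun y => ⟨hdv _, hdv _, hdv _⟩
    have hmaps : ∀ y ∈ (tbox x m).filter (fun y => tcong M a y ∧ ∀ Q ∈ insert P S, φ Q y),
        r y ∈ R := by
      intro y hy
      rw [Finset.mem_filter] at hy
      have hdeg : ∀ p : F[X], (p % md P - 0).degree < d := fun p => by
        rw [sub_zero]
        exact lt_of_lt_of_le (EuclideanDomain.mod_lt p hmP) degree_le_natDegree
      rw [hR, Finset.mem_filter]
      refine ⟨?_, ?_⟩
      · simp only [tbox, Finset.mem_product, mem_sbox]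
        exact ⟨hdeg _, hdeg _, hdeg _⟩
      · exact hper P (Finset.mem_insert_self _ _) y (r y) (hrc y).symm
          (hy.2.2 P (Finset.mem_insert_self _ _))
    rw [Finset.card_eq_sum_card_fiberwise hmaps]
    have hfib : ∀ b ∈ R, ((((tbox x m).filter
        (fun y => tcong M a y ∧ ∀ Q ∈ insert P S, φ Q y)).filter (fun y => r y = b)).card : ℝ) =
        (tbox x m).card / (Fintype.card F : ℝ) ^ (3 * (M.natDegree + d)) *
          ∏ P ∈ S, dens (md P) (φ P) := by
      intro b hb
      rw [hR, Finset.mem_filter] at hb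
      obtain ⟨s, t, hst⟩ := hMc P (Finset.mem_insert_self _ _)
      -- s * M + t * md P = 1
      let cr : F[X] → F[X] → F[X] := fun u v => v * (s * M) + u * (t * md P)
      have cr1 : ∀ u v, M ∣ cr u v - u := fun u v => ⟨(v - u) * s, by
        simp only [cr]; linear_combination u * hst⟩
      have cr2 : ∀ u v, md P ∣ cr u v - v := fun u v => ⟨(u - v) * t, by
        simp only [cr]; linear_combination v * hst⟩
      let a' : F[X] × F[X] × F[X] := (cr a.1 b.1, cr a.2.1 b.2.1, cr a.2.2 b.2.2)
      have ha1 : tcong M a a' := ⟨cr1 _ _, cr1 _ _, cr1 _ _⟩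
      have ha2 : tcong (md P) b a' := ⟨cr2 _ _, cr2 _ _, cr2 _ _⟩
      have hMP : IsCoprime M (md P) := hMc P (Finset.mem_insert_self _ _)
      have hset : ((tbox x m).filter
        (fun y => tcong M a y ∧ ∀ Q ∈ insert P S, φ Q y)).filter (fun y => r y = b) =
        (tbox x m).filter (fun y => tcong (M * md P) a' y ∧ ∀ Q ∈ S, φ Q y) := by
        ext y
        simp only [Finset.mem_filter]
        constructor
        · rintro ⟨⟨hy, hya, hyQ⟩, hyb⟩
          refine ⟨hy, ?_, fun Q hQ => hyQ Q (Finset.mem_insert_of_mem hQ)⟩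
          have k1 := ha1.symm.trans hya
          have k2 := ha2.symm.trans (hyb ▸ hrc y)
          exact ⟨hMP.mul_dvd k1.1 k2.1, hMP.mul_dvd k1.2.1 k2.2.1, hMP.mul_dvd k1.2.2 k2.2.2⟩
        · rintro ⟨hy, hya, hyQ⟩
          have k1 : tcong M a' y := ⟨(dvd_mul_right _ _).trans hya.1,
            (dvd_mul_right _ _).trans hya.2.1, (dvd_mul_right _ _).trans hya.2.2⟩
          have k2 : tcong (md P) a' y := ⟨(dvd_mul_left _ _).trans hya.1,
            (dvd_mul_left _ _).trans hya.2.1, (dvd_mul_left _ _).trans hya.2.2⟩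
          have k3 := ha2.trans k2
          refine ⟨⟨hy, ha1.trans k1, ?_⟩, ?_⟩
          · intro Q hQ
            rcases Finset.mem_insert.1 hQ with rfl | hQ
            · exact hper Q (Finset.mem_insert_self _ _) b y k3 hb.2
            · exact hyQ Q hQ
          · have hb1 := hb.1
            simp only [tbox, Finset.mem_product, mem_sbox, sub_zero] at hb1
            have hmod : ∀ p c : F[X], md P ∣ p - c → c.degree < d → p % md P = c := by
              intro p c hpc hc
              have h4 : md P ∣ p % md P - c := by
                have := dvd_sub hpc (hdv p)
                convert this using 1; ring
              have h5 : (p % md P - c).degree < (md P).degree := by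
                refine lt_of_le_of_lt (degree_sub_le _ _)
                  (max_lt (EuclideanDomain.mod_lt p hmP) ?_)
                rwa [degree_eq_natDegree hmP]
              exact sub_eq_zero.1 (eq_zero_of_dvd_of_degree_lt h4 h5)
            simp only [r]
            exact Prod.ext (hmod _ _ k3.1 hb1.1)
              (Prod.ext (hmod _ _ k3.2.1 hb1.2.1) (hmod _ _ k3.2.2 hb1.2.2))
      rw [hset]
      have hdeg : (M * md P).natDegree = M.natDegree + d := natDegree_mul hM hmP
      have := ih (fun Q hQ => hne Q (Finset.mem_insert_of_mem hQ))
        (fun Q hQ Q' hQ' => hcop Q (Finset.mem_insert_of_mem hQ) Q' (Finset.mem_insert_of_mem hQ'))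
        (fun Q hQ => hper Q (Finset.mem_insert_of_mem hQ)) (M * md P) a' (mul_ne_zero hM hmP)
        (fun Q hQ => IsCoprime.mul_left (hMc Q (Finset.mem_insert_of_mem hQ))
          (hcop P (Finset.mem_insert_self _ _) Q (Finset.mem_insert_of_mem hQ)
            (by rintro rfl; exact hP hQ)))
        (by rw [hdeg]; omega) (by rw [hdeg]; omega) (by rw [hdeg]; omega)
      rw [hdeg] at this
      exact this
    push_cast
    rw [Finset.sum_congr rfl hfib, Finset.sum_const, nsmul_eq_mul, Finset.prod_insert hP, dens,
      ← hd, ← hR]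
    have hq : (Fintype.card F : ℝ) ≠ 0 := by simp
    rw [mul_add, pow_add]
    field_simp

end M2
end EvenChar

namespace EvenChar
section M3
open scoped Classical
set_option linter.unusedSectionVars false
set_option linter.unusedSimpArgs false
variable {F : Type} [Field F] [Fintype F]

/-- `y² + N y + B` is not maximal at `P`. -/
def nonMax (P N B : F[X]) : Prop := P ∣ N ∧ ∃ w, P ^ 2 ∣ w ^ 2 + N * w + B

def bad (P : F[X]) (x : F[X] × F[X] × F[X]) : Prop := nonMax P x.1 (x.2.1 * x.2.2)

def bad0 (P : F[X]) (x : F[X] × F[X] × F[X]) : Prop := nonMax P x.1 x.2.2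

lemma nonMax_congr {P N B N' B' : F[X]} (h1 : P ^ 2 ∣ N' - N) (h2 : P ^ 2 ∣ B' - B)
    (h : nonMax P N B) : nonMax P N' B' := by
  obtain ⟨hN, w, hw⟩ := h
  refine ⟨?_, w, ?_⟩
  · have : N' = (N' - N) + N := by ring
    rw [this]
    exact dvd_add ((dvd_pow_self P two_ne_zero).trans h1) hN
  · have : w ^ 2 + N' * w + B' = (w ^ 2 + N * w + B) + (N' - N) * w + (B' - B) := by ring
    rw [this]
    exact dvd_add (dvd_add hw (h1.mul_right _)) h2

lemma bad_congr {P : F[X]} {y z : F[X] × F[X] × F[X]} (h : tcong (P ^ 2) y z) (hb : bad P y) :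
    bad P z := by
  refine nonMax_congr h.1 ?_ hb
  have : z.2.1 * z.2.2 - y.2.1 * y.2.2 = (z.2.1 - y.2.1) * z.2.2 + y.2.1 * (z.2.2 - y.2.2) := by
    ring
  rw [this]
  exact dvd_add (h.2.1.mul_right _) (h.2.2.mul_left _)

lemma bad0_congr {P : F[X]} {y z : F[X] × F[X] × F[X]} (h : tcong (P ^ 2) y z) (hb : bad0 P y) :
    bad0 P z := nonMax_congr h.1 h.2.2 hb

lemma dvd_sub_mod (P p : F[X]) : P ∣ p - p % P :=
  ⟨p / P, by
    have := EuclideanDomain.div_add_mod p P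
    linear_combination -this⟩

lemma mod_eq_of_dvd {P p c : F[X]} (hP : P ≠ 0) (h : P ∣ p - c) (hc : c.degree < P.degree) :
    p % P = c := by
  have h4 : P ∣ p % P - c := by
    have := dvd_sub h (dvd_sub_mod P p)
    convert this using 1; ring
  have h5 : (p % P - c).degree < P.degree :=
    lt_of_le_of_lt (degree_sub_le _ _) (max_lt (EuclideanDomain.mod_lt p hP) hc)
  exact sub_eq_zero.1 (eq_zero_of_dvd_of_degree_lt h4 h5)

lemma two_eq_zero_poly [CharP F 2] : (2 : F[X]) = 0 := CharTwo.two_eq_zero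

/-- shifting `w` modulo `P` -/
lemma shift_dvd [CharP F 2] {P N b w v : F[X]} (hN : P ∣ N) (h : P ∣ w - v)
    (hw : P ^ 2 ∣ w ^ 2 + N * w + b) : P ^ 2 ∣ v ^ 2 + N * v + b := by
  obtain ⟨n, rfl⟩ := hN
  obtain ⟨z, hz⟩ := h
  have : v ^ 2 + P * n * v + b = (w ^ 2 + P * n * w + b) + P ^ 2 * (z ^ 2 - n * z) := by
    have hv : v = w - P * z := by linear_combination -hz
    rw [hv]
    linear_combination (-(w * P * z)) * two_eq_zero_poly (F := F)
  rw [this]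
  exact dvd_add hw (dvd_mul_right _ _)

lemma dvd_of_sq_sub [CharP F 2] {P w v : F[X]} (hP : Prime P) (h : P ∣ w ^ 2 - v ^ 2) :
    P ∣ w - v := by
  have : w ^ 2 - v ^ 2 = (w - v) ^ 2 := by
    linear_combination (w * v - v ^ 2) * two_eq_zero_poly (F := F)
  rw [this] at h
  exact hP.dvd_of_dvd_pow h

lemma natDegree_sq (P : F[X]) : (P ^ 2).natDegree = 2 * P.natDegree := natDegree_pow _ _

lemma degree_lt_iff_polyLT {P c : F[X]} (hP : P ≠ 0) :
    c.degree < P.degree ↔ c ∈ polyLT F P.natDegree := by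
  rw [mem_polyLT, degree_eq_natDegree hP]

/-- unit case count -/
lemma card_bad_c_unit [CharP F 2] {P N f : F[X]} (hP : Irreducible P) (hN : P ∣ N)
    (hf : ¬ P ∣ f) :
    ((polyLT F (P ^ 2).natDegree).filter (fun c => ∃ w, P ^ 2 ∣ w ^ 2 + N * w + f * c)).card =
      Fintype.card F ^ P.natDegree := by
  have hP0 : P ≠ 0 := hP.ne_zero
  have hP2 : P ^ 2 ≠ 0 := pow_ne_zero _ hP0
  have hcop : IsCoprime (P ^ 2) f := by
    apply IsCoprime.pow_left
    exact (hP.coprime_iff_not_dvd).2 hf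
  obtain ⟨s, t, hst⟩ := hcop
  rw [← card_polyLT (F := F)]
  symm
  have key : ∀ w, P ^ 2 ∣ w ^ 2 + N * w + f * ((-(t * (w ^ 2 + N * w))) % P ^ 2) := by
    intro w
    have h1 := dvd_sub_mod (P ^ 2) (-(t * (w ^ 2 + N * w)))
    have : w ^ 2 + N * w + f * ((-(t * (w ^ 2 + N * w))) % P ^ 2) =
      P ^ 2 * (s * (w ^ 2 + N * w)) -
        f * (-(t * (w ^ 2 + N * w)) - (-(t * (w ^ 2 + N * w))) % P ^ 2) := by
      linear_combination (-(w ^ 2 + N * w)) * hst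
    rw [this]
    exact dvd_sub (dvd_mul_right _ _) (h1.mul_left _)
  refine Finset.card_bij (fun w _ => (-(t * (w ^ 2 + N * w))) % P ^ 2) ?_ ?_ ?_
  · intro w _
    rw [Finset.mem_filter, ← degree_lt_iff_polyLT hP2]
    exact ⟨EuclideanDomain.mod_lt _ hP2, w, key w⟩
  · intro w hw w' hw' he
    rw [← degree_lt_iff_polyLT hP0] at hw hw'
    have h1 := key w
    rw [show (-(t * (w ^ 2 + N * w))) % P ^ 2 = (-(t * (w' ^ 2 + N * w'))) % P ^ 2 from he] at h1
    have h2 := (dvd_pow_self P two_ne_zero).trans (dvd_sub h1 (key w'))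
    have h3 : P ∣ w ^ 2 - w' ^ 2 := by
      have e : w ^ 2 - w' ^ 2 = (w ^ 2 + N * w + f * ((-(t * (w' ^ 2 + N * w'))) % P ^ 2) -
        (w' ^ 2 + N * w' + f * ((-(t * (w' ^ 2 + N * w'))) % P ^ 2))) - N * (w - w') := by ring
      rw [e]
      exact dvd_sub h2 (hN.mul_right _)
    have h4 := dvd_of_sq_sub hP.prime h3
    exact sub_eq_zero.1 (eq_zero_of_dvd_of_degree_lt h4
      (lt_of_le_of_lt (degree_sub_le _ _) (max_lt hw hw')))
  · intro c hc
    rw [Finset.mem_filter, ← degree_lt_iff_polyLT hP2] at hc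
    obtain ⟨hcd, w, hw⟩ := hc
    have h1 := shift_dvd hN (dvd_sub_mod P w) hw
    refine ⟨w % P, (degree_lt_iff_polyLT hP0).1 (EuclideanDomain.mod_lt _ hP0), ?_⟩
    refine mod_eq_of_dvd hP2 ?_ hcd
    set v := w % P
    have e : -(t * (v ^ 2 + N * v)) - c = P ^ 2 * (-(s * c)) - t * (v ^ 2 + N * v + f * c) := by
      linear_combination c * hst
    rw [e]
    exact dvd_sub (dvd_mul_right _ _) (h1.mul_left _)

lemma dvd_of_bad [CharP F 2] {P N b w : F[X]} (hP : Irreducible P) (hN : P ∣ N)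
    (hb : P ∣ b) (hw : P ^ 2 ∣ w ^ 2 + N * w + b) : P ^ 2 ∣ b := by
  have h1 : P ∣ w ^ 2 := by
    have e : w ^ 2 = (w ^ 2 + N * w + b) - N * w - b := by ring
    rw [e]
    exact dvd_sub (dvd_sub ((dvd_pow_self P two_ne_zero).trans hw) (hN.mul_right _)) hb
  have h2 : P ∣ w := hP.prime.dvd_of_dvd_pow h1
  have := shift_dvd (v := 0) hN (by simpa using h2) hw
  simpa using this

lemma card_bad_c [CharP F 2] {P N f : F[X]} (hP : Irreducible P) (hN : P ∣ N)
    (hf : ¬ P ^ 2 ∣ f) :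
    ((polyLT F (P ^ 2).natDegree).filter (fun c => ∃ w, P ^ 2 ∣ w ^ 2 + N * w + f * c)).card =
      Fintype.card F ^ P.natDegree := by
  by_cases h : P ∣ f
  · have hset : (polyLT F (P ^ 2).natDegree).filter
        (fun c => ∃ w, P ^ 2 ∣ w ^ 2 + N * w + f * c) =
        (sbox (0 : F[X]) (P ^ 2).natDegree).filter (fun c => P ∣ c - 0) := by
      ext c
      simp only [Finset.mem_filter, mem_polyLT, mem_sbox, sub_zero]
      refine and_congr_right fun _ => ?_
      constructor
      · rintro ⟨w, hw⟩
        have h1 := dvd_of_bad hP hN (h.mul_right c) hw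
        by_contra hc
        obtain ⟨g, rfl⟩ := h
        rw [pow_two, mul_assoc] at h1
        have h2 := (mul_dvd_mul_iff_left hP.ne_zero).1 h1
        rcases hP.prime.dvd_or_dvd h2 with h3 | h3
        · apply hf; rw [pow_two]; exact mul_dvd_mul_left _ h3
        · exact hc h3
      · intro hc
        refine ⟨0, ?_⟩
        rw [pow_two]
        simpa using mul_dvd_mul h hc
    rw [hset, card_sbox_res hP.ne_zero (by rw [natDegree_sq]; omega), natDegree_sq]
    congr 1; omega
  · exact card_bad_c_unit hP hN h

lemma polyLT_eq_sbox (m : ℕ) : polyLT F m = sbox 0 m := by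
  ext p; rw [mem_polyLT, mem_sbox, sub_zero]

lemma card_bad [CharP F 2] {P : F[X]} (hP : Irreducible P) :
    ((tbox (0, 0, 0) ((P ^ 2).natDegree, (P ^ 2).natDegree, (P ^ 2).natDegree)).filter
      (bad P)).card = Fintype.card F ^ P.natDegree *
        ((Fintype.card F ^ (2 * P.natDegree) - 1) * Fintype.card F ^ P.natDegree +
          Fintype.card F ^ (2 * P.natDegree)) := by
  set D := (P ^ 2).natDegree with hD
  have hP2 : P ^ 2 ≠ 0 := pow_ne_zero _ hP.ne_zero
  have hDd : D = 2 * P.natDegree := natDegree_sq P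
  rw [Finset.card_filter, tbox, Finset.sum_product]
  simp only [← polyLT_eq_sbox]
  have h1 : ∀ N ∈ polyLT F D, (∑ y ∈ polyLT F D ×ˢ polyLT F D, if bad P (N, y) then 1 else 0) =
      if P ∣ N then ((Fintype.card F ^ (2 * P.natDegree) - 1) * Fintype.card F ^ P.natDegree +
          Fintype.card F ^ (2 * P.natDegree)) else 0 := by
    intro N _
    split_ifs with hN
    · rw [Finset.sum_product]
      have h2 : ∀ f ∈ polyLT F D, (∑ c ∈ polyLT F D, if bad P (N, f, c) then 1 else 0) =
          if P ^ 2 ∣ f - 0 then Fintype.card F ^ (2 * P.natDegree)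
            else Fintype.card F ^ P.natDegree := by
        intro f _
        rw [← Finset.card_filter]
        have e : ∀ c, bad P (N, f, c) ↔ ∃ w, P ^ 2 ∣ w ^ 2 + N * w + f * c := by
          intro c; simp [bad, nonMax, hN]
        simp only [e, sub_zero]
        split_ifs with hf
        · rw [Finset.filter_true_of_mem, card_polyLT, hDd]
          intro c _
          exact ⟨0, by simpa using hf.mul_right c⟩
        · exact card_bad_c hP hN hf
      rw [Finset.sum_congr rfl h2, Finset.sum_ite, Finset.sum_const, Finset.sum_const,
        polyLT_eq_sbox, card_sbox_res hP2 le_rfl, Finset.filter_not, Finset.card_sdiff_of_subset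
          (Finset.filter_subset _ _), card_sbox_res hP2 le_rfl, card_sbox, ← hD, hDd]
      simp
      ring
    · apply Finset.sum_eq_zero
      intro y _
      simp [bad, nonMax, hN]
  rw [Finset.sum_congr rfl h1, Finset.sum_ite, Finset.sum_const_zero, add_zero, Finset.sum_const,
    polyLT_eq_sbox]
  have := card_sbox_res hP.ne_zero (m := D) (by omega) (0 : F[X]) 0
  simp only [sub_zero] at this
  rw [this, smul_eq_mul]
  congr 2; omega

lemma card_bad0 [CharP F 2] {P : F[X]} (hP : Irreducible P) :
    ((tbox (0, 0, 0) ((P ^ 2).natDegree, (P ^ 2).natDegree, (P ^ 2).natDegree)).filter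
      (bad0 P)).card = Fintype.card F ^ P.natDegree *
        (Fintype.card F ^ (2 * P.natDegree) * Fintype.card F ^ P.natDegree) := by
  set D := (P ^ 2).natDegree with hD
  have hDd : D = 2 * P.natDegree := natDegree_sq P
  rw [Finset.card_filter, tbox, Finset.sum_product]
  simp only [← polyLT_eq_sbox]
  have h1 : ∀ N ∈ polyLT F D, (∑ y ∈ polyLT F D ×ˢ polyLT F D, if bad0 P (N, y) then 1 else 0) =
      if P ∣ N then (Fintype.card F ^ (2 * P.natDegree) * Fintype.card F ^ P.natDegree) else 0 := by
    intro N _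
    split_ifs with hN
    · rw [Finset.sum_product]
      have h2 : ∀ f ∈ polyLT F D, (∑ c ∈ polyLT F D, if bad0 P (N, f, c) then 1 else 0) =
          Fintype.card F ^ P.natDegree := by
        intro f _
        rw [← Finset.card_filter]
        have e : ∀ c, bad0 P (N, f, c) ↔ ∃ w, P ^ 2 ∣ w ^ 2 + N * w + 1 * c := by
          intro c; simp [bad0, nonMax, hN]
        simp only [e]
        exact card_bad_c hP hN (fun h => hP.not_isUnit (isUnit_of_dvd_one
          ((dvd_pow_self P two_ne_zero).trans h)))
      rw [Finset.sum_congr rfl h2, Finset.sum_const, card_polyLT, smul_eq_mul, hDd]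
    · apply Finset.sum_eq_zero
      intro y _
      simp [bad0, nonMax, hN]
  rw [Finset.sum_congr rfl h1, Finset.sum_ite, Finset.sum_const_zero, add_zero, Finset.sum_const,
    polyLT_eq_sbox]
  have := card_sbox_res hP.ne_zero (m := D) (by omega) (0 : F[X]) 0
  simp only [sub_zero] at this
  rw [this, smul_eq_mul]
  congr 2; omega

/-- `|P|` as a real number -/
def pn (P : F[X]) : ℝ := (Fintype.card F : ℝ) ^ P.natDegree

lemma pn_pos (P : F[X]) : 0 < pn P := by
  have : 0 < Fintype.card F := Fintype.card_pos
  unfold pn; positivity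

lemma dens_not (M : F[X]) (φ : F[X] × F[X] × F[X] → Prop) :
    dens M (fun x => ¬ φ x) = 1 - dens M φ := by
  have hq : (Fintype.card F : ℝ) ≠ 0 := by simp
  unfold dens
  rw [eq_sub_iff_add_eq, ← add_div, div_eq_one_iff_eq (pow_ne_zero _ hq)]
  have := Finset.card_filter_add_card_filter_not (s := tbox (0, 0, 0)
    (M.natDegree, M.natDegree, M.natDegree)) φ
  rw [add_comm] at this
  rw [← Nat.cast_add]
  trans ((tbox ((0, 0, 0) : F[X] × F[X] × F[X])
    (M.natDegree, M.natDegree, M.natDegree)).card : ℝ)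
  · congr 1
    convert this
  · rw [card_tbox]
    push_cast; ring

lemma dens_good [CharP F 2] {P : F[X]} (hP : Irreducible P) :
    dens (P ^ 2) (fun x => ¬ bad P x) =
      (1 - (pn P ^ 2)⁻¹) * (1 - (pn P ^ 2 * (pn P + 1))⁻¹) := by
  rw [dens_not, dens, card_bad hP, natDegree_sq]
  have hp := pn_pos P
  have e1 : (Fintype.card F : ℝ) ^ (2 * P.natDegree) = pn P ^ 2 := by
    rw [pn, ← pow_mul, mul_comm]
  have e2 : (Fintype.card F : ℝ) ^ (3 * (2 * P.natDegree)) = pn P ^ 6 := by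
    rw [pn, ← pow_mul]; congr 1; ring
  have e3 : (Fintype.card F : ℝ) ^ P.natDegree = pn P := rfl
  have e4 : 1 ≤ Fintype.card F ^ (2 * P.natDegree) := Nat.one_le_pow _ _ Fintype.card_pos
  push_cast [Nat.cast_sub e4]
  rw [e1, e2, e3]
  field_simp
  ring

lemma dens_good0 [CharP F 2] {P : F[X]} (hP : Irreducible P) :
    dens (P ^ 2) (fun x => ¬ bad0 P x) = 1 - (pn P ^ 2)⁻¹ := by
  rw [dens_not, dens, card_bad0 hP, natDegree_sq]
  have hp := pn_pos P
  have e1 : (Fintype.card F : ℝ) ^ (2 * P.natDegree) = pn P ^ 2 := by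
    rw [pn, ← pow_mul, mul_comm]
  have e2 : (Fintype.card F : ℝ) ^ (3 * (2 * P.natDegree)) = pn P ^ 6 := by
    rw [pn, ← pow_mul]; congr 1; ring
  have e3 : (Fintype.card F : ℝ) ^ P.natDegree = pn P := rfl
  push_cast
  rw [e1, e2, e3]
  field_simp

end M3
end EvenChar

namespace EvenChar
section M4
open scoped Classical
set_option linter.unusedSectionVars false
set_option linter.unusedSimpArgs false
variable {F : Type} [Field F] [Fintype F]

/-- polynomials of degree `m` with leading coefficient `l` -/
def bx (l : F) (m : ℕ) : Finset F[X] := sbox (C l * X ^ m) m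

lemma card_bx (l : F) (m : ℕ) : (bx l m).card = Fintype.card F ^ m := card_sbox _ _

lemma mem_bx {l : F} (hl : l ≠ 0) {m : ℕ} {p : F[X]} :
    p ∈ bx l m ↔ p.natDegree = m ∧ p.leadingCoeff = l := by
  rw [bx, mem_sbox]
  have hd : (C l * X ^ m : F[X]).degree = m := degree_C_mul_X_pow m hl
  constructor
  · intro h
    have h' : (p - C l * X ^ m).degree < (C l * X ^ m : F[X]).degree := by rwa [hd]
    have hp : p = (p - C l * X ^ m) + C l * X ^ m := by ring
    refine ⟨?_, ?_⟩
    · rw [hp]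
      apply natDegree_eq_of_degree_eq_some
      rw [degree_add_eq_right_of_degree_lt h', hd]
    · rw [hp, leadingCoeff_add_of_degree_lt h', leadingCoeff_C_mul_X_pow]
  · rintro ⟨h1, h2⟩
    have hp0 : p ≠ 0 := by
      rintro rfl; simp at h2; exact hl h2.symm
    have hpd : p.degree = m := by rw [degree_eq_natDegree hp0, h1]
    rw [← hpd]
    apply degree_sub_lt _ hp0
    · rw [h2, leadingCoeff_C_mul_X_pow]
    · rw [hpd, hd]

lemma mem_bx_one {m : ℕ} {p : F[X]} : p ∈ bx (1 : F) m ↔ p.Monic ∧ p.natDegree = m := by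
  rw [mem_bx one_ne_zero]; exact and_comm

lemma card_bx_dvd {l : F} (hl : l ≠ 0) (m : ℕ) {M : F[X]} (hM : M ≠ 0) :
    (((bx l m).filter (fun p => M ∣ p)).card : ℝ) ≤ (Fintype.card F : ℝ) ^ m / pn M := by
  have hp := pn_pos M
  by_cases h : M.natDegree ≤ m
  · have := card_sbox_res hM h (C l * X ^ m) 0
    simp only [sub_zero] at this
    rw [bx, this, le_div_iff₀ hp, pn]
    push_cast
    rw [← pow_add, Nat.sub_add_cancel h]
  · rw [Finset.filter_false_of_mem]
    · simp; positivity
    · intro p hpb hd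
      rw [mem_bx hl] at hpb
      have hp0 : p ≠ 0 := by
        rintro rfl; simp at hpb; exact hl hpb.2.symm
      have := natDegree_le_of_dvd hd hp0
      omega

variable (F) in
/-- monic irreducibles of degree `d` -/
def prD (d : ℕ) : Finset F[X] := (bx (1 : F) d).filter Irreducible

lemma mem_prD {d : ℕ} {P : F[X]} : P ∈ prD F d ↔ P.Monic ∧ P.natDegree = d ∧ Irreducible P := by
  rw [prD, Finset.mem_filter, mem_bx_one, and_assoc]

lemma card_prD (d : ℕ) : d * (prD F d).card ≤ Fintype.card F ^ d := by
  rcases Nat.eq_zero_or_pos d with rfl | hd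
  · simp
  have hq : 1 < Fintype.card F := Fintype.one_lt_card
  have h1 : (∏ P ∈ prD F d, P) ∣ (X ^ (Fintype.card F) ^ d - X : F[X]) := by
    apply Finset.prod_dvd_of_isRelPrime
    · intro P hP Q hQ hne
      simp only [Finset.mem_coe, mem_prD] at hP hQ
      have : ¬ Associated P Q := fun h => hne (eq_of_monic_of_associated hP.1 hQ.1 h)
      exact ((hP.2.2.coprime_iff_not_dvd).2
        (fun h => this (hP.2.2.associated_of_dvd hQ.2.2 h))).isRelPrime
    · intro P hP
      rw [mem_prD] at hP
      have := (Irreducible.natDegree_dvd_iff_dvd_X_pow_card_pow_sub_X (k := F) (n := d) hP.2.2).1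
        (by rw [hP.2.1])
      simpa using this
  have h2 := natDegree_le_of_dvd h1 (FiniteField.X_pow_card_pow_sub_X_ne_zero _ hd.ne' hq)
  rw [FiniteField.X_pow_card_pow_sub_X_natDegree_eq _ hd.ne' hq,
    natDegree_prod_of_monic _ _ (fun P hP => (mem_prD.1 hP).1),
    Finset.sum_congr rfl (fun P hP => (mem_prD.1 hP).2.1), Finset.sum_const, smul_eq_mul,
    mul_comm] at h2
  exact h2

/-- the sample space -/
def smp (r k m : ℕ) (l : F) : Finset (F[X] × F[X] × F[X]) :=
  tbox (C 1 * X ^ r, C 1 * X ^ k, C l * X ^ m) (r, k, m)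

lemma mem_smp {r k m : ℕ} {l : F} {x : F[X] × F[X] × F[X]} :
    x ∈ smp r k m l ↔ x.1 ∈ bx 1 r ∧ x.2.1 ∈ bx 1 k ∧ x.2.2 ∈ bx l m := by
  simp [smp, tbox, bx]

lemma smp_eq (r k m : ℕ) (l : F) : smp r k m l = bx 1 r ×ˢ bx 1 k ×ˢ bx l m := by
  ext x; simp [mem_smp]

lemma card_smp (r k m : ℕ) (l : F) : ((smp r k m l).card : ℝ) =
    (Fintype.card F : ℝ) ^ r * ((Fintype.card F : ℝ) ^ k * (Fintype.card F : ℝ) ^ m) := by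
  simp [smp, card_tbox]

lemma card_bad_le [CharP F 2] {r k m : ℕ} {l : F} (hl : l ≠ 0) {P : F[X]} (hP : Irreducible P) :
    (((smp r k m l).filter (bad P)).card : ℝ) ≤
      (smp r k m l).card * (((Fintype.card F : ℝ) ^ r)⁻¹ + 4 * (pn P ^ 2)⁻¹) := by
  have hq0 : (0:ℝ) < Fintype.card F := by exact_mod_cast Fintype.card_pos (α := F)
  have hp := pn_pos P
  have hP0 := hP.ne_zero
  have hP2 : P ^ 2 ≠ 0 := pow_ne_zero _ hP0
  have hpn2 : pn (P ^ 2) = pn P ^ 2 := by rw [pn, pn, natDegree_sq, ← pow_mul, mul_comm]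
  set U1 := (smp r k m l).filter (fun x => bad P x ∧ ¬ P ∣ x.2.1 * x.2.2) with hU1
  set U2 := bx (1:F) r ×ˢ (bx (1:F) k).filter (fun f => P ^ 2 ∣ f) ×ˢ bx l m with hU2
  set U3 := bx (1:F) r ×ˢ bx (1:F) k ×ˢ (bx l m).filter (fun f => P ^ 2 ∣ f) with hU3
  set U4 := bx (1:F) r ×ˢ (bx (1:F) k).filter (fun f => P ∣ f) ×ˢ
    (bx l m).filter (fun f => P ∣ f) with hU4
  have hsub : (smp r k m l).filter (bad P) ⊆ U1 ∪ (U2 ∪ (U3 ∪ U4)) := by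
    intro x hx
    rw [Finset.mem_filter] at hx
    obtain ⟨hx, hb⟩ := hx
    have hx' := mem_smp.1 hx
    by_cases h : P ∣ x.2.1 * x.2.2
    · obtain ⟨hN, w, hw⟩ := hb
      have h1 := dvd_of_bad hP hN h hw
      apply Finset.mem_union_right
      rw [Finset.mem_union, Finset.mem_union]
      simp only [hU2, hU3, hU4, Finset.mem_product, Finset.mem_filter]
      by_cases hf : P ∣ x.2.1
      · by_cases hc : P ∣ x.2.2
        · right; right; exact ⟨hx'.1, ⟨hx'.2.1, hf⟩, ⟨hx'.2.2, hc⟩⟩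
        · left
          have : IsCoprime (P ^ 2) x.2.2 :=
            IsCoprime.pow_left ((hP.coprime_iff_not_dvd).2 hc)
          exact ⟨hx'.1, ⟨hx'.2.1, this.dvd_of_dvd_mul_right h1⟩, hx'.2.2⟩
      · right; left
        have : IsCoprime (P ^ 2) x.2.1 :=
            IsCoprime.pow_left ((hP.coprime_iff_not_dvd).2 hf)
        exact ⟨hx'.1, hx'.2.1, ⟨hx'.2.2, this.dvd_of_dvd_mul_left h1⟩⟩
    · apply Finset.mem_union_left
      rw [hU1, Finset.mem_filter]
      exact ⟨hx, hb, h⟩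
  have hc1 : (U1.card : ℝ) ≤ (1 + (Fintype.card F : ℝ) ^ r / pn P ^ 2) *
      ((Fintype.card F : ℝ) ^ k * (Fintype.card F : ℝ) ^ m) := by
    have hfib : ∀ a ∈ U1.image Prod.snd, (U1.filter (fun x => x.2 = a)).card ≤
        Fintype.card F ^ (r - (P ^ 2).natDegree) := by
      intro a ha
      obtain ⟨x0, hx0, rfl⟩ := Finset.mem_image.1 ha
      rw [hU1, Finset.mem_filter] at hx0
      obtain ⟨_, ⟨hN0, w0, hw0⟩, hnd⟩ := hx0
      have h1 : (U1.filter (fun x => x.2 = x0.2)).card ≤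
          ((sbox (C 1 * X ^ r) r).filter (fun p => P ^ 2 ∣ p - x0.1)).card := by
        apply Finset.card_le_card_of_injOn Prod.fst
        · intro x hx
          simp only [Finset.coe_filter, Set.mem_setOf_eq, hU1, Finset.mem_filter] at hx ⊢
          obtain ⟨⟨hx, ⟨hN, w, hw⟩, _⟩, he⟩ := hx
          refine ⟨(mem_smp.1 hx).1, ?_⟩
          rw [he] at hw
          set b := x0.2.1 * x0.2.2
          have h3 : P ∣ w ^ 2 - w0 ^ 2 := by
            have e : w ^ 2 - w0 ^ 2 = (w ^ 2 + x.1 * w + b) - (w0 ^ 2 + x0.1 * w0 + b)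
              - x.1 * w + x0.1 * w0 := by ring
            rw [e]
            exact dvd_add (dvd_sub (dvd_sub ((dvd_pow_self P two_ne_zero).trans hw)
              ((dvd_pow_self P two_ne_zero).trans hw0)) (hN.mul_right _)) (hN0.mul_right _)
          have h4 := dvd_of_sq_sub hP.prime h3
          have h5 := shift_dvd hN h4 hw
          have h6 : P ^ 2 ∣ (x.1 - x0.1) * w0 := by
            have := dvd_sub h5 hw0
            convert this using 1; ring
          have h7 : ¬ P ∣ w0 := by
            intro h
            apply hnd
            have e : b = (w0 ^ 2 + x0.1 * w0 + b) - (w0 ^ 2 + x0.1 * w0) := by ring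
            rw [e]
            exact dvd_sub ((dvd_pow_self P two_ne_zero).trans hw0)
              (dvd_add (dvd_pow h two_ne_zero) (h.mul_left _))
          exact (IsCoprime.pow_left ((hP.coprime_iff_not_dvd).2 h7)).dvd_of_dvd_mul_right h6
        · intro x hx y hy hxy
          simp only [Finset.coe_filter, Set.mem_setOf_eq] at hx hy
          exact Prod.ext hxy (hx.2.trans hy.2.symm)
      refine h1.trans ?_
      by_cases h : (P ^ 2).natDegree ≤ r
      · rw [card_sbox_res hP2 h]
      · refine (card_sbox_res_le_one (by omega) hP2 _ _).trans ?_
        exact Nat.one_le_pow _ _ Fintype.card_pos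
    have h2 := Finset.card_le_mul_card_image U1 _ hfib
    have h3 : (U1.image Prod.snd).card ≤ Fintype.card F ^ k * Fintype.card F ^ m := by
      rw [← card_bx (1:F) k, ← card_bx l m, ← Finset.card_product]
      apply Finset.card_le_card
      intro y hy
      obtain ⟨x, hx, rfl⟩ := Finset.mem_image.1 hy
      rw [hU1, Finset.mem_filter] at hx
      rw [Finset.mem_product]
      exact (mem_smp.1 hx.1).2
    have h4 : ((Fintype.card F ^ (r - (P ^ 2).natDegree) : ℕ) : ℝ) ≤
        1 + (Fintype.card F : ℝ) ^ r / pn P ^ 2 := by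
      rw [← hpn2, pn]
      by_cases h : (P ^ 2).natDegree ≤ r
      · push_cast
        rw [pow_sub₀ _ hq0.ne' h, div_eq_mul_inv]
        linarith
      · rw [Nat.sub_eq_zero_of_le (by omega)]
        have : 0 ≤ (Fintype.card F : ℝ) ^ r / (Fintype.card F : ℝ) ^ (P ^ 2).natDegree := by
          positivity
        simpa using this
    calc (U1.card : ℝ) ≤ ((Fintype.card F ^ (r - (P ^ 2).natDegree) : ℕ) : ℝ) *
          ((U1.image Prod.snd).card : ℝ) := by exact_mod_cast h2
      _ ≤ _ := by
          apply mul_le_mul h4 _ (by positivity) (by positivity)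
          exact_mod_cast h3
  have hQ : ∀ j : ℕ, (0:ℝ) ≤ (Fintype.card F : ℝ) ^ j := fun j => by positivity
  have hc2 : (U2.card : ℝ) ≤ (Fintype.card F : ℝ) ^ r *
      ((Fintype.card F : ℝ) ^ k / pn P ^ 2 * (Fintype.card F : ℝ) ^ m) := by
    rw [hU2, Finset.card_product, Finset.card_product, card_bx, card_bx]
    push_cast
    have := card_bx_dvd (one_ne_zero (α := F)) k hP2
    rw [hpn2] at this
    gcongr
  have hc3 : (U3.card : ℝ) ≤ (Fintype.card F : ℝ) ^ r *
      ((Fintype.card F : ℝ) ^ k * ((Fintype.card F : ℝ) ^ m / pn P ^ 2)) := by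
    rw [hU3, Finset.card_product, Finset.card_product, card_bx, card_bx]
    push_cast
    have := card_bx_dvd hl m hP2
    rw [hpn2] at this
    gcongr
  have hc4 : (U4.card : ℝ) ≤ (Fintype.card F : ℝ) ^ r *
      ((Fintype.card F : ℝ) ^ k / pn P * ((Fintype.card F : ℝ) ^ m / pn P)) := by
    rw [hU4, Finset.card_product, Finset.card_product, card_bx]
    push_cast
    have h1 := card_bx_dvd hl m hP0
    have h2 := card_bx_dvd (one_ne_zero (α := F)) k hP0
    gcongr
  have hall : (((smp r k m l).filter (bad P)).card : ℝ) ≤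
      U1.card + (U2.card + (U3.card + U4.card)) := by
    have := (Finset.card_le_card hsub).trans ((Finset.card_union_le _ _).trans
      (Nat.add_le_add_left ((Finset.card_union_le _ _).trans
        (Nat.add_le_add_left (Finset.card_union_le _ _) _)) _))
    exact_mod_cast this
  refine hall.trans ((add_le_add hc1 (add_le_add hc2 (add_le_add hc3 hc4))).trans (le_of_eq ?_))
  rw [card_smp]
  field_simp
  ring

lemma bad_deg_le {r k m : ℕ} {l : F} {P : F[X]} {x : F[X] × F[X] × F[X]}
    (hx : x ∈ smp r k m l) (hb : bad P x) : P.natDegree ≤ r := by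
  have h1 := mem_bx_one.1 (mem_smp.1 hx).1
  rw [← h1.2]
  exact natDegree_le_of_dvd hb.1 h1.1.ne_zero

/-- good triples -/
def good (x : F[X] × F[X] × F[X]) : Prop := ∀ P : F[X], P.Monic → Irreducible P → ¬ bad P x

variable (F) in
/-- monic irreducibles of degree at most `Y`. -/
def prLE (Y : ℕ) : Finset F[X] := (Finset.range (Y + 1)).biUnion (prD F)

lemma mem_prLE {Y : ℕ} {P : F[X]} :
    P ∈ prLE F Y ↔ P.Monic ∧ P.natDegree ≤ Y ∧ Irreducible P := by
  simp only [prLE, Finset.mem_biUnion, Finset.mem_range, mem_prD]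
  constructor
  · rintro ⟨d, hd, h1, h2, h3⟩; exact ⟨h1, by omega, h3⟩
  · rintro ⟨h1, h2, h3⟩; exact ⟨_, by omega, h1, rfl, h3⟩

/-- error term -/
def errT (q : ℝ) (Y r : ℕ) : ℝ := ∑ d ∈ Finset.Ioc Y r, q ^ d / d * ((q ^ r)⁻¹ + 4 * ((q ^ d) ^ 2)⁻¹)

lemma sieve [CharP F 2] {r k m : ℕ} {l : F} (hl : l ≠ 0) (Y : ℕ) :
    |(((smp r k m l).filter good).card : ℝ) -
      (((smp r k m l).filter (fun x => ∀ P ∈ prLE F Y, ¬ bad P x)).card : ℝ)| ≤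
      (smp r k m l).card * errT (Fintype.card F) Y r := by
  have hq0 : (0:ℝ) < Fintype.card F := by exact_mod_cast Fintype.card_pos (α := F)
  set A := (smp r k m l).filter good
  set B := (smp r k m l).filter (fun x => ∀ P ∈ prLE F Y, ¬ bad P x)
  have hAB : A ⊆ B := by
    intro x hx
    rw [Finset.mem_filter] at hx ⊢
    exact ⟨hx.1, fun P hP => hx.2 P (mem_prLE.1 hP).1 (mem_prLE.1 hP).2.2⟩
  have hBA : B \ A ⊆ (Finset.Ioc Y r).biUnion
      (fun d => (prD F d).biUnion (fun P => (smp r k m l).filter (bad P))) := by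
    intro x hx
    rw [Finset.mem_sdiff, Finset.mem_filter, Finset.mem_filter] at hx
    obtain ⟨⟨hx, h1⟩, h2⟩ := hx
    have h3 : ¬ good x := fun h => h2 ⟨hx, h⟩
    unfold good at h3
    push Not at h3
    obtain ⟨P, hPm, hPi, hb⟩ := h3
    have hdeg := bad_deg_le hx hb
    have hY : Y < P.natDegree := by
      by_contra hY
      exact h1 P (mem_prLE.2 ⟨hPm, by omega, hPi⟩) hb
    simp only [Finset.mem_biUnion, Finset.mem_Ioc, mem_prD, Finset.mem_filter]
    exact ⟨_, ⟨hY, hdeg⟩, P, ⟨hPm, rfl, hPi⟩, hx, hb⟩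
  have hcard : ((B \ A).card : ℝ) ≤ (smp r k m l).card * errT (Fintype.card F) Y r := by
    have h1 : ((B \ A).card : ℝ) ≤ ∑ d ∈ Finset.Ioc Y r, ∑ P ∈ prD F d,
        (((smp r k m l).filter (bad P)).card : ℝ) := by
      have := (Finset.card_le_card hBA).trans (Finset.card_biUnion_le.trans
        (Finset.sum_le_sum (fun d _ => Finset.card_biUnion_le)))
      exact_mod_cast this
    refine h1.trans ?_
    rw [errT, Finset.mul_sum]
    apply Finset.sum_le_sum
    intro d hd
    have hd0 : 0 < d := by have := (Finset.mem_Ioc.1 hd).1; omega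
    have h2 : ∀ P ∈ prD F d, (((smp r k m l).filter (bad P)).card : ℝ) ≤
      (smp r k m l).card * (((Fintype.card F : ℝ) ^ r)⁻¹ +
        4 * (((Fintype.card F : ℝ) ^ d) ^ 2)⁻¹) := by
      intro P hP
      rw [mem_prD] at hP
      have := card_bad_le (r := r) (k := k) (m := m) hl hP.2.2
      rwa [pn, hP.2.1] at this
    refine (Finset.sum_le_sum h2).trans ?_
    rw [Finset.sum_const, nsmul_eq_mul]
    have h3 : ((prD F d).card : ℝ) ≤ (Fintype.card F : ℝ) ^ d / d := by
      rw [le_div_iff₀ (by exact_mod_cast hd0), mul_comm]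
      exact_mod_cast card_prD d
    rw [mul_left_comm]
    gcongr
  rw [abs_sub_comm, abs_of_nonneg]
  · have := Finset.card_sdiff_add_card_eq_card hAB
    have h : (B.card : ℝ) - A.card = (B \ A).card := by
      rw [← this]; push_cast; ring
    rw [h]; exact hcard
  · have := Finset.card_le_card hAB
    simpa using this

lemma aux_sum (q : ℝ) (hq : 2 ≤ q) (r : ℕ) :
    (∑ d ∈ Finset.Icc 1 (r + 1), q ^ d / d) * (q ^ (r + 1))⁻¹ ≤ 4 / ((r : ℝ) + 1) := by
  have hq0 : 0 < q := by linarith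
  induction r with
  | zero => simp; rw [mul_inv_cancel₀ hq0.ne']; norm_num
  | succ r ih =>
    rw [Finset.sum_Icc_succ_top (by omega), add_mul]
    set s := ∑ d ∈ Finset.Icc 1 (r + 1), q ^ d / (d : ℝ) with hs
    have h1 : s * (q ^ (r + 1 + 1))⁻¹ = s * (q ^ (r + 1))⁻¹ * q⁻¹ := by
      rw [pow_succ q (r + 1), mul_inv]; ring
    have h2 : q ^ (r + 1 + 1) / ((r + 1 + 1 : ℕ) : ℝ) * (q ^ (r + 1 + 1))⁻¹ =
        1 / ((r : ℝ) + 2) := by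
      push_cast; field_simp; ring
    rw [h1, h2]
    have hs0 : 0 ≤ s * (q ^ (r + 1))⁻¹ := by positivity
    have h3 : q⁻¹ ≤ 1 / 2 := by rw [inv_le_comm₀ hq0 (by norm_num)]; linarith
    rcases Nat.eq_zero_or_pos r with rfl | hr
    · have hs1 : s = q := by simp [hs]
      rw [hs1]
      simp
      rw [mul_inv_cancel₀ hq0.ne']
      norm_num at h3 ⊢
      linarith
    · have hr' : (1 : ℝ) ≤ r := by exact_mod_cast hr
      have h4 : s * (q ^ (r + 1))⁻¹ * q⁻¹ ≤ 4 / ((r : ℝ) + 1) * (1 / 2) := by gcongr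
      refine (add_le_add_left h4 _).trans ?_
      push_cast
      rw [div_mul_div_comm, div_add_div _ _ (by positivity) (by positivity),
        div_le_div_iff₀ (by positivity) (by positivity)]
      nlinarith

lemma geo_tail (q : ℝ) (hq : 2 ≤ q) (Y r : ℕ) :
    ∑ d ∈ Finset.Ioc Y r, (q ^ d)⁻¹ ≤ (q ^ Y)⁻¹ := by
  have hq0 : 0 < q := by linarith
  suffices h : ∀ j, ∑ d ∈ Finset.Ioc Y (Y + j), (q ^ d)⁻¹ ≤ (q ^ Y)⁻¹ - (q ^ (Y + j))⁻¹ by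
    rcases le_total Y r with h1 | h1
    · obtain ⟨j, rfl⟩ := Nat.exists_eq_add_of_le h1
      refine (h j).trans ?_
      have : 0 ≤ (q ^ (Y + j))⁻¹ := by positivity
      linarith
    · rw [Finset.Ioc_eq_empty (by omega)]; simp; positivity
  intro j
  induction j with
  | zero => simp
  | succ j ih =>
    rw [← add_assoc, Finset.sum_Ioc_succ_top (by omega)]
    refine (add_le_add_left ih _).trans ?_
    have h1 : (q ^ (Y + j))⁻¹ = q * (q ^ (Y + j + 1))⁻¹ := by
      rw [pow_succ]; field_simp
    rw [h1]
    have : 0 < (q ^ (Y + j + 1))⁻¹ := by positivity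
    nlinarith

lemma errT_le (q : ℝ) (hq : 2 ≤ q) (Y r : ℕ) : errT q Y (r + 1) ≤ 4 / ((r : ℝ) + 1) + 4 * (q ^ Y)⁻¹ := by
  have hq0 : 0 < q := by linarith
  unfold errT
  have h1 : ∀ d ∈ Finset.Ioc Y (r + 1), q ^ d / d * ((q ^ (r + 1))⁻¹ + 4 * ((q ^ d) ^ 2)⁻¹) ≤
      q ^ d / d * (q ^ (r + 1))⁻¹ + 4 * (q ^ d)⁻¹ := by
    intro d hd
    have hd0 : 1 ≤ d := by have := (Finset.mem_Ioc.1 hd).1; omega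
    have hd1 : (1 : ℝ) ≤ d := by exact_mod_cast hd0
    rw [mul_add]
    refine add_le_add le_rfl ?_
    have : q ^ d / d * (4 * ((q ^ d) ^ 2)⁻¹) = 4 * (q ^ d)⁻¹ / d := by
      field_simp
    rw [this]
    exact div_le_self (by positivity) hd1
  refine (Finset.sum_le_sum h1).trans ?_
  rw [Finset.sum_add_distrib, ← Finset.mul_sum, ← Finset.sum_mul]
  gcongr
  · refine le_trans ?_ (aux_sum q hq r)
    gcongr
    intro d hd
    rw [Finset.mem_Ioc] at hd
    rw [Finset.mem_Icc]; omega
  · exact geo_tail q hq _ _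

end M4
end EvenChar

namespace EvenChar
section M5
open scoped Classical
set_option linter.unusedSectionVars false
set_option linter.unusedSimpArgs false
variable {F : Type} [Field F] [Fintype F]

variable (F) in
/-- monic primes -/
abbrev Pr : Type := {P : F[X] // P.Monic ∧ Irreducible P}

lemma two_le_card : (2 : ℝ) ≤ Fintype.card F := by
  have : 1 < Fintype.card F := Fintype.one_lt_card
  exact_mod_cast this

lemma two_le_pn {P : F[X]} (hP : Irreducible P) : 2 ≤ pn P := by
  have h := hP.natDegree_pos
  have h2 := two_le_card (F := F)
  unfold pn
  calc (2 : ℝ) ≤ Fintype.card F := h2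
    _ = (Fintype.card F : ℝ) ^ 1 := (pow_one _).symm
    _ ≤ _ := pow_le_pow_right₀ (by linarith) h

/-- primes of degree at most `Y`, in the subtype -/
def prS (Y : ℕ) : Finset (Pr F) := (prLE F Y).subtype _

lemma mem_prS {Y : ℕ} {P : Pr F} : P ∈ prS Y ↔ P.1.natDegree ≤ Y := by
  rw [prS, Finset.mem_subtype, mem_prLE]
  exact ⟨fun h => h.2.1, fun h => ⟨P.2.1, h, P.2.2⟩⟩

lemma prS_tendsto : Filter.Tendsto (prS (F := F)) Filter.atTop Filter.atTop := by
  apply Filter.tendsto_atTop_finset_of_monotone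
  · intro a b hab P hP
    rw [mem_prS] at *
    omega
  · intro P
    exact ⟨_, mem_prS.2 le_rfl⟩

lemma prod_prLE (f : F[X] → ℝ) (Y : ℕ) : ∏ P ∈ prLE F Y, f P = ∏ P ∈ prS Y, f P.1 := by
  symm
  apply Finset.prod_subtype_of_mem
  intro x hx
  rw [mem_prLE] at hx
  exact ⟨hx.1, hx.2.2⟩

lemma sum_prLE (f : F[X] → ℝ) (Y : ℕ) : ∑ P ∈ prLE F Y, f P = ∑ P ∈ prS Y, f P.1 := by
  symm
  apply Finset.sum_subtype_of_mem
  intro x hx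
  rw [mem_prLE] at hx
  exact ⟨hx.1, hx.2.2⟩

lemma summable_pn : Summable (fun P : Pr F => (pn P.1 ^ 2)⁻¹) := by
  have hq := two_le_card (F := F)
  have hq0 : (0 : ℝ) < Fintype.card F := by linarith
  apply summable_of_sum_le (c := 2)
  · intro P
    have := pn_pos P.1
    positivity
  · intro u
    obtain ⟨Y, hY⟩ : ∃ Y, u ⊆ prS Y :=
      ((prS_tendsto (F := F)).eventually (Filter.eventually_ge_atTop u)).exists
    refine (Finset.sum_le_sum_of_subset_of_nonneg hY ?_).trans ?_
    · intro P _ _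
      have := pn_pos P.1
      positivity
    rw [← sum_prLE (fun P => (pn P ^ 2)⁻¹), prLE, Finset.sum_biUnion]
    · have h1 : ∀ d ∈ Finset.range (Y + 1), ∑ P ∈ prD F d, (pn P ^ 2)⁻¹ ≤ (1 / 2 : ℝ) ^ d := by
        intro d _
        have : ∀ P ∈ prD F d, (pn P ^ 2)⁻¹ = (((Fintype.card F : ℝ) ^ d) ^ 2)⁻¹ := by
          intro P hP
          rw [pn, (mem_prD.1 hP).2.1]
        rw [Finset.sum_congr rfl this, Finset.sum_const, nsmul_eq_mul]
        have hc : ((prD F d).card : ℝ) ≤ (Fintype.card F : ℝ) ^ d := by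
          rcases Nat.eq_zero_or_pos d with rfl | hd
          · have : prD F 0 = ∅ := by
              apply Finset.eq_empty_of_forall_notMem
              intro P hP
              rw [mem_prD] at hP
              have := hP.2.2.natDegree_pos
              omega
            simp [this]
          · have := card_prD (F := F) d
            have h2 : (prD F d).card ≤ Fintype.card F ^ d := by nlinarith
            exact_mod_cast h2
        calc _ ≤ (Fintype.card F : ℝ) ^ d * (((Fintype.card F : ℝ) ^ d) ^ 2)⁻¹ := by gcongr
          _ = (1 / (Fintype.card F : ℝ)) ^ d := by rw [one_div, inv_pow]; field_simp
          _ ≤ _ := by gcongr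
      refine (Finset.sum_le_sum h1).trans ?_
      exact sum_geometric_two_le _
    · intro a _ b _ hab
      rw [Function.onFun, Finset.disjoint_left]
      intro P h1 h2
      rw [mem_prD] at h1 h2
      exact hab (h1.2.1.symm.trans h2.2.1)

variable (F) in
/-- local density product -/
def rho0 : ℝ := ∏' P : Pr F, (1 - (pn P.1 ^ 2)⁻¹)

variable (F) in
lemma eulerPR_eq : eulerPR F 2 = ∏' P : Pr F, (1 - (pn P.1 ^ 2 * (pn P.1 + 1))⁻¹) := by
  unfold eulerPR
  refine tprod_congr fun P => ?_
  rw [Real.rpow_natCast, Real.rpow_two]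
  rfl

lemma loc_le (P : Pr F) : (pn P.1 ^ 2 * (pn P.1 + 1))⁻¹ ≤ (pn P.1 ^ 2)⁻¹ := by
  have := pn_pos P.1
  gcongr
  nlinarith [sq_nonneg (pn P.1)]

lemma loc_lt (P : Pr F) : (pn P.1 ^ 2)⁻¹ < 1 := by
  have := two_le_pn P.2.2
  apply inv_lt_one_of_one_lt₀
  nlinarith

lemma summable1 : Summable (fun P : Pr F => ‖-(pn P.1 ^ 2)⁻¹‖) := by
  simpa using (summable_pn (F := F)).norm

lemma summable2 : Summable (fun P : Pr F => ‖-(pn P.1 ^ 2 * (pn P.1 + 1))⁻¹‖) := by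
  refine Summable.of_nonneg_of_le (fun P => norm_nonneg _) (fun P => ?_) (summable_pn (F := F))
  have := pn_pos P.1
  rw [norm_neg, Real.norm_of_nonneg (by positivity)]
  exact loc_le P

lemma rho0_ne : rho0 F ≠ 0 := by
  have := tprod_one_add_ne_zero_of_summable (f := fun P : Pr F => -(pn P.1 ^ 2)⁻¹)
    (fun P => by have := loc_lt P; linarith) summable1
  simpa [rho0, sub_eq_add_neg] using this

lemma euler_ne : eulerPR F 2 ≠ 0 := by
  have := tprod_one_add_ne_zero_of_summable (f := fun P : Pr F => -(pn P.1 ^ 2 * (pn P.1 + 1))⁻¹)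
    (fun P => by have := loc_lt P; have := loc_le P; linarith) summable2
  rw [eulerPR_eq]
  simpa [sub_eq_add_neg] using this

lemma hasProd0 : HasProd (fun P : Pr F => 1 - (pn P.1 ^ 2)⁻¹) (rho0 F) := by
  have := (multipliable_one_add_of_summable (f := fun P : Pr F => -(pn P.1 ^ 2)⁻¹) summable1).hasProd
  simpa [rho0, sub_eq_add_neg] using this

lemma hasProd1 : HasProd (fun P : Pr F => 1 - (pn P.1 ^ 2 * (pn P.1 + 1))⁻¹) (eulerPR F 2) := by
  have := (multipliable_one_add_of_summable
    (f := fun P : Pr F => -(pn P.1 ^ 2 * (pn P.1 + 1))⁻¹) summable2).hasProd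
  rw [eulerPR_eq]
  simpa [sub_eq_add_neg] using this

lemma lim0 : Filter.Tendsto (fun Y => ∏ P ∈ prLE F Y, (1 - (pn P ^ 2)⁻¹)) Filter.atTop
    (nhds (rho0 F)) := by
  have := (hasProd0 (F := F)).comp prS_tendsto
  refine this.congr fun Y => ?_
  rw [prod_prLE]; rfl

lemma lim1 : Filter.Tendsto (fun Y => ∏ P ∈ prLE F Y,
    ((1 - (pn P ^ 2)⁻¹) * (1 - (pn P ^ 2 * (pn P + 1))⁻¹))) Filter.atTop
    (nhds (rho0 F * eulerPR F 2)) := by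
  have := ((hasProd0 (F := F)).mul hasProd1).comp prS_tendsto
  refine this.congr fun Y => ?_
  rw [prod_prLE]; rfl

/-- proportion of good triples -/
def Gc (r k m : ℕ) (l : F) : ℝ := (((smp r k m l).filter good).card : ℝ) / (smp r k m l).card

lemma card_smp_pos (r k m : ℕ) (l : F) : (0 : ℝ) < (smp r k m l).card := by
  have hq := two_le_card (F := F)
  rw [card_smp]; positivity

lemma Gc_nonneg (r k m : ℕ) (l : F) : 0 ≤ Gc r k m l := by
  unfold Gc; positivity

lemma Gc_le_one (r k m : ℕ) (l : F) : Gc r k m l ≤ 1 := by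
  unfold Gc
  rw [div_le_one (card_smp_pos r k m l)]
  exact_mod_cast Finset.card_filter_le _ _

lemma coprime_sq {P Q : F[X]} {Y : ℕ} (hP : P ∈ prLE F Y) (hQ : Q ∈ prLE F Y) (hne : P ≠ Q) :
    IsCoprime (P ^ 2) (Q ^ 2) := by
  rw [mem_prLE] at hP hQ
  apply IsCoprime.pow
  refine (hP.2.2.coprime_iff_not_dvd).2 fun h => hne ?_
  exact eq_of_monic_of_associated hP.1 hQ.1 (hP.2.2.associated_of_dvd hQ.2.2 h)

lemma main_term [CharP F 2] (φ : F[X] → F[X] × F[X] × F[X] → Prop)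
    (hφ : ∀ P, ∀ y z, tcong (P ^ 2) y z → (φ P y → φ P z)) (Y : ℕ) :
    ∃ K, ∀ r k m, K ≤ r → K ≤ k → K ≤ m → ∀ l : F,
      (((smp r k m l).filter (fun x => ∀ P ∈ prLE F Y, ¬ φ P x)).card : ℝ) =
       (smp r k m l).card * ∏ P ∈ prLE F Y, dens (P ^ 2) (fun x => ¬ φ P x) := by
  refine ⟨∑ P ∈ prLE F Y, (P ^ 2).natDegree, fun r k m hr hk hm l => ?_⟩
  have := dens_main (C 1 * X ^ r, C 1 * X ^ k, C l * X ^ m) (r, k, m) (fun P => P ^ 2)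
    (fun P x => ¬ φ P x) (prLE F Y) (fun P hP => pow_ne_zero _ (mem_prLE.1 hP).2.2.ne_zero)
    (fun P hP Q hQ hne => coprime_sq hP hQ hne)
    (fun P hP y z h h1 h2 => h1 (hφ P z y h.symm h2)) 1 (0, 0, 0) one_ne_zero
    (fun P _ => isCoprime_one_left) (by simpa using hr) (by simpa using hk) (by simpa using hm)
  simp only [natDegree_one, mul_zero, pow_zero, div_one] at this
  rw [smp, ← this]
  congr 2
  ext x
  simp [tcong]

lemma err_small : ∀ ε > 0, ∃ Y₀ : ℕ, ∀ Y ≥ Y₀, ∃ K : ℕ, ∀ r ≥ K,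
    errT (Fintype.card F) Y r ≤ ε := by
  intro ε hε
  have hq := two_le_card (F := F)
  have h1 : Filter.Tendsto (fun Y : ℕ => 4 * ((Fintype.card F : ℝ) ^ Y)⁻¹) Filter.atTop (nhds 0) := by
    have := (tendsto_pow_atTop_nhds_zero_of_lt_one (r := (Fintype.card F : ℝ)⁻¹) (by positivity)
      (inv_lt_one_of_one_lt₀ (by linarith))).const_mul 4
    simpa [inv_pow] using this
  have h2 : Filter.Tendsto (fun r : ℕ => 4 / ((r : ℝ) + 1)) Filter.atTop (nhds 0) := by
    have := (tendsto_one_div_add_atTop_nhds_zero_nat (𝕜 := ℝ)).const_mul 4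
    simpa [div_eq_mul_inv] using this
  obtain ⟨Y₀, hY⟩ := Filter.eventually_atTop.1 (h1.eventually (gt_mem_nhds (half_pos hε)))
  obtain ⟨K, hK⟩ := Filter.eventually_atTop.1 (h2.eventually (gt_mem_nhds (half_pos hε)))
  refine ⟨Y₀, fun Y hYY => ⟨K + 1, fun r hr => ?_⟩⟩
  obtain ⟨r, rfl⟩ : ∃ r', r = r' + 1 := ⟨r - 1, by omega⟩
  have := errT_le _ hq Y r
  have := hY Y hYY
  have := hK r (by omega)
  linarith

lemma Gc_sieve [CharP F 2] {r k m : ℕ} {l : F} (hl : l ≠ 0) (Y : ℕ) {x : ℝ}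
    (hx : (((smp r k m l).filter (fun x => ∀ P ∈ prLE F Y, ¬ bad P x)).card : ℝ) =
      (smp r k m l).card * x) : |Gc r k m l - x| ≤ errT (Fintype.card F) Y r := by
  have h := sieve (r := r) (k := k) (m := m) hl Y
  have h0 := card_smp_pos r k m l
  rw [hx] at h
  have e : Gc r k m l - x = ((((smp r k m l).filter good).card : ℝ) - (smp r k m l).card * x) /
      (smp r k m l).card := by
    unfold Gc; field_simp
  rw [e, abs_div, abs_of_pos h0, div_le_iff₀ h0, mul_comm (errT _ _ _)]
  exact h

theorem Gc_lim [CharP F 2] : ∀ ε > 0, ∃ K, ∀ r k m, K ≤ r → K ≤ k → K ≤ m → ∀ l : F, l ≠ 0 →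
    |Gc r k m l - rho0 F * eulerPR F 2| ≤ ε := by
  intro ε hε
  obtain ⟨Y₀, h0⟩ := err_small (F := F) _ (half_pos hε)
  obtain ⟨Y₁, h1⟩ := Metric.tendsto_atTop.1 (lim1 (F := F)) _ (half_pos hε)
  obtain ⟨K₀, h0⟩ := h0 (max Y₀ Y₁) (le_max_left _ _)
  have h1 := h1 (max Y₀ Y₁) (le_max_right _ _)
  set Y := max Y₀ Y₁
  obtain ⟨K₁, h2⟩ := main_term (F := F) bad (fun P y z => bad_congr) Y
  refine ⟨max K₀ K₁, fun r k m hr hk hm l hl => ?_⟩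
  have h3 := Gc_sieve hl Y (h2 r k m (by omega) (by omega) (by omega) l)
  rw [Finset.prod_congr rfl (fun P hP => dens_good (mem_prLE.1 hP).2.2)] at h3
  have h4 := h0 r (by omega)
  rw [Real.dist_eq] at h1
  have := abs_sub_le (Gc r k m l) _ (rho0 F * eulerPR F 2) |>.trans (add_le_add h3 h1.le)
  linarith

theorem Gc0_lim [CharP F 2] : ∀ ε > 0, ∃ K, ∀ r m, K ≤ r → K ≤ m → ∀ l : F, l ≠ 0 →
    |Gc r 0 m l - rho0 F| ≤ ε := by
  intro ε hε
  obtain ⟨Y₀, h0⟩ := err_small (F := F) _ (half_pos hε)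
  obtain ⟨Y₁, h1⟩ := Metric.tendsto_atTop.1 (lim0 (F := F)) _ (half_pos hε)
  obtain ⟨K₀, h0⟩ := h0 (max Y₀ Y₁) (le_max_left _ _)
  have h1 := h1 (max Y₀ Y₁) (le_max_right _ _)
  set Y := max Y₀ Y₁
  obtain ⟨K₁, h2⟩ := main_term (F := F) bad0 (fun P y z => bad0_congr) Y
  refine ⟨max K₀ K₁, fun r m hr hm l hl => ?_⟩
  have h2 := h2 r K₁ m (by omega) le_rfl (by omega) l
  have key : (((smp r 0 m l).filter (fun x => ∀ P ∈ prLE F Y, ¬ bad P x)).card : ℝ) *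
      (Fintype.card F : ℝ) ^ K₁ =
      ((smp r K₁ m l).filter (fun x => ∀ P ∈ prLE F Y, ¬ bad0 P x)).card := by
    have e1 : (smp r 0 m l).filter (fun x => ∀ P ∈ prLE F Y, ¬ bad P x) =
        ((bx 1 r ×ˢ bx l m).filter (fun x => ∀ P ∈ prLE F Y, ¬ nonMax P x.1 x.2)).image
          (fun x => (x.1, 1, x.2)) := by
      ext ⟨a, b, c⟩
      rw [Finset.mem_filter]
      simp only [Finset.mem_filter, mem_smp, Finset.mem_image, Finset.mem_product, Prod.exists,
        Prod.mk.injEq, mem_bx_one (m := 0), bad]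
      constructor
      · rintro ⟨⟨h1, ⟨h2, h3⟩, h4⟩, h5⟩
        have : b = 1 := h2.natDegree_eq_zero.1 h3
        subst this
        exact ⟨a, c, ⟨⟨h1, h4⟩, by simpa using h5⟩, rfl, rfl, rfl⟩
      · rintro ⟨a', c', ⟨⟨h1, h4⟩, h5⟩, rfl, rfl, rfl⟩
        exact ⟨⟨h1, ⟨monic_one, natDegree_one⟩, h4⟩, by simpa using h5⟩
    have e2 : (smp r K₁ m l).filter (fun x => ∀ P ∈ prLE F Y, ¬ bad0 P x) =
        ((((bx 1 r ×ˢ bx l m).filter (fun x => ∀ P ∈ prLE F Y, ¬ nonMax P x.1 x.2)) ×ˢ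
          (bx (1 : F) K₁))).image (fun x => (x.1.1, x.2, x.1.2)) := by
      ext ⟨a, b, c⟩
      rw [Finset.mem_filter]
      simp only [Finset.mem_filter, mem_smp, Finset.mem_image, Finset.mem_product, Prod.exists,
        Prod.mk.injEq, bad0]
      constructor
      · rintro ⟨⟨h1, h2, h4⟩, h5⟩
        exact ⟨a, c, b, ⟨⟨⟨h1, h4⟩, h5⟩, h2⟩, rfl, rfl, rfl⟩
      · rintro ⟨a', c', b', ⟨⟨⟨h1, h4⟩, h5⟩, h2⟩, rfl, rfl, rfl⟩
        exact ⟨⟨h1, h2, h4⟩, h5⟩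
    rw [e1, e2, Finset.card_image_of_injective, Finset.card_image_of_injective, Finset.card_product,
      card_bx]
    · push_cast; ring
    · rintro ⟨⟨a, b⟩, c⟩ ⟨⟨a', b'⟩, c'⟩ h
      simp only [Prod.mk.injEq] at h ⊢
      tauto
    · rintro ⟨a, b⟩ ⟨a', b'⟩ h
      simp only [Prod.mk.injEq] at h ⊢
      tauto
  have hq := two_le_card (F := F)
  have hpos : (0 : ℝ) < (Fintype.card F : ℝ) ^ K₁ := by positivity
  have h3 := Gc_sieve hl Y (x := ∏ P ∈ prLE F Y, dens (P ^ 2) (fun x => ¬ bad0 P x)) (by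
    apply mul_right_cancel₀ hpos.ne'
    rw [key, h2, card_smp, card_smp]
    ring)
  rw [Finset.prod_congr rfl (fun P hP => dens_good0 (mem_prLE.1 hP).2.2)] at h3
  have h4 := h0 r (by omega)
  rw [Real.dist_eq] at h1
  have := abs_sub_le (Gc r 0 m l) _ (rho0 F) |>.trans (add_le_add h3 h1.le)
  linarith

end M5
end EvenChar

namespace EvenChar
section M5b
open scoped Classical
set_option linter.unusedSectionVars false
set_option linter.unusedSimpArgs false
variable {F : Type} [Field F] [Fintype F]

lemma tannery {x C L : ℝ} (hx : 0 ≤ x) (hx1 : x < 1) (a : ℕ → ℕ → ℝ) (hC : ∀ g j, |a g j| ≤ C)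
    (ha : ∀ j, Filter.Tendsto (fun g => a g j) Filter.atTop (nhds L)) :
    Filter.Tendsto (fun g => ∑ j ∈ Finset.range (g + 1), x ^ j * a g j) Filter.atTop
      (nhds (L / (1 - x))) := by
  have h := tendsto_tsum_of_dominated_convergence (𝓕 := Filter.atTop)
    (f := fun g j => if j ∈ Finset.range (g + 1) then x ^ j * a g j else 0)
    (g := fun j => x ^ j * L) (bound := fun j => x ^ j * C)
    ((summable_geometric_of_lt_one hx hx1).mul_right C) ?_ ?_
  · rw [tsum_mul_right, tsum_geometric_of_lt_one hx hx1, inv_mul_eq_div] at h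
    refine h.congr fun g => ?_
    rw [tsum_eq_sum (s := Finset.range (g + 1))]
    · exact Finset.sum_congr rfl fun j hj => if_pos hj
    · intro j hj; exact if_neg hj
  · intro j
    refine ((ha j).const_mul (x ^ j)).congr' ?_
    filter_upwards [Filter.eventually_ge_atTop j] with g hg
    rw [if_pos (Finset.mem_range.2 (by omega))]
  · refine Filter.Eventually.of_forall fun g j => ?_
    have h1 := hC g j
    have h0 : 0 ≤ C := (abs_nonneg _).trans h1
    split_ifs
    · rw [norm_mul, Real.norm_of_nonneg (by positivity), Real.norm_eq_abs]
      gcongr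
    · rw [norm_zero]; positivity

lemma tannery_bd {x C : ℝ} (hx : 0 ≤ x) (hx1 : x < 1) (a : ℕ → ℝ) (hC : ∀ j, |a j| ≤ C) (g : ℕ) :
    |∑ j ∈ Finset.range (g + 1), x ^ j * a j| ≤ C / (1 - x) := by
  have h0 : 0 ≤ C := (abs_nonneg _).trans (hC 0)
  calc _ ≤ ∑ j ∈ Finset.range (g + 1), |x ^ j * a j| := Finset.abs_sum_le_sum_abs _ _
    _ ≤ ∑ j ∈ Finset.range (g + 1), x ^ j * C := by
        apply Finset.sum_le_sum
        intro j _
        rw [abs_mul, abs_of_nonneg (by positivity)]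
        gcongr
        exact hC j
    _ ≤ ∑' j, x ^ j * C := Summable.sum_le_tsum _ (fun j _ => by positivity)
        ((summable_geometric_of_lt_one hx hx1).mul_right C)
    _ = _ := by rw [tsum_mul_right, tsum_geometric_of_lt_one hx hx1, inv_mul_eq_div]

lemma abs_Gc_le (r k m : ℕ) (l : F) : |Gc r k m l| ≤ 1 := by
  rw [abs_of_nonneg (Gc_nonneg _ _ _ _)]; exact Gc_le_one _ _ _ _

lemma Gc_tendsto [CharP F 2] {r k m : ℕ → ℕ} (hr : Filter.Tendsto r Filter.atTop Filter.atTop)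
    (hk : Filter.Tendsto k Filter.atTop Filter.atTop)
    (hm : Filter.Tendsto m Filter.atTop Filter.atTop) {l : F} (hl : l ≠ 0) :
    Filter.Tendsto (fun g => Gc (r g) (k g) (m g) l) Filter.atTop (nhds (rho0 F * eulerPR F 2)) := by
  rw [Metric.tendsto_nhds]
  intro ε hε
  obtain ⟨K, hK⟩ := Gc_lim (F := F) _ (half_pos hε)
  filter_upwards [hr.eventually_ge_atTop K, hk.eventually_ge_atTop K, hm.eventually_ge_atTop K]
    with g h1 h2 h3
  rw [Real.dist_eq]
  have := hK _ _ _ h1 h2 h3 l hl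
  linarith

lemma Gc0_tendsto [CharP F 2] {r m : ℕ → ℕ} (hr : Filter.Tendsto r Filter.atTop Filter.atTop)
    (hm : Filter.Tendsto m Filter.atTop Filter.atTop) {l : F} (hl : l ≠ 0) :
    Filter.Tendsto (fun g => Gc (r g) 0 (m g) l) Filter.atTop (nhds (rho0 F)) := by
  rw [Metric.tendsto_nhds]
  intro ε hε
  obtain ⟨K, hK⟩ := Gc0_lim (F := F) _ (half_pos hε)
  filter_upwards [hr.eventually_ge_atTop K, hm.eventually_ge_atTop K] with g h1 h3
  rw [Real.dist_eq]
  have := hK _ _ h1 h3 l hl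
  linarith

lemma tend_of_le {f : ℕ → ℕ} (c : ℕ) (h : ∀ g, g ≤ f g + c) :
    Filter.Tendsto f Filter.atTop Filter.atTop := by
  apply Filter.tendsto_atTop.2
  intro b
  filter_upwards [Filter.eventually_ge_atTop (b + c)] with g hg
  have := h g
  omega

variable (F) in
/-- weighted numerator, case I -/
def numI (g : ℕ) : ℝ := ∑ k ∈ Finset.range (g + 1), ∑ r ∈ Finset.range (g + 1),
  ∑ l ∈ Finset.univ.erase (0 : F), (Fintype.card F : ℝ) ^ r * (Fintype.card F : ℝ) ^ k *
    Gc r k (2 * g + 1 - k) l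

variable (F) in
/-- weighted denominator, case I -/
def denI (g : ℕ) : ℝ := ∑ r ∈ Finset.range (g + 1),
  ∑ l ∈ Finset.univ.erase (0 : F), (Fintype.card F : ℝ) ^ r * Gc r 0 (2 * g + 1) l

lemma resc (q : ℝ) (hq : 0 < q) (g : ℕ) (f : ℕ → ℝ) :
    (∑ k ∈ Finset.range (g + 1), q ^ k * f k) / q ^ g =
      ∑ j ∈ Finset.range (g + 1), q⁻¹ ^ j * f (g - j) := by
  rw [← Finset.sum_flip, Finset.sum_div]
  refine Finset.sum_congr rfl fun j hj => ?_
  have hj : j ≤ g := by rw [Finset.mem_range] at hj; omega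
  have : q ^ g = q ^ (g - j) * q ^ j := by rw [← pow_add]; congr 1; omega
  rw [this, inv_pow]
  field_simp

lemma inv_q : 0 ≤ (Fintype.card F : ℝ)⁻¹ ∧ (Fintype.card F : ℝ)⁻¹ < 1 := by
  have hq := two_le_card (F := F)
  exact ⟨by positivity, inv_lt_one_of_one_lt₀ (by linarith)⟩

lemma numI_lim [CharP F 2] : Filter.Tendsto (fun g => numI F g / (Fintype.card F : ℝ) ^ g /
    (Fintype.card F : ℝ) ^ g) Filter.atTop (nhds (((Finset.univ.erase (0 : F)).card *
      (rho0 F * eulerPR F 2)) / (1 - (Fintype.card F : ℝ)⁻¹) / (1 - (Fintype.card F : ℝ)⁻¹))) := by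
  have hq := two_le_card (F := F)
  obtain ⟨h0, h1⟩ := inv_q (F := F)
  have hq0 : (0 : ℝ) < Fintype.card F := by linarith
  have hb : ∀ r k m, |∑ l ∈ Finset.univ.erase (0 : F), Gc r k m l| ≤
      (Finset.univ.erase (0 : F)).card := by
    intro r k m
    refine (Finset.abs_sum_le_sum_abs _ _).trans ?_
    refine (Finset.sum_le_sum fun l _ => abs_Gc_le _ _ _ _).trans ?_
    simp
  have := tannery h0 h1 (fun g j => ∑ i ∈ Finset.range (g + 1), (Fintype.card F : ℝ)⁻¹ ^ i *
    ∑ l ∈ Finset.univ.erase (0 : F), Gc (g - i) (g - j) (2 * g + 1 - (g - j)) l)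
    (fun g j => tannery_bd h0 h1 _ (fun i => hb _ _ _) g)
    (fun j => tannery h0 h1 _ (fun g i => hb _ _ _) (fun i => tendsto_finsetSum _
      (fun l hl => Gc_tendsto (tend_of_le i (fun g => by omega)) (tend_of_le j (fun g => by omega))
        (tend_of_le 0 (fun g => by omega)) (Finset.ne_of_mem_erase hl))))
  rw [Finset.sum_const, nsmul_eq_mul] at this
  refine this.congr fun g => ?_
  have e : numI F g = ∑ k ∈ Finset.range (g + 1), (Fintype.card F : ℝ) ^ k *
      ∑ r ∈ Finset.range (g + 1), (Fintype.card F : ℝ) ^ r *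
        ∑ l ∈ Finset.univ.erase (0 : F), Gc r k (2 * g + 1 - k) l := by
    unfold numI
    refine Finset.sum_congr rfl fun k _ => ?_
    rw [Finset.mul_sum]
    refine Finset.sum_congr rfl fun r _ => ?_
    rw [← mul_assoc, Finset.mul_sum]
    refine Finset.sum_congr rfl fun l _ => ?_
    ring
  rw [e, resc _ hq0, Finset.sum_div]
  refine Finset.sum_congr rfl fun j _ => ?_
  rw [mul_div_assoc, resc _ hq0]

lemma denI_lim [CharP F 2] : Filter.Tendsto (fun g => denI F g / (Fintype.card F : ℝ) ^ g)
    Filter.atTop (nhds (((Finset.univ.erase (0 : F)).card * rho0 F) /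
      (1 - (Fintype.card F : ℝ)⁻¹))) := by
  have hq := two_le_card (F := F)
  obtain ⟨h0, h1⟩ := inv_q (F := F)
  have hq0 : (0 : ℝ) < Fintype.card F := by linarith
  have hb : ∀ r k m, |∑ l ∈ Finset.univ.erase (0 : F), Gc r k m l| ≤
      (Finset.univ.erase (0 : F)).card := by
    intro r k m
    refine (Finset.abs_sum_le_sum_abs _ _).trans ?_
    refine (Finset.sum_le_sum fun l _ => abs_Gc_le _ _ _ _).trans ?_
    simp
  have := tannery h0 h1 (fun g i => 
    ∑ l ∈ Finset.univ.erase (0 : F), Gc (g - i) 0 (2 * g + 1) l) (fun g i => hb _ _ _) (fun i => tendsto_finsetSum _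
      (fun l hl => Gc0_tendsto (tend_of_le i (fun g => by omega))
        (tend_of_le 0 (fun g => by omega)) (Finset.ne_of_mem_erase hl)))
  rw [Finset.sum_const, nsmul_eq_mul] at this
  refine this.congr fun g => ?_
  have e : denI F g = ∑ r ∈ Finset.range (g + 1), (Fintype.card F : ℝ) ^ r *
        ∑ l ∈ Finset.univ.erase (0 : F), Gc r 0 (2 * g + 1) l := by
    unfold denI
    refine Finset.sum_congr rfl fun k _ => ?_
    rw [Finset.mul_sum]
  rw [e, resc _ hq0]

theorem limI [CharP F 2] : Filter.Tendsto (fun g => numI F g / denI F g /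
    (zetaR (Fintype.card F) 2 * eulerPR F 2 * (Fintype.card F : ℝ) ^ g))
    Filter.atTop (nhds 1) := by
  have hq := two_le_card (F := F)
  obtain ⟨h0, h1⟩ := inv_q (F := F)
  have hq0 : (0 : ℝ) < Fintype.card F := by linarith
  have hE := euler_ne (F := F)
  have hR := rho0_ne (F := F)
  have hc : (0 : ℝ) < (Finset.univ.erase (0 : F)).card := by
    exact_mod_cast Finset.card_pos.2 ⟨1, by simp⟩
  have hz : zetaR (Fintype.card F) 2 = (1 - (Fintype.card F : ℝ)⁻¹)⁻¹ := by
    unfold zetaR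
    rw [show (1 : ℝ) - 2 = -1 by norm_num, Real.rpow_neg_one]
  have h1' : 0 < 1 - (Fintype.card F : ℝ)⁻¹ := by linarith
  have hd : ((Finset.univ.erase (0 : F)).card * rho0 F) / (1 - (Fintype.card F : ℝ)⁻¹) ≠ 0 := by
    positivity
  have := ((numI_lim (F := F)).div (denI_lim (F := F)) hd).div_const
    (zetaR (Fintype.card F) 2 * eulerPR F 2)
  have e : ((Finset.univ.erase (0 : F)).card * (rho0 F * eulerPR F 2)) /
      (1 - (Fintype.card F : ℝ)⁻¹) / (1 - (Fintype.card F : ℝ)⁻¹) /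
      (((Finset.univ.erase (0 : F)).card * rho0 F) / (1 - (Fintype.card F : ℝ)⁻¹)) /
      (zetaR (Fintype.card F) 2 * eulerPR F 2) = 1 := by
    rw [hz]
    have := h1'.ne'
    have := hc.ne'
    set z := 1 - (Fintype.card F : ℝ)⁻¹
    field_simp
  rw [e] at this
  refine this.congr fun g => ?_
  have : (0 : ℝ) < (Fintype.card F : ℝ) ^ g := by positivity
  set Q := (Fintype.card F : ℝ) ^ g
  simp only [Pi.div_apply]
  rw [div_div_div_cancel_right₀ this.ne', div_div, div_div, div_div, mul_comm Q]
  congr 1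
  ring

variable (F) in
/-- weighted numerator, case F -/
def numF (l : F) (g : ℕ) : ℝ := (∑ k ∈ Finset.range (g + 1), (Fintype.card F : ℝ) ^ k *
    Gc (g + 1) k (2 * (g + 1) - k) l) + (Fintype.card F : ℝ) ^ (g + 1) / (Fintype.card F + 1) *
    Gc (g + 1) (g + 1) (g + 1) l

theorem limF [CharP F 2] {l : F} (hl : l ≠ 0) :
    Filter.Tendsto (fun g => numF F l g / Gc (g + 1) 0 (2 * (g + 1)) l /
    (2 * zetaR (Fintype.card F) 3 * eulerPR F 2 * (Fintype.card F : ℝ) ^ g))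
    Filter.atTop (nhds 1) := by
  have hq := two_le_card (F := F)
  obtain ⟨h0, h1⟩ := inv_q (F := F)
  have hq0 : (0 : ℝ) < Fintype.card F := by linarith
  have hE := euler_ne (F := F)
  have hR := rho0_ne (F := F)
  have hz : zetaR (Fintype.card F) 3 = (1 - ((Fintype.card F : ℝ) ^ 2)⁻¹)⁻¹ := by
    unfold zetaR
    rw [show (1 : ℝ) - 3 = -(2 : ℕ) by norm_num, Real.rpow_neg hq0.le, Real.rpow_natCast]
  have t1 := tannery h0 h1 (fun g j => Gc (g + 1) (g - j) (2 * (g + 1) - (g - j)) l)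
    (fun g j => abs_Gc_le _ _ _ _)
    (fun j => Gc_tendsto (tend_of_le 0 (fun g => by omega)) (tend_of_le j (fun g => by omega))
        (tend_of_le 0 (fun g => by omega)) hl)
  have t2 := (Gc_tendsto (tend_of_le (f := fun g => g + 1) 0 (fun g => by omega))
    (tend_of_le (f := fun g => g + 1) 0 (fun g => by omega))
        (tend_of_le (f := fun g => g + 1) 0 (fun g => by omega)) hl).const_mul
        ((Fintype.card F : ℝ) / (Fintype.card F + 1))
  have t3 := (Gc0_tendsto (tend_of_le (f := fun g => g + 1) 0 (fun g => by omega))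
        (tend_of_le (f := fun g => 2 * (g + 1)) 0 (fun g => by omega)) hl)
  have := ((t1.add t2).div t3 hR).div_const (2 * zetaR (Fintype.card F) 3 * eulerPR F 2)
  have h1' : 0 < 1 - (Fintype.card F : ℝ)⁻¹ := by linarith
  have h2' : 0 < (Fintype.card F : ℝ) - 1 := by linarith
  have e : (rho0 F * eulerPR F 2 / (1 - (Fintype.card F : ℝ)⁻¹) +
      (Fintype.card F : ℝ) / (Fintype.card F + 1) * (rho0 F * eulerPR F 2)) / rho0 F /
      (2 * zetaR (Fintype.card F) 3 * eulerPR F 2) = 1 := by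
    rw [hz]
    set q := (Fintype.card F : ℝ)
    have e1 : 1 - q⁻¹ = (q - 1) / q := by field_simp
    have e2 : 1 - (q ^ 2)⁻¹ = (q - 1) * (q + 1) / q ^ 2 := by field_simp; ring
    rw [e1, e2]
    have := h2'.ne'
    field_simp
    ring
  rw [e] at this
  refine this.congr fun g => ?_
  have hp : (0 : ℝ) < (Fintype.card F : ℝ) ^ g := by positivity
  have e3 : numF F l g / (Fintype.card F : ℝ) ^ g =
      ∑ j ∈ Finset.range (g + 1), (Fintype.card F : ℝ)⁻¹ ^ j *
        Gc (g + 1) (g - j) (2 * (g + 1) - (g - j)) l + (Fintype.card F : ℝ) / (Fintype.card F + 1) *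
        Gc (g + 1) (g + 1) (g + 1) l := by
    unfold numF
    rw [add_div, resc _ hq0 g (fun k => Gc (g + 1) k (2 * (g + 1) - k) l), pow_succ]
    congr 1
    field_simp
  simp only [Pi.div_apply, Pi.add_apply]
  rw [← e3]
  set Q := (Fintype.card F : ℝ) ^ g
  rw [div_div, div_div, div_div]
  congr 1
  ring

end M5b
end EvenChar

namespace EvenChar
section M6
open scoped Classical
open QuadraticAlgebra nonZeroDivisors
set_option linter.unusedSectionVars false
set_option linter.unusedSimpArgs false
variable {F : Type} [Field F] [Fintype F] [CharP F 2]

/-- degree condition for the norm form -/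
def HD (N B : F[X]) : Prop :=
  ∀ a b : F[X], (a ^ 2 + N * a * b + b ^ 2 * B).degree = max (a ^ 2).degree (b ^ 2 * B).degree

/-- the order `A[y]`, `y² = N y + B` -/
abbrev OO (N B : F[X]) : Type := QuadraticAlgebra F[X] B N

lemma norm_eq {N B : F[X]} (z : OO N B) :
    QuadraticAlgebra.norm z = z.re ^ 2 + N * z.re * z.im + z.im ^ 2 * B := by
  rw [QuadraticAlgebra.norm_def, CharTwo.sub_eq_add]
  ring

lemma norm_deg {N B : F[X]} (hD : HD N B) (z : OO N B) :
    (QuadraticAlgebra.norm z).degree = max (z.re ^ 2).degree (z.im ^ 2 * B).degree := by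
  rw [norm_eq, hD]

lemma norm_ne {N B : F[X]} (hD : HD N B) (hB : B ≠ 0) {z : OO N B} (hz : z ≠ 0) :
    QuadraticAlgebra.norm z ≠ 0 := by
  intro h
  have h1 := norm_deg hD z
  rw [h, degree_zero] at h1
  have h2 := h1.symm.le
  rw [max_le_iff, le_bot_iff, le_bot_iff, degree_eq_bot, degree_eq_bot] at h2
  apply hz
  refine QuadraticAlgebra.ext ?_ ?_
  · simpa using h2.1
  · simpa [hB] using h2.2

/-- the ideal `(f, y + r)` -/
def Ifr {N B : F[X]} (f r : F[X]) (h : f ∣ r ^ 2 + N * r + B) : Ideal (OO N B) where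
  carrier := {z | f ∣ z.re + r * z.im}
  zero_mem' := by simp
  add_mem' := by
    intro a b ha hb
    simp only [Set.mem_ofPred_eq, re_add, im_add] at *
    have := dvd_add ha hb
    convert this using 1
    ring
  smul_mem' := by
    intro c z hz
    simp only [Set.mem_ofPred_eq, smul_eq_mul, re_mul, im_mul] at *
    have := dvd_add (hz.mul_right (c.re + r * c.im)) (h.mul_right (c.im * z.im))
    convert this using 1
    linear_combination -(c.im * z.im * r ^ 2) * (two_eq_zero_poly (F := F))

lemma mem_Ifr {N B f r : F[X]} {h : f ∣ r ^ 2 + N * r + B} {z : OO N B} :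
    z ∈ Ifr f r h ↔ f ∣ z.re + r * z.im := Iff.rfl

lemma f_mem {N B f r : F[X]} (h : f ∣ r ^ 2 + N * r + B) :
    (algebraMap F[X] (OO N B) f) ∈ Ifr f r h := by
  rw [mem_Ifr]; simp

lemma y_mem {N B f r : F[X]} (h : f ∣ r ^ 2 + N * r + B) :
    (⟨r, 1⟩ : OO N B) ∈ Ifr f r h := by
  rw [mem_Ifr]; simp [CharTwo.add_self_eq_zero]

lemma am_mem_Ifr {N B f r x : F[X]} {h : f ∣ r ^ 2 + N * r + B} :
    algebraMap F[X] (OO N B) x ∈ Ifr f r h ↔ f ∣ x := by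
  rw [mem_Ifr]; simp

lemma Ifr_ne {N B f r : F[X]} (h : f ∣ r ^ 2 + N * r + B) : Ifr (N := N) (B := B) f r h ≠ ⊥ := by
  intro h0
  have := y_mem h
  rw [h0, Ideal.mem_bot] at this
  have := congrArg QuadraticAlgebra.im this
  simp at this

lemma am_ne {N B f : F[X]} (h : f ≠ 0) : algebraMap F[X] (OO N B) f ≠ 0 := by
  intro h0
  have := congrArg QuadraticAlgebra.re h0
  exact h (by simpa using this)

lemma structure_lemma {N B : F[X]} (hD : HD N B) (hB : B ≠ 0) {J : Ideal (OO N B)} (hJ : J ≠ ⊥) :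
    ∃ (e f r : F[X]) (h : f ∣ r ^ 2 + N * r + B), e ≠ 0 ∧ f.Monic ∧ r.degree < f.degree ∧
      J = Ideal.span {algebraMap F[X] (OO N B) e} * Ifr f r h := by
  have t2 := two_eq_zero_poly (F := F)
  obtain ⟨e, he⟩ := (IsPrincipalIdealRing.principal
    (Submodule.map (imₗ B N) (J.restrictScalars F[X]) : Ideal F[X])).principal
  obtain ⟨d, hd⟩ := (IsPrincipalIdealRing.principal (J.comap (algebraMap F[X] (OO N B)))).principal
  have he1 : ∀ x : F[X], e ∣ x ↔ ∃ z ∈ J, z.im = x := by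
    intro x
    rw [← Ideal.mem_span_singleton]
    change x ∈ Submodule.span F[X] {e} ↔ _
    rw [← he]
    simp [Submodule.mem_map, imₗ]
  have hd1 : ∀ x : F[X], d ∣ x ↔ algebraMap F[X] (OO N B) x ∈ J := by
    intro x
    rw [← Ideal.mem_span_singleton]
    change x ∈ Submodule.span F[X] {d} ↔ _
    rw [← hd]; rfl
  obtain ⟨z, hzJ, hz⟩ := Submodule.exists_mem_ne_zero_of_ne_bot hJ
  have hd0 : d ≠ 0 := by
    rintro rfl
    have h1 : algebraMap F[X] (OO N B) (QuadraticAlgebra.norm z) ∈ J := by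
      rw [algebraMap_norm_eq_mul_star]
      exact J.mul_mem_right _ hzJ
    rw [← hd1, zero_dvd_iff] at h1
    exact norm_ne hD hB hz h1
  have hed : ∀ x : F[X], algebraMap F[X] (OO N B) x ∈ J → e ∣ x := by
    intro x hx
    rw [he1]
    refine ⟨⟨0, 1⟩ * algebraMap F[X] (OO N B) x, J.mul_mem_left _ hx, ?_⟩
    simp
  obtain ⟨f', hf'⟩ := hed d ((hd1 d).1 dvd_rfl)
  have he0 : e ≠ 0 := by rintro rfl; simp at hf'; exact hd0 hf'
  have hf0 : f' ≠ 0 := by rintro rfl; simp at hf'; exact hd0 hf'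
  set f := normalize f' with hf
  have hfm : f.Monic := monic_normalize hf0
  have hfa : Associated f f' := normalize_associated f'
  have hd2 : ∀ x : F[X], e * f ∣ x ↔ algebraMap F[X] (OO N B) x ∈ J := by
    intro x
    rw [← hd1, hf']
    exact (hfa.mul_left e).dvd_iff_dvd_left
  obtain ⟨z0, hz0J, hz0⟩ := (he1 e).1 dvd_rfl
  obtain ⟨r0, hr0⟩ : e ∣ z0.re := by
    have h1 : e ∣ z0.re + N * e := by
      rw [he1]
      refine ⟨⟨0, 1⟩ * z0, J.mul_mem_left _ hz0J, ?_⟩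
      simp [hz0]
    exact (dvd_add_left (dvd_mul_left _ _)).1 h1
  have hz0' : z0 = algebraMap F[X] (OO N B) e * ⟨r0, 1⟩ := by
    refine QuadraticAlgebra.ext ?_ ?_
    · simp [hr0]
    · simp [hz0]
  have hrr : f ∣ r0 ^ 2 + N * r0 + B := by
    have h1 : algebraMap F[X] (OO N B) (e * (r0 ^ 2 + N * r0 + B)) ∈ J := by
      have : algebraMap F[X] (OO N B) (e * (r0 ^ 2 + N * r0 + B)) = ⟨r0 + N, 1⟩ * z0 := by
        rw [hz0']
        refine QuadraticAlgebra.ext ?_ ?_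
        · simp only [re_mul, im_mul, algebraMap_re, algebraMap_im]; ring
        · simp only [re_mul, im_mul, algebraMap_re, algebraMap_im]
          linear_combination -(e * r0 + e * N) * t2
      rw [this]
      exact J.mul_mem_left _ hz0J
    rw [← hd2] at h1
    exact (mul_dvd_mul_iff_left he0).1 h1
  obtain ⟨k, hk⟩ := dvd_sub_mod f r0
  set r := r0 % f with hr
  have hr0k : r0 = r + f * k := by rw [← hk]; ring
  have hrdeg : r.degree < f.degree := EuclideanDomain.mod_lt r0 hfm.ne_zero
  have hrd : f ∣ r ^ 2 + N * r + B := by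
    have : r ^ 2 + N * r + B = (r0 ^ 2 + N * r0 + B) - f * (k * (2 * r + f * k + N)) := by
      rw [hr0k]; ring
    rw [this]
    exact dvd_sub hrr (dvd_mul_right _ _)
  refine ⟨e, f, r, hrd, he0, hfm, hrdeg, ?_⟩
  ext w
  rw [Ideal.mem_span_singleton_mul]
  constructor
  · intro hw
    obtain ⟨b, hb⟩ : e ∣ w.im := (he1 _).2 ⟨w, hw, rfl⟩
    have h1 : algebraMap F[X] (OO N B) (w.re - b * (e * r0)) ∈ J := by
      have : algebraMap F[X] (OO N B) (w.re - b * (e * r0)) =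
          w - algebraMap F[X] (OO N B) b * z0 := by
        rw [hz0']
        refine QuadraticAlgebra.ext ?_ ?_
        · simp
        · simp [hb]; ring
      rw [this]
      exact J.sub_mem hw (J.mul_mem_left _ hz0J)
    rw [← hd2] at h1
    obtain ⟨c, hc⟩ := h1
    refine ⟨⟨f * c + b * r0, b⟩, ?_, ?_⟩
    · rw [mem_Ifr]
      refine ⟨c + b * k, ?_⟩
      simp only
      linear_combination b * hr0k + r * b * t2
    · refine QuadraticAlgebra.ext ?_ ?_
      · simp only [re_mul, im_mul, algebraMap_re, algebraMap_im]
        linear_combination -hc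
      · simp [hb]
  · rintro ⟨v, hv, rfl⟩
    rw [mem_Ifr] at hv
    obtain ⟨c, hc⟩ := hv
    have : algebraMap F[X] (OO N B) e * v = algebraMap F[X] (OO N B) v.im * z0 +
        algebraMap F[X] (OO N B) (e * f * (c - v.im * k)) := by
      rw [hz0']
      refine QuadraticAlgebra.ext ?_ ?_
      · simp only [re_add, re_mul, im_mul, algebraMap_re, algebraMap_im]
        linear_combination e * hc - e * v.im * hr0k - e * r * v.im * t2
      · simp; ring
    rw [this]
    exact J.add_mem (J.mul_mem_left _ hz0J) ((hd2 _).1 (dvd_mul_right _ _))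

end M6
end EvenChar

namespace EvenChar
section M6b
open scoped Classical
open QuadraticAlgebra nonZeroDivisors
set_option linter.unusedSectionVars false
set_option linter.unusedSimpArgs false
variable {F : Type} [Field F] [Fintype F] [CharP F 2] {N B : F[X]}

/-- degree of the norm -/
def nn (z : OO N B) : ℕ := (QuadraticAlgebra.norm z).natDegree

lemma nn_mul (hD : HD N B) (hB : B ≠ 0) {z w : OO N B} (hz : z ≠ 0) (hw : w ≠ 0) :
    nn (z * w) = nn z + nn w := by
  rw [nn, map_mul, natDegree_mul (norm_ne hD hB hz) (norm_ne hD hB hw)]; rfl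

lemma nn_am (f : F[X]) : nn (algebraMap F[X] (OO N B) f) = 2 * f.natDegree := by
  rw [nn, QuadraticAlgebra.norm_algebraMap, natDegree_pow]

lemma nn_ge_of_im (hD : HD N B) (hB : B ≠ 0) {z : OO N B} (h : z.im ≠ 0) :
    2 * z.im.natDegree + B.natDegree ≤ nn z := by
  rw [nn, ← Nat.cast_le (α := WithBot ℕ), ← degree_eq_natDegree, norm_deg hD]
  · refine le_trans ?_ (le_max_right _ _)
    rw [degree_eq_natDegree (mul_ne_zero (pow_ne_zero 2 h) hB),
      natDegree_mul (pow_ne_zero 2 h) hB, natDegree_pow]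
  · apply norm_ne hD hB
    rintro rfl; simp at h

lemma nn_ge_of_re (hD : HD N B) (hB : B ≠ 0) {z : OO N B} (h : z.re ≠ 0) :
    2 * z.re.natDegree ≤ nn z := by
  rw [nn, ← Nat.cast_le (α := WithBot ℕ), ← degree_eq_natDegree, norm_deg hD]
  · refine le_trans ?_ (le_max_left _ _)
    rw [degree_eq_natDegree (pow_ne_zero 2 h), natDegree_pow]
  · apply norm_ne hD hB
    rintro rfl; simp at h

lemma nn_le (hD : HD N B) (hB : B ≠ 0) {z : OO N B} {m : ℕ} (h1 : 2 * z.re.natDegree ≤ m)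
    (h2 : z.im ≠ 0 → 2 * z.im.natDegree + B.natDegree ≤ m) : nn z ≤ m := by
  rw [nn, natDegree_le_iff_degree_le, norm_deg hD]
  apply max_le
  · refine degree_le_natDegree.trans ?_
    rw [natDegree_pow]; exact_mod_cast h1
  · by_cases h : z.im = 0
    · simp [h]
    · refine degree_le_natDegree.trans ?_
      rw [natDegree_mul (pow_ne_zero 2 h) hB, natDegree_pow]
      exact_mod_cast h2 h

lemma min_of_le (hD : HD N B) (hB : B ≠ 0) {f r : F[X]} {h : f ∣ r ^ 2 + N * r + B}
    (hf : 2 * f.natDegree ≤ B.natDegree) {w : OO N B} (hw : w ∈ Ifr f r h) (hw0 : w ≠ 0) :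
    2 * f.natDegree ≤ nn w := by
  by_cases him : w.im = 0
  · have hre : w.re ≠ 0 := fun h0 => hw0 (QuadraticAlgebra.ext h0 him)
    rw [mem_Ifr, him, mul_zero, add_zero] at hw
    have := natDegree_le_of_dvd hw hre
    have := nn_ge_of_re hD hB hre
    omega
  · have := nn_ge_of_im hD hB him
    omega

lemma le_of_min (hD : HD N B) (hB : B ≠ 0) {f r : F[X]} {h : f ∣ r ^ 2 + N * r + B}
    (hr : r.degree < f.degree)
    (hmin : ∀ w ∈ Ifr (N := N) (B := B) f r h, w ≠ 0 → 2 * f.natDegree ≤ nn w) :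
    2 * f.natDegree ≤ B.natDegree := by
  have h1 := hmin ⟨r, 1⟩ (y_mem h) (fun h0 => by
    have := congrArg QuadraticAlgebra.im h0
    simp at this)
  by_contra hlt
  push Not at hlt
  have hf : 0 < f.natDegree := by omega
  have hr' : r.natDegree < f.natDegree := by
    by_cases hr0 : r = 0
    · simpa [hr0] using hf
    · exact natDegree_lt_natDegree hr0 hr
  have h2 : nn (⟨r, 1⟩ : OO N B) ≤ 2 * f.natDegree - 1 :=
    nn_le hD hB (by simp only; omega) (fun _ => by simp; omega)
  omega

variable [IsDedekindDomain (OO N B)]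

lemma span_ne {z : OO N B} (hz : z ≠ 0) : Ideal.span {z} ≠ 0 := by
  simpa [Ideal.zero_eq_bot] using hz

lemma exists_red (hD : HD N B) (hB : B ≠ 0) {J : Ideal (OO N B)} {z : OO N B} (hz : z ∈ J)
    (hz0 : z ≠ 0) (hmin : ∀ v ∈ J, v ≠ 0 → nn z ≤ nn v) :
    ∃ (f r : F[X]) (h : f ∣ r ^ 2 + N * r + B), f.Monic ∧ r.degree < f.degree ∧
      Ideal.span {z} * Ifr f r h = Ideal.span {algebraMap F[X] (OO N B) f} * J := by
  have hJ : J ≠ ⊥ := by rintro rfl; exact hz0 (by simpa using hz)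
  have hs : star z ≠ 0 := by
    intro h0
    have := congrArg QuadraticAlgebra.norm h0
    rw [QuadraticAlgebra.norm_star, QuadraticAlgebra.norm_zero] at this
    exact norm_ne hD hB hz0 this
  have hJ' : Ideal.span {star z} * J ≠ ⊥ := mul_ne_zero (span_ne hs) hJ
  obtain ⟨e, f, r, h, he, hf, hr, hJe⟩ := structure_lemma hD hB hJ'
  refine ⟨f, r, h, hf, hr, ?_⟩
  have hef : e * f ≠ 0 := mul_ne_zero he hf.ne_zero
  have h1 : algebraMap F[X] (OO N B) (QuadraticAlgebra.norm z) ∈ Ideal.span {star z} * J := by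
    rw [Ideal.mem_span_singleton_mul]
    exact ⟨z, hz, by rw [algebraMap_norm_eq_mul_star, mul_comm]⟩
  rw [hJe, Ideal.mem_span_singleton_mul] at h1
  obtain ⟨w, hw, hw1⟩ := h1
  have hwim : w.im = 0 := by
    have := congrArg QuadraticAlgebra.im hw1
    simpa [he] using this
  have hwre : e * w.re = QuadraticAlgebra.norm z := by
    have := congrArg QuadraticAlgebra.re hw1
    simpa using this
  rw [mem_Ifr, hwim, mul_zero, add_zero] at hw
  obtain ⟨t, ht⟩ := hw
  have hnz : QuadraticAlgebra.norm z = e * f * t := by rw [← hwre, ht]; ring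
  have h2 : algebraMap F[X] (OO N B) (e * f) ∈ Ideal.span {star z} * J := by
    rw [hJe, Ideal.mem_span_singleton_mul]
    exact ⟨_, f_mem h, by rw [map_mul]⟩
  rw [Ideal.mem_span_singleton_mul] at h2
  obtain ⟨v, hv, hv1⟩ := h2
  have hnv : e * f = t * QuadraticAlgebra.norm v := by
    have := congrArg QuadraticAlgebra.norm hv1
    rw [map_mul, QuadraticAlgebra.norm_star, QuadraticAlgebra.norm_algebraMap, hnz] at this
    apply mul_left_cancel₀ hef
    linear_combination -this
  have ht0 : t ≠ 0 := by rintro rfl; simp at hnv; exact hef (by simpa using hnv)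
  have hnv0 : QuadraticAlgebra.norm v ≠ 0 := by intro h0; rw [h0, mul_zero] at hnv; exact hef hnv
  have hv0 : v ≠ 0 := by rintro rfl; simp at hnv0
  have h3 := hmin v hv hv0
  have h4 : nn z = (e * f).natDegree + t.natDegree := by rw [nn, hnz, natDegree_mul hef ht0]
  have h5 : (e * f).natDegree = t.natDegree + nn v := by rw [hnv, natDegree_mul ht0 hnv0]; rfl
  have ht1 : t.natDegree = 0 := by omega
  have htu : IsUnit t := by
    rw [isUnit_iff_degree_eq_zero, degree_eq_natDegree ht0, ht1]; rfl
  have htu' : Ideal.span {algebraMap F[X] (OO N B) t} = ⊤ :=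
    Ideal.span_singleton_eq_top.2 (htu.map _)
  apply mul_left_cancel₀ (span_ne (am_ne he) : Ideal.span {algebraMap F[X] (OO N B) e} ≠ 0)
  calc Ideal.span {algebraMap F[X] (OO N B) e} * (Ideal.span {z} * Ifr f r h)
      = Ideal.span {z} * (Ideal.span {algebraMap F[X] (OO N B) e} * Ifr f r h) := by ring
    _ = (Ideal.span {z} * Ideal.span {star z}) * J := by rw [← hJe]; ring
    _ = Ideal.span {algebraMap F[X] (OO N B) (e * f * t)} * J := by
        rw [Ideal.span_singleton_mul_span_singleton, ← hnz, algebraMap_norm_eq_mul_star]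
    _ = Ideal.span {algebraMap F[X] (OO N B) e} * (Ideal.span {algebraMap F[X] (OO N B) f} * J) *
        Ideal.span {algebraMap F[X] (OO N B) t} := by
        rw [map_mul, map_mul, ← Ideal.span_singleton_mul_span_singleton,
          ← Ideal.span_singleton_mul_span_singleton]
        ring
    _ = _ := by rw [htu', Ideal.mul_top]

variable (N B) in
/-- reduced pairs -/
def RP : Type := {p : F[X] × F[X] // p.1.Monic ∧ 2 * p.1.natDegree ≤ B.natDegree ∧
  p.2.degree < p.1.degree ∧ p.1 ∣ p.2 ^ 2 + N * p.2 + B}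

/-- ideal of a pair -/
def RP.I (p : RP N B) : Ideal (OO N B) := Ifr p.1.1 p.1.2 p.2.2.2.2

/-- the element `f` of the ideal -/
def RP.fe (p : RP N B) : OO N B := algebraMap F[X] (OO N B) p.1.1

lemma RP.fe_ne (p : RP N B) : p.fe ≠ 0 := am_ne p.2.1.ne_zero

lemma RP.I_ne (p : RP N B) : p.I ≠ 0 := Ifr_ne _

lemma RP.nn_fe (p : RP N B) : nn p.fe = 2 * p.1.1.natDegree := nn_am _

lemma RP.fe_mem (p : RP N B) : p.fe ∈ p.I := f_mem _

lemma RP.min (hD : HD N B) (hB : B ≠ 0) (p : RP N B) {w : OO N B} (hw : w ∈ p.I) (hw0 : w ≠ 0) :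
    nn p.fe ≤ nn w := by
  rw [RP.nn_fe]
  exact min_of_le hD hB p.2.2.1 hw hw0

/-- relation between minimal elements and pairs -/
def Rel (J : Ideal (OO N B)) (z : OO N B) (p : RP N B) : Prop :=
  Ideal.span {z} * p.I = Ideal.span {p.fe} * J

lemma Rel.mem {J : Ideal (OO N B)} {z : OO N B} {p : RP N B} (h : Rel J z p) : z ∈ J := by
  have h1 : z * p.fe ∈ Ideal.span {z} * p.I :=
    Ideal.mem_span_singleton_mul.2 ⟨_, p.fe_mem, rfl⟩
  rw [h, Ideal.mem_span_singleton_mul] at h1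
  obtain ⟨v, hv, hv1⟩ := h1
  rw [mul_comm] at hv1
  rwa [← mul_right_cancel₀ p.fe_ne hv1]

lemma Rel.ne {J : Ideal (OO N B)} (hJ : J ≠ ⊥) {z : OO N B} {p : RP N B} (h : Rel J z p) :
    z ≠ 0 := by
  rintro rfl
  have : Ideal.span {p.fe} * J ≠ 0 := mul_ne_zero (span_ne p.fe_ne) hJ
  rw [← h] at this
  simp at this

lemma Rel.min (hD : HD N B) (hB : B ≠ 0) {J : Ideal (OO N B)} {z : OO N B} {p : RP N B}
    (h : Rel J z p) {v : OO N B} (hv : v ∈ J) (hv0 : v ≠ 0) : nn z ≤ nn v := by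
  have hz0 : z ≠ 0 := h.ne (by rintro rfl; exact hv0 (by simpa using hv))
  have h1 : p.fe * v ∈ Ideal.span {p.fe} * J := Ideal.mem_span_singleton_mul.2 ⟨_, hv, rfl⟩
  rw [← h, Ideal.mem_span_singleton_mul] at h1
  obtain ⟨w, hw, hw1⟩ := h1
  have hw0 : w ≠ 0 := by
    rintro rfl
    rw [mul_zero] at hw1
    exact mul_ne_zero p.fe_ne hv0 hw1.symm
  have h2 := congrArg nn hw1
  rw [nn_mul hD hB hz0 hw0, nn_mul hD hB p.fe_ne hv0] at h2
  have := p.min hD hB hw hw0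
  omega

lemma exists_rel (hD : HD N B) (hB : B ≠ 0) {J : Ideal (OO N B)} {z : OO N B} (hz : z ∈ J)
    (hz0 : z ≠ 0) (hmin : ∀ v ∈ J, v ≠ 0 → nn z ≤ nn v) : ∃ p : RP N B, Rel J z p := by
  obtain ⟨f, r, h, hf, hr, hI⟩ := exists_red hD hB hz hz0 hmin
  have hmin' : ∀ w ∈ Ifr (N := N) (B := B) f r h, w ≠ 0 → 2 * f.natDegree ≤ nn w := by
    intro w hw hw0
    have h1 : z * w ∈ Ideal.span {z} * Ifr f r h := Ideal.mem_span_singleton_mul.2 ⟨_, hw, rfl⟩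
    rw [hI, Ideal.mem_span_singleton_mul] at h1
    obtain ⟨v, hv, hv1⟩ := h1
    have hv0 : v ≠ 0 := by
      rintro rfl
      rw [mul_zero] at hv1
      exact mul_ne_zero hz0 hw0 hv1.symm
    have h2 := congrArg nn hv1
    rw [nn_mul hD hB hz0 hw0, nn_mul hD hB (am_ne hf.ne_zero) hv0, nn_am] at h2
    have := hmin v hv hv0
    omega
  exact ⟨⟨(f, r), hf, le_of_min hD hB hr hmin', hr, h⟩, hI⟩

lemma RP.dvd_of {p p' : RP N B}
    (h : Ideal.span {p'.fe} * p.I = Ideal.span {p.fe} * p'.I) : p.1.1 ∣ p'.1.1 := by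
  have h1 : p'.fe * ⟨p.1.2, 1⟩ ∈ Ideal.span {p'.fe} * p.I :=
    Ideal.mem_span_singleton_mul.2 ⟨_, y_mem _, rfl⟩
  rw [h, Ideal.mem_span_singleton_mul] at h1
  obtain ⟨w, hw, hw1⟩ := h1
  have := congrArg QuadraticAlgebra.im hw1
  simp [RP.fe] at this
  exact ⟨_, this.symm⟩

lemma Rel.unique {J : Ideal (OO N B)} {z : OO N B} (hz : z ≠ 0) {p p' : RP N B} (h : Rel J z p)
    (h' : Rel J z p') : p = p' := by
  have h1 : Ideal.span {p'.fe} * p.I = Ideal.span {p.fe} * p'.I := by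
    apply mul_left_cancel₀ (span_ne hz)
    calc Ideal.span {z} * (Ideal.span {p'.fe} * p.I) = Ideal.span {p'.fe} * (Ideal.span {z} * p.I) := by
          ring
      _ = Ideal.span {p.fe} * (Ideal.span {z} * p'.I) := by rw [h, h']; ring
      _ = _ := by ring
  have h2 : p.1.1 = p'.1.1 := eq_of_monic_of_associated p.2.1 p'.2.1
    (associated_of_dvd_dvd (RP.dvd_of h1) (RP.dvd_of h1.symm))
  have hfe : p.fe = p'.fe := by rw [RP.fe, RP.fe, h2]
  rw [hfe] at h1
  have h3 := mul_left_cancel₀ (span_ne p'.fe_ne) h1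
  have h4 : (⟨p.1.2, 1⟩ : OO N B) ∈ p'.I := by rw [← h3]; exact y_mem _
  rw [RP.I, mem_Ifr] at h4
  simp only [mul_one] at h4
  rw [← CharTwo.sub_eq_add] at h4
  have h5 : p.1.2 - p'.1.2 = 0 := by
    apply eq_zero_of_dvd_of_degree_lt h4
    refine (degree_sub_le _ _).trans_lt (max_lt ?_ p'.2.2.2.1)
    rw [← h2]; exact p.2.2.2.1
  exact Subtype.ext (Prod.ext h2 (sub_eq_zero.1 h5))

lemma isUnit_iff_const (hD : HD N B) (hB : 0 < B.natDegree) {u : OO N B} :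
    IsUnit u ↔ ∃ c : F, c ≠ 0 ∧ u = algebraMap F[X] (OO N B) (C c) := by
  have hB0 : B ≠ 0 := by rintro rfl; simp at hB
  constructor
  · intro hu
    have h0 : nn u = 0 := by
      rw [isUnit_iff_norm_isUnit] at hu
      exact natDegree_eq_zero_of_isUnit hu
    have him : u.im = 0 := by
      by_contra h
      have := nn_ge_of_im hD hB0 h
      omega
    have hre : u.re ≠ 0 := fun h => hu.ne_zero (QuadraticAlgebra.ext h him)
    have h1 := nn_ge_of_re hD hB0 hre
    have h2 : u.re = C (u.re.coeff 0) := eq_C_of_natDegree_eq_zero (by omega)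
    refine ⟨u.re.coeff 0, fun h => hre (by rw [h2, h, C_0]), QuadraticAlgebra.ext ?_ ?_⟩
    · rw [algebraMap_re, ← h2]
    · rw [him, algebraMap_im]
  · rintro ⟨c, hc, rfl⟩
    exact (Polynomial.isUnit_C.2 (isUnit_iff_ne_zero.2 hc)).map _

lemma Rel.scale (hD : HD N B) (hB : 0 < B.natDegree) {J : Ideal (OO N B)} {z z' : OO N B}
    {p : RP N B} (h : Rel J z p) :
    Rel J z' p ↔ ∃ c : F, c ≠ 0 ∧ z' = algebraMap F[X] (OO N B) (C c) * z := by
  unfold Rel at h ⊢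
  rw [← h]
  constructor
  · intro h'
    have h1 := mul_right_cancel₀ p.I_ne h'
    rw [Ideal.span_singleton_eq_span_singleton] at h1
    obtain ⟨u, hu⟩ := h1.symm
    obtain ⟨c, hc, hcu⟩ := (isUnit_iff_const hD hB).1 u.isUnit
    exact ⟨c, hc, by rw [← hcu, ← hu, mul_comm]⟩
  · rintro ⟨c, hc, rfl⟩
    rw [← Ideal.span_singleton_mul_span_singleton, Ideal.span_singleton_eq_top.2
      ((isUnit_iff_const hD hB).2 ⟨c, hc, rfl⟩), Ideal.top_mul]

/-- class of a pair -/
def RP.cls (p : RP N B) : ClassGroup (OO N B) :=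
  ClassGroup.mk0 ⟨p.I, mem_nonZeroDivisors_of_ne_zero p.I_ne⟩

lemma cls_eq_iff (p p0 : RP N B) : p.cls = p0.cls ↔ ∃ z, Rel p0.I z p := by
  unfold RP.cls
  rw [ClassGroup.mk0_eq_mk0_iff]
  constructor
  · rintro ⟨b, a, hb, ha, h⟩
    simp only at h
    have h1 : b * p.fe ∈ Ideal.span {b} * p.I :=
      Ideal.mem_span_singleton_mul.2 ⟨_, p.fe_mem, rfl⟩
    rw [h, Ideal.mem_span_singleton_mul] at h1
    obtain ⟨z, hz, hz1⟩ := h1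
    refine ⟨z, ?_⟩
    unfold Rel
    apply mul_left_cancel₀ (span_ne ha)
    rw [← mul_assoc, Ideal.span_singleton_mul_span_singleton, hz1,
      ← Ideal.span_singleton_mul_span_singleton]
    calc _ = Ideal.span {p.fe} * (Ideal.span {b} * p.I) := by ring
      _ = _ := by rw [h]; ring
  · rintro ⟨z, hz⟩
    exact ⟨z, p.fe, hz.ne p0.I_ne, p.fe_ne, hz⟩

lemma cls_surj (hD : HD N B) (hB : B ≠ 0) : Function.Surjective (RP.cls (N := N) (B := B)) := by
  intro c
  obtain ⟨⟨J, hJ⟩, rfl⟩ := ClassGroup.mk0_surjective c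
  have hJ0 : J ≠ ⊥ := nonZeroDivisors.ne_zero hJ
  obtain ⟨z0, hz0J, hz0⟩ := Submodule.exists_mem_ne_zero_of_ne_bot hJ0
  have hex : ∃ m, ∃ z ∈ J, z ≠ 0 ∧ nn z = m := ⟨_, z0, hz0J, hz0, rfl⟩
  obtain ⟨z, hz, hz1, hz2⟩ := Nat.find_spec hex
  obtain ⟨p, hp⟩ := exists_rel hD hB hz hz1 (fun v hv hv0 => by
    rw [hz2]; exact Nat.find_min' hex ⟨v, hv, hv0, rfl⟩)
  refine ⟨p, ?_⟩
  unfold RP.cls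
  rw [ClassGroup.mk0_eq_mk0_iff]
  exact ⟨z, p.fe, hz1, p.fe_ne, hp⟩

/-- minimal elements of the ideal of a pair -/
def Zm (p : RP N B) : Type := {z : OO N B // z ∈ p.I ∧ z ≠ 0 ∧ nn z ≤ nn p.fe}

lemma card_Zm (hD : HD N B) (hB : 0 < B.natDegree) (p0 : RP N B) :
    Nat.card (Zm p0) = (Fintype.card F - 1) * Nat.card {p : RP N B // p.cls = p0.cls} := by
  have hB0 : B ≠ 0 := by rintro rfl; simp at hB
  have hex : ∀ p : {p : RP N B // p.cls = p0.cls}, ∃ z, Rel p0.I z p.1 :=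
    fun p => (cls_eq_iff _ _).1 p.2
  choose zz hzz using hex
  have hc : Nat.card Fˣ = Fintype.card F - 1 := by
    rw [Nat.card_eq_fintype_card, Fintype.card_units]
  rw [← hc, ← Nat.card_prod]
  symm
  have hrel : ∀ (c : Fˣ) p, Rel p0.I (algebraMap F[X] (OO N B) (C (c : F)) * zz p) p.1 := fun c p =>
    ((hzz p).scale hD hB).2 ⟨c, c.ne_zero, rfl⟩
  refine Nat.card_congr (Equiv.ofBijective (fun x : Fˣ × {p : RP N B // p.cls = p0.cls} =>
    (⟨algebraMap F[X] (OO N B) (C (x.1 : F)) * zz x.2, (hrel x.1 x.2).mem,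
      (hrel x.1 x.2).ne p0.I_ne, (hrel x.1 x.2).min hD hB0 p0.fe_mem p0.fe_ne⟩ : Zm p0)) ⟨?_, ?_⟩)
  · rintro ⟨c, p⟩ ⟨c', p'⟩ h
    have h := congrArg Subtype.val h
    simp only at h
    have h1 := hrel c p
    have hpp : p = p' := by
      apply Subtype.ext
      refine Rel.unique (h1.ne p0.I_ne) h1 ?_
      rw [h]; exact hrel c' p'
    subst hpp
    have h2 := mul_right_cancel₀ ((hzz p).ne p0.I_ne) h
    have h3 := congrArg QuadraticAlgebra.re h2
    rw [algebraMap_re, algebraMap_re] at h3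
    rw [Units.ext (C_injective h3)]
  · rintro ⟨z, hz, hz0, hz1⟩
    obtain ⟨p, hp⟩ := exists_rel hD hB0 hz hz0 (fun v hv hv0 => hz1.trans (p0.min hD hB0 hv hv0))
    have hcls : p.cls = p0.cls := (cls_eq_iff _ _).2 ⟨z, hp⟩
    obtain ⟨c, hc, hcz⟩ := ((hzz ⟨p, hcls⟩).scale hD hB).1 hp
    refine ⟨(Units.mk0 c hc, ⟨p, hcls⟩), ?_⟩
    apply Subtype.ext
    simp only [Units.val_mk0]
    exact hcz.symm

lemma card_Zm_lt (hD : HD N B) (hB : B ≠ 0) (p : RP N B) (hp : 2 * p.1.1.natDegree < B.natDegree) :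
    Nat.card (Zm p) = Fintype.card F - 1 := by
  have hc : Nat.card Fˣ = Fintype.card F - 1 := by
    rw [Nat.card_eq_fintype_card, Fintype.card_units]
  rw [← hc]
  symm
  refine Nat.card_congr (Equiv.ofBijective (fun c : Fˣ =>
    (⟨algebraMap F[X] (OO N B) (C (c : F)) * p.fe, p.I.mul_mem_left _ p.fe_mem,
      mul_ne_zero (am_ne (C_ne_zero.2 c.ne_zero)) p.fe_ne, ?_⟩ : Zm p)) ⟨?_, ?_⟩)
  · rw [nn_mul hD hB (am_ne (C_ne_zero.2 c.ne_zero)) p.fe_ne, nn_am, natDegree_C]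
    simp
  · intro c c' h
    have h := congrArg Subtype.val h
    have h2 := mul_right_cancel₀ p.fe_ne h
    have h3 := congrArg QuadraticAlgebra.re h2
    rw [algebraMap_re, algebraMap_re] at h3
    exact Units.ext (C_injective h3)
  · rintro ⟨z, hz, hz0, hz1⟩
    rw [p.nn_fe] at hz1
    have him : z.im = 0 := by
      by_contra h
      have := nn_ge_of_im hD hB h
      omega
    have hre : z.re ≠ 0 := fun h => hz0 (QuadraticAlgebra.ext h him)
    have h1 := nn_ge_of_re hD hB hre
    rw [RP.I, mem_Ifr, him, mul_zero, add_zero] at hz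
    obtain ⟨t, ht⟩ := hz
    have ht0 : t ≠ 0 := by rintro rfl; rw [mul_zero] at ht; exact hre ht
    have h2 : z.re.natDegree = p.1.1.natDegree + t.natDegree := by
      rw [ht, natDegree_mul p.2.1.ne_zero ht0]
    have h3 : t = C (t.coeff 0) := eq_C_of_natDegree_eq_zero (by omega)
    refine ⟨Units.mk0 (t.coeff 0) (fun h => ht0 (by rw [h3, h, C_0])), Subtype.ext ?_⟩
    simp only [Units.val_mk0]
    rw [← h3, RP.fe, ← map_mul]
    refine QuadraticAlgebra.ext ?_ ?_
    · rw [algebraMap_re, ht, mul_comm]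
    · rw [algebraMap_im, him]

lemma card_Zm_eq (hD : HD N B) (hB : B ≠ 0) (p : RP N B) (hp : 2 * p.1.1.natDegree = B.natDegree) :
    Nat.card (Zm p) = Fintype.card F ^ 2 - 1 := by
  have hc : Nat.card {x : F × F // x ≠ 0} = Fintype.card F ^ 2 - 1 := by
    rw [Nat.card_eq_fintype_card, Fintype.card_subtype_compl, Fintype.card_prod]
    simp [sq]
  rw [← hc]
  symm
  have hr : p.1.2.natDegree ≤ p.1.1.natDegree := natDegree_le_natDegree p.2.2.2.1.le
  refine Nat.card_congr (Equiv.ofBijective (fun x : {x : F × F // x ≠ 0} =>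
    (⟨⟨C x.1.1 * p.1.1 + C x.1.2 * p.1.2, C x.1.2⟩, ?_, ?_, ?_⟩ : Zm p)) ⟨?_, ?_⟩)
  · rw [RP.I, mem_Ifr]
    refine ⟨C x.1.1, ?_⟩
    simp only
    linear_combination C x.1.2 * p.1.2 * two_eq_zero_poly (F := F)
  · intro h
    have h1 := congrArg QuadraticAlgebra.im h
    have h2 := congrArg QuadraticAlgebra.re h
    simp only [im_zero, re_zero, C_eq_zero] at h1 h2
    rw [h1, C_0, zero_mul, add_zero, mul_eq_zero, C_eq_zero] at h2
    exact x.2 (Prod.ext (h2.resolve_right p.2.1.ne_zero) h1)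
  · rw [p.nn_fe]
    apply nn_le hD hB
    · simp only
      have : (C x.1.1 * p.1.1 + C x.1.2 * p.1.2).natDegree ≤ p.1.1.natDegree := by
        refine (natDegree_add_le _ _).trans (max_le (natDegree_C_mul_le _ _) ?_)
        exact (natDegree_C_mul_le _ _).trans hr
      omega
    · intro _
      simp only [natDegree_C]
      omega
  · intro x x' h
    have h := congrArg Subtype.val h
    have h1 := congrArg QuadraticAlgebra.im h
    have h2 := congrArg QuadraticAlgebra.re h
    simp only at h1 h2
    rw [h1] at h2
    have h3 := mul_right_cancel₀ p.2.1.ne_zero (add_right_cancel h2)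
    exact Subtype.ext (Prod.ext (C_injective h3) (C_injective h1))
  · rintro ⟨z, hz, hz0, hz1⟩
    rw [p.nn_fe] at hz1
    have him : z.im = C (z.im.coeff 0) := by
      apply eq_C_of_natDegree_eq_zero
      by_cases h : z.im = 0
      · simp [h]
      · have := nn_ge_of_im hD hB h
        omega
    have hre : z.re.natDegree ≤ p.1.1.natDegree := by
      by_cases h : z.re = 0
      · simp [h]
      · have := nn_ge_of_re hD hB h
        omega
    rw [RP.I, mem_Ifr] at hz
    obtain ⟨t, ht⟩ := hz
    have h3 : t = C (t.coeff 0) := by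
      apply eq_C_of_natDegree_eq_zero
      by_cases ht0 : t = 0
      · simp [ht0]
      have h1 := natDegree_mul p.2.1.ne_zero ht0
      rw [← ht] at h1
      have h2 : (z.re + p.1.2 * z.im).natDegree ≤ p.1.1.natDegree := by
        refine (natDegree_add_le _ _).trans (max_le hre ?_)
        rw [him]
        exact (natDegree_mul_C_le _ _).trans hr
      omega
    have hzre : z.re = C (t.coeff 0) * p.1.1 + C (z.im.coeff 0) * p.1.2 := by
      rw [← h3, ← him]
      linear_combination ht - p.1.2 * z.im * two_eq_zero_poly (F := F)
    refine ⟨⟨(t.coeff 0, z.im.coeff 0), fun h => hz0 ?_⟩, Subtype.ext ?_⟩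
    · rw [Prod.mk_eq_zero] at h
      refine QuadraticAlgebra.ext ?_ ?_
      · rw [hzre, h.1, h.2]; simp
      · rw [him, h.2]; simp
    · refine QuadraticAlgebra.ext ?_ ?_
      · exact hzre.symm
      · exact him.symm

instance : Finite (RP N B) := by
  apply Finite.of_injective (β := polyLT F (B.natDegree + 1) × polyLT F (B.natDegree + 1))
    (fun p => (⟨p.1.1, mem_polyLT.2 ?_⟩, ⟨p.1.2, mem_polyLT.2 ?_⟩))
  · intro p p' h
    simp only [Prod.mk.injEq, Subtype.mk.injEq] at h
    exact Subtype.ext (Prod.ext h.1 h.2)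
  · rw [degree_eq_natDegree p.2.1.ne_zero]
    have := p.2.2.1
    exact_mod_cast (by omega : p.1.1.natDegree < B.natDegree + 1)
  · refine p.2.2.2.1.trans ?_
    rw [degree_eq_natDegree p.2.1.ne_zero]
    have := p.2.2.1
    exact_mod_cast (by omega : p.1.1.natDegree < B.natDegree + 1)

/-- weight of a pair -/
def RP.wt (p : RP N B) : ℝ :=
  if 2 * p.1.1.natDegree < B.natDegree then 1 else ((Fintype.card F : ℝ) + 1)⁻¹

lemma wt_fiber (hD : HD N B) (hB : 0 < B.natDegree) (p : RP N B) :
    (Nat.card {p' : RP N B // p'.cls = p.cls} : ℝ) * p.wt = 1 := by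
  have hB0 : B ≠ 0 := by rintro rfl; simp at hB
  have h1 := card_Zm hD hB p
  have hq : 1 < Fintype.card F := Fintype.one_lt_card
  unfold RP.wt
  split_ifs with h
  · rw [card_Zm_lt hD hB0 p h] at h1
    have : Nat.card {p' : RP N B // p'.cls = p.cls} = 1 := by
      apply Nat.eq_of_mul_eq_mul_left (by omega : 0 < Fintype.card F - 1)
      omega
    rw [this]; simp
  · rw [card_Zm_eq hD hB0 p (by have := p.2.2.1; omega)] at h1
    have : Nat.card {p' : RP N B // p'.cls = p.cls} = Fintype.card F + 1 := by
      apply Nat.eq_of_mul_eq_mul_left (by omega : 0 < Fintype.card F - 1)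
      rw [← h1]
      obtain ⟨m, hm⟩ : ∃ m, Fintype.card F = m + 1 := ⟨_, (Nat.succ_pred_eq_of_pos (by omega)).symm⟩
      rw [hm]
      simp
      apply Nat.sub_eq_of_eq_add
      ring
    rw [this]
    push_cast
    exact mul_inv_cancel₀ (by positivity)

theorem card_class (hD : HD N B) (hB : 0 < B.natDegree) [Fintype (RP N B)] :
    (Nat.card (ClassGroup (OO N B)) : ℝ) = ∑ p : RP N B, p.wt := by
  have hB0 : B ≠ 0 := by rintro rfl; simp at hB
  have hs := cls_surj hD hB0
  haveI : Finite (ClassGroup (OO N B)) := Finite.of_surjective _ hs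
  haveI := Fintype.ofFinite (ClassGroup (OO N B))
  rw [← Finset.sum_fiberwise Finset.univ RP.cls RP.wt, Nat.card_eq_fintype_card,
    ← Finset.card_univ, Finset.cast_card]
  refine Finset.sum_congr rfl fun c _ => ?_
  obtain ⟨p, rfl⟩ := hs c
  have hw : ∀ p' ∈ Finset.univ.filter (fun p' : RP N B => p'.cls = p.cls), p'.wt = p.wt := by
    intro p' hp'
    have hp' := (Finset.mem_filter.1 hp').2
    have h1 := wt_fiber hD hB p
    have h2 := wt_fiber hD hB p'
    rw [hp'] at h2
    have h3 : (Nat.card {p' : RP N B // p'.cls = p.cls} : ℝ) ≠ 0 := by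
      intro h0; rw [h0, zero_mul] at h1; exact zero_ne_one h1
    exact mul_left_cancel₀ h3 (h2.trans h1.symm)
  rw [Finset.sum_congr rfl hw, Finset.sum_const, nsmul_eq_mul, ← wt_fiber hD hB p,
    Nat.card_eq_fintype_card, Fintype.card_subtype]

end M6b
end EvenChar

namespace EvenChar
section M7
open scoped Classical
open QuadraticAlgebra nonZeroDivisors
set_option linter.unusedSectionVars false
set_option linter.unusedSimpArgs false
set_option linter.style.haveILetI false
variable {F : Type} [Field F] [Fintype F] [CharP F 2]

/-- maximality -/
def MX (N B : F[X]) : Prop := ∀ P : F[X], P.Monic → Irreducible P → ¬ nonMax P N B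

lemma MX.irr {N B : F[X]} (h : MX N B) {P : F[X]} (hP : Irreducible P) (hd : P ∣ N) (w : F[X]) :
    ¬ P ^ 2 ∣ w ^ 2 + N * w + B := by
  intro hw
  have ha : Associated P (normalize P) := associated_normalize P
  refine h (normalize P) (monic_normalize hP.ne_zero) (ha.irreducible hP) ⟨?_, w, ?_⟩
  · exact ha.symm.dvd.trans hd
  · exact (ha.symm.pow_pow (n := 2)).dvd.trans hw

lemma descent {N B : F[X]} (hM : MX N B) (M : F[X]) : M ≠ 0 → ∀ s b : F[X], M ∣ N →
    M ^ 2 ∣ s ^ 2 + s * b * N + b ^ 2 * B → M ∣ s ∧ M ∣ b := by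
  induction M using UniqueFactorizationMonoid.induction_on_prime with
  | h₁ => intro h; exact absurd rfl h
  | h₂ x hx => intro _ s b _ _; exact ⟨hx.dvd, hx.dvd⟩
  | h₃ M P hM0 hP ih =>
    intro h0 s b hd hs
    have hPN : P ∣ N := (dvd_mul_right P M).trans hd
    have hP2 : P ^ 2 ∣ s ^ 2 + s * b * N + b ^ 2 * B :=
      (pow_dvd_pow_of_dvd (dvd_mul_right P M) 2).trans hs
    have hPb : P ∣ b := by
      by_contra hb
      have hc : IsCoprime (P ^ 2) b := ((hP.irreducible.coprime_iff_not_dvd).2 hb).pow_left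
      obtain ⟨v, u, hu⟩ := hc
      apply hM.irr hP.irreducible hPN (u * s)
      obtain ⟨c, hc⟩ := hP2
      refine ⟨u ^ 2 * c + v * (N * u * s) + B * v * (1 + u * b), ?_⟩
      have h1 : u * b = 1 - v * P ^ 2 := by linear_combination hu
      linear_combination u ^ 2 * hc - (N * u * s + B * (1 + u * b)) * hu
    have hPs : P ∣ s := by
      have h1 : P ∣ s ^ 2 := by
        have h2 : P ∣ s ^ 2 + s * b * N + b ^ 2 * B := (dvd_pow_self P two_ne_zero).trans hP2
        have h3 : P ∣ s * b * N + b ^ 2 * B :=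
          dvd_add ((hPb.mul_left s).mul_right N) ((dvd_pow hPb two_ne_zero).mul_right B)
        rw [add_assoc] at h2
        exact (dvd_add_left h3).1 h2
      exact hP.dvd_of_dvd_pow h1
    obtain ⟨b', rfl⟩ := hPb
    obtain ⟨s', rfl⟩ := hPs
    have := ih hM0 s' b' ((dvd_mul_left M P).trans hd) (by
      have h1 : P ^ 2 * M ^ 2 ∣ P ^ 2 * (s' ^ 2 + s' * b' * N + b' ^ 2 * B) := by
        convert hs using 1 <;> ring
      exact (mul_dvd_mul_iff_left (pow_ne_zero 2 hP.ne_zero)).1 h1)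
    exact ⟨mul_dvd_mul_left P this.1, mul_dvd_mul_left P this.2⟩

local notation "aM" => algebraMap F[X] (RatFunc F)

lemma aM_inj : Function.Injective aM := IsFractionRing.injective F[X] (RatFunc F)

lemma aM_ne {p : F[X]} (hp : p ≠ 0) : aM p ≠ 0 := by
  rw [Ne, map_eq_zero_iff _ aM_inj]; exact hp

lemma two_eq_zero_rat : (2 : RatFunc F) = 0 := by
  have h := congrArg aM (two_eq_zero_poly (F := F))
  rwa [map_ofNat, map_zero] at h

lemma normk_ne {N B : F[X]} {u : RatFunc F} (hN : N ≠ 0) (hu : aM N ^ 2 * u = aM B)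
    (hD : HD N B) (hB : B ≠ 0) {a b : RatFunc F} (h : a ^ 2 + a * b + b ^ 2 * u = 0) :
    a = 0 ∧ b = 0 := by
  obtain ⟨a0, d, hd, rfl⟩ := IsFractionRing.div_surjective (A := F[X]) a
  obtain ⟨b0, e, he, rfl⟩ := IsFractionRing.div_surjective (A := F[X]) b
  have hd0 : aM d ≠ 0 := aM_ne (nonZeroDivisors.ne_zero hd)
  have he0 : aM e ≠ 0 := aM_ne (nonZeroDivisors.ne_zero he)
  have h1 : (N * (a0 * e)) ^ 2 + N * (N * (a0 * e)) * (b0 * d) + (b0 * d) ^ 2 * B = 0 := by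
    apply aM_inj
    field_simp at h
    simp only [map_add, map_mul, map_pow, map_zero, ← hu]
    linear_combination (aM N) ^ 2 * h
  have h2 := hD (N * (a0 * e)) (b0 * d)
  rw [h1, degree_zero] at h2
  have h3 := h2.symm.le
  rw [max_le_iff, le_bot_iff, le_bot_iff, degree_eq_bot, degree_eq_bot] at h3
  simp [hN, hB, nonZeroDivisors.ne_zero hd, nonZeroDivisors.ne_zero he] at h3
  simp [h3]

lemma irr_of {N B : F[X]} {u : RatFunc F} (hN : N ≠ 0) (hu : aM N ^ 2 * u = aM B)
    (hD : HD N B) (hB : B ≠ 0) : Irreducible (X ^ 2 + X + C u : (RatFunc F)[X]) := by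
  have hdeg : (X ^ 2 + X + C u : (RatFunc F)[X]).natDegree = 2 := by compute_degree!
  apply Polynomial.irreducible_of_degree_le_three_of_not_isRoot
  · rw [hdeg]; decide
  · intro x hx
    have : x ^ 2 + x * 1 + 1 ^ 2 * u = 0 := by simpa [IsRoot] using hx
    exact one_ne_zero (normk_ne hN hu hD hB this).2

section gen
variable {u : RatFunc F} 

local notation "ff" => (X ^ 2 + X + C u : (RatFunc F)[X])
local notation "LL" => AdjoinRoot (X ^ 2 + X + C u : (RatFunc F)[X])

lemma monic_ff : (ff).Monic := by monicity!

lemma root_eq : (AdjoinRoot.root ff) ^ 2 + AdjoinRoot.root ff + algebraMap (RatFunc F) LL u = 0 := by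
  have h := AdjoinRoot.eval₂_root ff
  simpa using h

lemma exists_rep (z : LL) : ∃ a b : RatFunc F, z = algebraMap (RatFunc F) LL a +
    algebraMap (RatFunc F) LL b * AdjoinRoot.root ff := by
  obtain ⟨p, rfl⟩ := AdjoinRoot.mk_surjective z
  have h1 : AdjoinRoot.mk ff p = AdjoinRoot.mk ff (p %ₘ ff) := by
    conv_lhs => rw [← modByMonic_add_div p ff]
    simp
  have hdeg : (ff).degree = 2 := by compute_degree!
  have h2 : (p %ₘ ff).degree ≤ 1 := by
    have := degree_modByMonic_lt p (monic_ff (u := u))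
    rw [hdeg] at this
    exact Order.lt_succ_iff.1 (by exact_mod_cast this)
  rw [h1, eq_X_add_C_of_degree_le_one h2]
  refine ⟨(p %ₘ ff).coeff 0, (p %ₘ ff).coeff 1, ?_⟩
  simp only [map_add, map_mul, AdjoinRoot.mk_C, AdjoinRoot.mk_X]
  exact add_comm _ _

lemma two_LL : (2 : LL) = 0 := by
  have h := congrArg (algebraMap (RatFunc F) LL) (two_eq_zero_rat (F := F))
  rwa [map_ofNat, map_zero] at h

/-- conjugation -/
def conj : LL →ₐ[RatFunc F] LL :=
  AdjoinRoot.liftAlgHom ff (Algebra.ofId _ _) (AdjoinRoot.root ff + 1) (by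
    have h := root_eq (u := u)
    simp only [eval₂_add, eval₂_pow, eval₂_X, eval₂_C]
    have h2 := two_LL (u := u)
    change _ + algebraMap (RatFunc F) LL u = 0
    linear_combination h + (AdjoinRoot.root ff + 1) * h2)

lemma conj_root : conj (AdjoinRoot.root ff) = AdjoinRoot.root ff + 1 := by
  simp [conj]

lemma aM_LL (p : F[X]) : algebraMap F[X] LL p = algebraMap (RatFunc F) LL (aM p) :=
  IsScalarTower.algebraMap_apply _ _ _ _

lemma int_k [Fact (Irreducible ff)] {a : RatFunc F}
    (h : IsIntegral F[X] (algebraMap (RatFunc F) LL a)) : ∃ p : F[X], aM p = a := by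
  rw [isIntegral_algebraMap_iff (algebraMap (RatFunc F) LL).injective] at h
  exact IsIntegrallyClosed.isIntegral_iff.1 h

lemma int_of {N B : F[X]} [Fact (Irreducible ff)] (hN : N ≠ 0)
    (hu : aM N ^ 2 * u = aM B) (hM : MX N B) {z : LL} (hz : IsIntegral F[X] z) :
    ∃ a b : F[X], z = algebraMap F[X] LL a +
      algebraMap F[X] LL b * (algebraMap F[X] LL N * AdjoinRoot.root ff) := by
  obtain ⟨a, b, rfl⟩ := exists_rep z
  have hr := root_eq (u := u)
  have h2 := two_LL (u := u)
  have hz' := hz.map ((conj (u := u)).restrictScalars F[X])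
  simp only [AlgHom.restrictScalars_apply, map_add, map_mul, AlgHom.commutes, conj_root] at hz'
  obtain ⟨β, hβ⟩ : ∃ p : F[X], aM p = b := by
    apply int_k (u := u)
    have h3 := IsIntegral.add hz hz'
    have h4 : algebraMap (RatFunc F) LL a + algebraMap (RatFunc F) LL b * AdjoinRoot.root ff +
      (algebraMap (RatFunc F) LL a + algebraMap (RatFunc F) LL b * (AdjoinRoot.root ff + 1)) =
      algebraMap (RatFunc F) LL b := by
      linear_combination (algebraMap (RatFunc F) LL a + algebraMap (RatFunc F) LL b * AdjoinRoot.root ff) * h2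
    rw [h4] at h3
    exact h3
  obtain ⟨c, hc⟩ : ∃ p : F[X], aM p = a ^ 2 + a * b + b ^ 2 * u := by
    apply int_k (u := u)
    have h3 := IsIntegral.mul hz hz'
    have h4 : (algebraMap (RatFunc F) LL a + algebraMap (RatFunc F) LL b * AdjoinRoot.root ff) *
      (algebraMap (RatFunc F) LL a + algebraMap (RatFunc F) LL b * (AdjoinRoot.root ff + 1)) =
      algebraMap (RatFunc F) LL (a ^ 2 + a * b + b ^ 2 * u) := by
      simp only [map_add, map_mul, map_pow]
      linear_combination ((algebraMap (RatFunc F) LL b) ^ 2) * hr - ((algebraMap (RatFunc F) LL b) ^ 2 * algebraMap (RatFunc F) LL u - algebraMap (RatFunc F) LL a * algebraMap (RatFunc F) LL b * AdjoinRoot.root ff) * h2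
    rw [h4] at h3
    exact h3
  obtain ⟨s, hs⟩ : ∃ p : F[X], aM p = a * aM N := by
    apply IsIntegrallyClosed.isIntegral_iff.1
    refine ⟨X ^ 2 + C (β * N) * X + C (β ^ 2 * B - N ^ 2 * c), by monicity!, ?_⟩
    simp only [eval₂_add, eval₂_mul, eval₂_sub, eval₂_pow, eval₂_X, eval₂_C, map_sub, map_mul, map_pow, hβ, hc, ← hu]
    ring
  have h3 : N ^ 2 ∣ s ^ 2 + s * β * N + β ^ 2 * B := by
    refine ⟨c, aM_inj ?_⟩
    simp only [map_add, map_mul, map_pow, hβ, hc, ← hu, hs]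
    ring
  obtain ⟨⟨s', rfl⟩, ⟨b', rfl⟩⟩ := descent hM N hN s β dvd_rfl h3
  refine ⟨s', b', ?_⟩
  have h4 : a = aM s' := by
    apply mul_right_cancel₀ (aM_ne hN)
    rw [← hs, map_mul, mul_comm]
  rw [h4, ← hβ]
  simp only [aM_LL, map_mul]
  ring

lemma indep {N B : F[X]} [Fact (Irreducible ff)] (hN : N ≠ 0)
    (hu : aM N ^ 2 * u = aM B) (hD : HD N B) (hB : B ≠ 0) {a b : F[X]}
    (h : algebraMap F[X] LL a + algebraMap F[X] LL b * (algebraMap F[X] LL N * AdjoinRoot.root ff) = 0) :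
    a = 0 ∧ b = 0 := by
  have hr := root_eq (u := u)
  have h2 := two_LL (u := u)
  have h1 : aM a ^ 2 + aM a * aM (b * N) + aM (b * N) ^ 2 * u = 0 := by
    apply (algebraMap (RatFunc F) LL).injective
    simp only [aM_LL] at h
    simp only [map_add, map_mul, map_pow, map_zero]
    set a' := algebraMap (RatFunc F) LL (aM a)
    set b' := algebraMap (RatFunc F) LL (aM b)
    set N' := algebraMap (RatFunc F) LL (aM N)
    linear_combination (a' + b' * N' * AdjoinRoot.root ff + b' * N') * h - (b' * N') ^ 2 * hr + ((b' * N') ^ 2 * algebraMap (RatFunc F) LL u - a' * b' * N' * AdjoinRoot.root ff) * h2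
  have h3 := normk_ne hN hu hD hB h1
  rw [map_eq_zero_iff _ aM_inj, map_eq_zero_iff _ aM_inj] at h3
  exact ⟨h3.1, by simpa [hN] using h3.2⟩

lemma dede {N B : F[X]} [hI : Fact (Irreducible ff)] (hN : N ≠ 0)
    (hu : aM N ^ 2 * u = aM B) (hD : HD N B) (hB : B ≠ 0) (hM : MX N B) :
    IsDedekindDomain (OO N B) ∧ Nonempty (OO N B ≃+* integralClosure F[X] LL) := by
  let y : LL := algebraMap F[X] LL N * AdjoinRoot.root ff
  have hr := root_eq (u := u)
  have h2 := two_LL (u := u)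
  have hy : y * y = B • (1 : LL) + N • y := by
    rw [Algebra.smul_def, Algebra.smul_def]
    have h3 : algebraMap F[X] LL B = (algebraMap F[X] LL N) ^ 2 * algebraMap (RatFunc F) LL u := by
      rw [aM_LL, aM_LL, ← hu]; simp
    rw [h3]
    simp only [y]
    linear_combination (algebraMap F[X] LL N) ^ 2 * hr - (algebraMap F[X] LL N) ^ 2 * (algebraMap (RatFunc F) LL u + AdjoinRoot.root ff) * h2
  let φ : OO N B →ₐ[F[X]] LL := QuadraticAlgebra.lift ⟨y, hy⟩
  have hφ : ∀ z, φ z = algebraMap F[X] LL z.re + algebraMap F[X] LL z.im * y := by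
    intro z
    simp [φ, QuadraticAlgebra.lift, Algebra.smul_def]
  letI : Algebra (OO N B) LL := φ.toRingHom.toAlgebra
  have hal : ∀ z, algebraMap (OO N B) LL z = φ z := fun z => rfl
  haveI : IsScalarTower F[X] (OO N B) LL := IsScalarTower.of_algebraMap_eq fun p => by
    rw [hal, AlgHom.commutes]
  haveI : IsIntegralClosure (OO N B) F[X] LL := by
    constructor
    · rw [injective_iff_map_eq_zero]
      intro z hz
      rw [hal, hφ] at hz
      obtain ⟨h3, h4⟩ := indep hN hu hD hB hz
      exact QuadraticAlgebra.ext h3 h4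
    · intro z
      constructor
      · intro hz
        obtain ⟨a, b, hab⟩ := int_of hN hu hM hz
        exact ⟨⟨a, b⟩, by rw [hal, hφ, hab]⟩
      · rintro ⟨w, rfl⟩
        exact (Algebra.IsIntegral.isIntegral (R := F[X]) w).map φ
  haveI : FiniteDimensional (RatFunc F) LL := (monic_ff (u := u)).finite_adjoinRoot
  haveI : Algebra.IsSeparable (RatFunc F) LL := by
    have hs : IsSeparable (RatFunc F) (AdjoinRoot.root ff) := by
      have h3 : (ff).Separable := by
        rw [separable_def']
        refine ⟨0, 1, ?_⟩
        have h4 : (2 : RatFunc F) = 0 := two_eq_zero_rat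
        have h5 : (1 + 1 : (RatFunc F)[X]) = 0 := by
          have h6 := congrArg (Polynomial.C (R := RatFunc F)) h4
          rwa [← one_add_one_eq_two, map_add, map_one, map_zero] at h6
        simp [h4, h5]
      refine h3.of_dvd (minpoly.dvd _ _ ?_)
      simp
    refine ⟨fun z => ?_⟩
    obtain ⟨a, b, rfl⟩ := exists_rep z
    exact Field.isSeparable_add (isSeparable_algebraMap _)
      (Field.isSeparable_mul (isSeparable_algebraMap _) hs)
  haveI : IsDomain (OO N B) :=
    (IsIntegralClosure.algebraMap_injective (OO N B) F[X] LL).isDomain (algebraMap (OO N B) LL)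
  haveI : IsDedekindDomain (OO N B) := IsIntegralClosure.isDedekindDomain F[X] (RatFunc F) LL _
  exact ⟨this, ⟨(IsIntegralClosure.equiv F[X] (OO N B) LL (integralClosure F[X] LL)).toRingEquiv⟩⟩

end gen

theorem hClass_eq {N B : F[X]} {u : RatFunc F} (hN : N ≠ 0)
    (hu : aM N ^ 2 * u = aM B) (hD : HD N B) (hB : B ≠ 0) (hM : MX N B) :
    IsDedekindDomain (OO N B) ∧ ∀ [IsDedekindDomain (OO N B)],
      hClass u = Nat.card (ClassGroup (OO N B)) := by
  have hirr := irr_of hN hu hD hB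
  haveI : Fact (Irreducible (X ^ 2 + X + C u : (RatFunc F)[X])) := ⟨hirr⟩
  obtain ⟨h1, ⟨e⟩⟩ := dede hN hu hD hB hM
  refine ⟨h1, ?_⟩
  intro _
  rw [hClass, dif_pos hirr]
  exact Nat.card_congr (ClassGroup.mulEquiv e).symm.toEquiv

end M7
end EvenChar

namespace EvenChar
section M8
open scoped Classical
set_option linter.unusedSectionVars false
set_option linter.unusedSimpArgs false
set_option linter.style.haveILetI false
variable {F : Type} [Field F] [Fintype F] [CharP F 2]

local notation "aM" => algebraMap F[X] (RatFunc F)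

/-- general partial fraction sum -/
def pf (S : Finset F[X]) (e : F[X] → ℕ) (a : F[X] → ℕ → F[X]) : RatFunc F :=
  ∑ P ∈ S, ∑ i ∈ Finset.Icc 1 (e P), aM (a P i) / aM P ^ (2 * i - 1)

/-- numerator of `pf` over the square of `∏ P ^ e P` -/
def pfB (S : Finset F[X]) (e : F[X] → ℕ) (a : F[X] → ℕ → F[X]) : F[X] :=
  ∑ P ∈ S, ∑ i ∈ Finset.Icc 1 (e P),
    (∏ Q ∈ S.erase P, Q ^ e Q) ^ 2 * (a P i * P ^ (2 * (e P - i) + 1))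

/-- level -/
def pfN (S : Finset F[X]) (e : F[X] → ℕ) : F[X] := ∏ P ∈ S, P ^ e P

lemma pfN_eq {S : Finset F[X]} {e : F[X] → ℕ} {P : F[X]} (hP : P ∈ S) :
    pfN S e = P ^ e P * ∏ Q ∈ S.erase P, Q ^ e Q := (Finset.mul_prod_erase S _ hP).symm

lemma pfN_monic {S : Finset F[X]} {e : F[X] → ℕ} (hS : ∀ P ∈ S, P.Monic ∧ Irreducible P) :
    (pfN S e).Monic := monic_prod_of_monic _ _ fun P hP => (hS P hP).1.pow _

lemma pf_eq {S : Finset F[X]} {e : F[X] → ℕ} {a : F[X] → ℕ → F[X]}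
    (hS : ∀ P ∈ S, P.Monic ∧ Irreducible P) :
    aM (pfN S e) ^ 2 * pf S e a = aM (pfB S e a) := by
  rw [pf, pfB, Finset.mul_sum, map_sum]
  refine Finset.sum_congr rfl fun P hP => ?_
  rw [Finset.mul_sum, map_sum]
  refine Finset.sum_congr rfl fun i hi => ?_
  rw [Finset.mem_Icc] at hi
  have hP0 : aM P ≠ 0 := aM_ne (hS P hP).1.ne_zero
  rw [pfN_eq hP]
  simp only [map_mul, map_pow]
  rw [← mul_div_assoc, div_eq_iff (pow_ne_zero _ hP0)]
  have : 2 * e P = (2 * (e P - i) + 1) + (2 * i - 1) := by omega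
  calc _ = aM P ^ (2 * e P) * aM (∏ Q ∈ S.erase P, Q ^ e Q) ^ 2 * aM (a P i) := by ring
    _ = _ := by rw [this]; ring

lemma pfB_deg {S : Finset F[X]} {e : F[X] → ℕ} {a : F[X] → ℕ → F[X]}
    (hS : ∀ P ∈ S, P.Monic ∧ Irreducible P)
    (ha : ∀ P ∈ S, ∀ i, 1 ≤ i → i ≤ e P → (a P i).degree < P.degree) :
    (pfB S e a).degree < (2 * (pfN S e).natDegree : ℕ) := by
  rw [← mem_degreeLT, pfB]
  refine Submodule.sum_mem _ fun P hP => Submodule.sum_mem _ fun i hi => ?_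
  rw [Finset.mem_Icc] at hi
  rw [mem_degreeLT]
  have hd := ha P hP i hi.1 hi.2
  have hPm := (hS P hP).1
  set M := ∏ Q ∈ S.erase P, Q ^ e Q with hMdef
  have hM : M.Monic := monic_prod_of_monic _ _ fun Q hQ => (hS Q (Finset.mem_of_mem_erase hQ)).1.pow _
  by_cases h0 : a P i = 0
  · rw [h0, zero_mul, mul_zero, degree_zero]
    exact WithBot.bot_lt_coe _
  have h1 : (a P i).natDegree < P.natDegree := natDegree_lt_natDegree h0 hd
  rw [degree_eq_natDegree (mul_ne_zero (pow_ne_zero _ hM.ne_zero) (mul_ne_zero h0 (pow_ne_zero _ hPm.ne_zero)))]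
  rw [pfN_eq hP, ← hMdef, (hPm.pow _).natDegree_mul hM, hPm.natDegree_pow]
  rw [natDegree_mul (pow_ne_zero _ hM.ne_zero) (mul_ne_zero h0 (pow_ne_zero _ hPm.ne_zero)),
    natDegree_mul h0 (pow_ne_zero _ hPm.ne_zero), hPm.natDegree_pow, hM.natDegree_pow]
  norm_cast
  have h2 : (2 * (e P - i) + 1) + 1 ≤ 2 * e P := by omega
  have h3 := Nat.mul_le_mul_right P.natDegree h2
  nlinarith

lemma pfB_local {S : Finset F[X]} {e : F[X] → ℕ} {a : F[X] → ℕ → F[X]}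
    (he : ∀ P ∈ S, 1 ≤ e P) {P : F[X]} (hP : P ∈ S) :
    ∃ t, pfB S e a = (∏ Q ∈ S.erase P, Q ^ e Q) ^ 2 * a P (e P) * P + P ^ 2 * t := by
  have h1 : P ^ 2 ∣ ∑ Q ∈ S.erase P, ∑ i ∈ Finset.Icc 1 (e Q),
    (∏ R ∈ S.erase Q, R ^ e R) ^ 2 * (a Q i * Q ^ (2 * (e Q - i) + 1)) := by
    refine Finset.dvd_sum fun Q hQ => Finset.dvd_sum fun i _ => ?_
    apply Dvd.dvd.mul_right
    apply pow_dvd_pow_of_dvd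
    have hPQ : P ∈ S.erase Q := by
      rw [Finset.mem_erase] at hQ ⊢
      exact ⟨hQ.1.symm, hP⟩
    exact (dvd_pow_self P (by have := he P hP; omega)).trans (Finset.dvd_prod_of_mem (fun R => R ^ e R) hPQ)
  obtain ⟨t1, ht1⟩ := h1
  have h2 : P ^ 2 ∣ ∑ i ∈ (Finset.Icc 1 (e P)).erase (e P),
    (∏ R ∈ S.erase P, R ^ e R) ^ 2 * (a P i * P ^ (2 * (e P - i) + 1)) := by
    refine Finset.dvd_sum fun i hi => ?_
    rw [Finset.mem_erase, Finset.mem_Icc] at hi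
    apply Dvd.dvd.mul_left
    apply Dvd.dvd.mul_left
    exact pow_dvd_pow P (by omega)
  obtain ⟨t2, ht2⟩ := h2
  refine ⟨t2 + t1, ?_⟩
  rw [pfB, ← Finset.add_sum_erase S _ hP, ht1,
    ← Finset.add_sum_erase (Finset.Icc 1 (e P)) _ (Finset.mem_Icc.2 ⟨he P hP, le_rfl⟩), ht2]
  simp only [Nat.sub_self, mul_zero, zero_add, pow_one]
  ring

lemma pfB_dvd {S : Finset F[X]} {e : F[X] → ℕ} {a : F[X] → ℕ → F[X]}
    (he : ∀ P ∈ S, 1 ≤ e P) {P : F[X]} (hP : P ∈ S) : P ∣ pfB S e a := by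
  obtain ⟨t, ht⟩ := pfB_local (a := a) he hP
  rw [ht]
  exact dvd_add (dvd_mul_left _ _) ((dvd_pow_self P two_ne_zero).mul_right _)

lemma mem_of_dvd {S : Finset F[X]} {e : F[X] → ℕ} (hS : ∀ P ∈ S, P.Monic ∧ Irreducible P)
    {P : F[X]} (hP : P.Monic) (hP' : Irreducible P) (h : P ∣ ∏ Q ∈ S, Q ^ e Q) : P ∈ S := by
  obtain ⟨Q, hQ, h1⟩ := (hP'.prime.dvd_finsetProd_iff _).1 h
  have h2 := hP'.prime.dvd_of_dvd_pow h1
  have h3 : P = Q := eq_of_monic_of_associated hP (hS Q hQ).1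
    (hP'.associated_of_dvd (hS Q hQ).2 h2)
  rwa [h3]

lemma pfB_sq {S : Finset F[X]} {e : F[X] → ℕ} {a : F[X] → ℕ → F[X]}
    (hS : ∀ P ∈ S, P.Monic ∧ Irreducible P)
    (he : ∀ P ∈ S, 1 ≤ e P) {P : F[X]} (hP : P ∈ S)
    (hd : (a P (e P)).degree < P.degree) : P ^ 2 ∣ pfB S e a ↔ a P (e P) = 0 := by
  obtain ⟨t, ht⟩ := pfB_local (a := a) he hP
  constructor
  · intro h
    rw [ht, dvd_add_left (dvd_mul_right _ _), pow_two,
      mul_dvd_mul_iff_right (hS P hP).1.ne_zero] at h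
    rcases (hS P hP).2.prime.dvd_or_dvd h with h1 | h1
    · exfalso
      have h2 := (hS P hP).2.prime.dvd_of_dvd_pow h1
      have h3 := mem_of_dvd (S := S.erase P) (fun Q hQ => hS Q (Finset.mem_of_mem_erase hQ))
        (hS P hP).1 (hS P hP).2 h2
      simp at h3
    · by_contra h0
      exact absurd (degree_le_of_dvd h1 h0) (not_le.2 hd)
  · intro h
    rw [ht, h]
    simp

/-- normal form data of level `N` -/
def Dat (N : F[X]) (v : RatFunc F) : Prop :=
  ∃ (S : Finset F[X]) (e : F[X] → ℕ) (a : F[X] → ℕ → F[X]),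
      (∀ P ∈ S, P.Monic ∧ Irreducible P) ∧
      (∀ P ∈ S, 1 ≤ e P) ∧
      (∀ P ∈ S, ∀ i, 1 ≤ i → i ≤ e P → (a P i).degree < P.degree) ∧
      (∀ P ∈ S, a P (e P) ≠ 0) ∧ N = pfN S e ∧ v = pf S e a

lemma natDegree_pfN {S : Finset F[X]} {e : F[X] → ℕ} (hS : ∀ P ∈ S, P.Monic ∧ Irreducible P) :
    (pfN S e).natDegree = ∑ P ∈ S, e P * P.natDegree := by
  rw [pfN, natDegree_prod_of_monic _ _ fun P hP => (hS P hP).1.pow _]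
  exact Finset.sum_congr rfl fun P hP => (hS P hP).1.natDegree_pow _

lemma mem_Ffam_iff {n : ℕ} {v : RatFunc F} : v ∈ Ffam F n ↔ ∃ N, Dat N v ∧ N.natDegree = n := by
  constructor
  · rintro ⟨S, e, a, h1, h2, h3, h4, h5, h6⟩
    exact ⟨pfN S e, ⟨S, e, a, h1, h2, h3, h4, rfl, h6⟩, by rw [natDegree_pfN h1, h5]⟩
  · rintro ⟨N, ⟨S, e, a, h1, h2, h3, h4, h5, h6⟩, h7⟩
    exact ⟨S, e, a, h1, h2, h3, h4, by rw [← natDegree_pfN h1, ← h5, h7], h6⟩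

lemma Dat.monic {N : F[X]} {v : RatFunc F} (h : Dat N v) : N.Monic := by
  obtain ⟨S, e, a, h1, h2, h3, h4, rfl, rfl⟩ := h
  exact pfN_monic h1

lemma Dat.num {N : F[X]} {v : RatFunc F} (h : Dat N v) : ∃ B : F[X], aM N ^ 2 * v = aM B ∧
    B.degree < (2 * N.natDegree : ℕ) ∧
    ∀ P : F[X], P.Monic → Irreducible P → P ∣ N → P ∣ B ∧ ¬ P ^ 2 ∣ B := by
  obtain ⟨S, e, a, h1, h2, h3, h4, rfl, rfl⟩ := h
  refine ⟨pfB S e a, pf_eq h1, pfB_deg h1 h3, fun P hP hP' hd => ?_⟩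
  have hPS := mem_of_dvd h1 hP hP' hd
  refine ⟨pfB_dvd h2 hPS, ?_⟩
  rw [pfB_sq h1 h2 hPS (h3 P hPS _ (h2 P hPS) le_rfl)]
  exact h4 P hPS

lemma MX_of {N B : F[X]} (h : ∀ P : F[X], P.Monic → Irreducible P → P ∣ N → P ∣ B ∧ ¬ P ^ 2 ∣ B) :
    MX N B := by
  rintro P hP hP' ⟨hd, w, hw⟩
  obtain ⟨h1, h2⟩ := h P hP hP' hd
  apply h2
  have h3 : P ∣ w := by
    have h4 : P ∣ w ^ 2 + N * w + B := (dvd_pow_self P two_ne_zero).trans hw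
    rw [add_assoc, dvd_add_left (dvd_add (hd.mul_right w) h1)] at h4
    exact hP'.prime.dvd_of_dvd_pow h4
  have h5 : P ^ 2 ∣ w ^ 2 + N * w := by
    refine dvd_add (pow_dvd_pow_of_dvd h3 2) ?_
    rw [pow_two]
    exact mul_dvd_mul hd h3
  exact (dvd_add_right h5).1 hw

lemma nonMax_add {P N B w Q : F[X]} : nonMax P N (B + (w ^ 2 + N * w + N ^ 2 * Q)) → nonMax P N B := by
  rintro ⟨hd, v, hv⟩
  refine ⟨hd, v + w, ?_⟩
  have h1 : P ^ 2 ∣ N ^ 2 * Q := (pow_dvd_pow_of_dvd hd 2).mul_right Q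
  have h2 := dvd_sub hv h1
  convert h2 using 1
  linear_combination (v * w) * two_eq_zero_poly (F := F)

lemma MX.add {N B : F[X]} (h : MX N B) (w Q : F[X]) : MX N (B + (w ^ 2 + N * w + N ^ 2 * Q)) :=
  fun P hP hP' hn => h P hP hP' (nonMax_add hn)

lemma MX.mod {N B : F[X]} (h : MX N B) (Q : F[X]) : MX N (B + N ^ 2 * Q) := by
  have := h.add 0 Q
  simpa using this

lemma int_rat {N C : F[X]} {w : RatFunc F} (h : w ^ 2 + aM N * w = aM C) : ∃ p : F[X], aM p = w := by
  apply IsIntegrallyClosed.isIntegral_iff.1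
  refine ⟨X ^ 2 + Polynomial.C N * X + Polynomial.C (-C), by monicity!, ?_⟩
  simp only [eval₂_add, eval₂_mul, eval₂_pow, eval₂_X, eval₂_C, eval₂_neg, map_neg, ← h]
  ring

/-- level is unique -/
lemma Dat.unique_dvd {N N' : F[X]} {v : RatFunc F} (h : Dat N v) (h' : Dat N' v) : N ∣ N' := by
  obtain ⟨B, hB, -, hP⟩ := h.num
  obtain ⟨B', hB', -, -⟩ := h'.num
  have hN0 := h.monic.ne_zero
  have hE : N' ^ 2 * B = N ^ 2 * B' := by
    apply aM_inj
    simp only [map_mul, map_pow, ← hB, ← hB']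
    ring
  obtain ⟨a, b, c, hab, ha, hb⟩ := UniqueFactorizationMonoid.exists_reduced_factors N hN0 N'
  have hc0 : c ≠ 0 := by rintro rfl; rw [zero_mul] at ha; exact hN0 ha.symm
  have hE2 : b ^ 2 * B = a ^ 2 * B' := by
    apply mul_left_cancel₀ (pow_ne_zero 2 hc0)
    rw [← ha, ← hb] at hE
    linear_combination hE
  have hdv : a ^ 2 ∣ B := by
    have h1 : IsCoprime (a ^ 2) (b ^ 2) := hab.isCoprime.pow
    exact h1.dvd_of_dvd_mul_left ⟨B', hE2⟩
  have hau : IsUnit a := by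
    by_contra hu
    have ha0 : a ≠ 0 := by rintro rfl; rw [mul_zero] at ha; exact hN0 ha.symm
    obtain ⟨P, hPi, hPd⟩ := WfDvdMonoid.exists_irreducible_factor hu ha0
    have has : Associated P (normalize P) := associated_normalize P
    have hPd' : normalize P ∣ a := has.symm.dvd.trans hPd
    refine (hP (normalize P) (monic_normalize hPi.ne_zero) (has.irreducible hPi) ?_).2 ?_
    · rw [← ha]; exact hPd'.mul_left c
    · exact (pow_dvd_pow_of_dvd hPd' 2).trans hdv
  rw [← ha, ← hb]
  exact mul_dvd_mul_left c (hau.dvd)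

lemma Dat.unique {N N' : F[X]} {v : RatFunc F} (h : Dat N v) (h' : Dat N' v) : N = N' :=
  eq_of_monic_of_associated h.monic h'.monic
    (associated_of_dvd_dvd (h.unique_dvd h') (h'.unique_dvd h))

/-- no non-trivial normal form is of the form `z ^ 2 + z` plus a polynomial -/
lemma Dat.inj {N : F[X]} {v z : RatFunc F} (h : Dat N v) {G : F[X]}
    (hz : v + aM G = z ^ 2 + z) : N = 1 := by
  obtain ⟨B, hB, -, hP⟩ := h.num
  by_contra hN
  have hu : ¬ IsUnit N := fun h1 => hN (h.monic.eq_one_of_isUnit h1)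
  obtain ⟨P, hPi, hPd⟩ := WfDvdMonoid.exists_irreducible_factor hu h.monic.ne_zero
  have has : Associated P (normalize P) := associated_normalize P
  have hPd' : normalize P ∣ N := has.symm.dvd.trans hPd
  have hPm := monic_normalize hPi.ne_zero
  have hPi' := has.irreducible hPi
  have hw : (aM N * z) ^ 2 + aM N * (aM N * z) = aM (B + N ^ 2 * G) := by
    simp only [map_add, map_mul, map_pow, ← hB]
    linear_combination (- aM N ^ 2) * hz
  obtain ⟨w, hw1⟩ := int_rat hw
  rw [← hw1] at hw
  have hw2 : w ^ 2 + N * w = B + N ^ 2 * G := aM_inj (by simpa using hw)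
  have hMX := MX_of hP
  refine hMX _ hPm hPi' ⟨hPd', w, ?_⟩
  have : w ^ 2 + N * w + B = N ^ 2 * G := by
    rw [hw2]; linear_combination B * two_eq_zero_poly (F := F)
  rw [this]
  exact (pow_dvd_pow_of_dvd hPd' 2).mul_right G

/-- sums of normal shape -/
def Sh (v : RatFunc F) : Prop :=
  ∃ (S : Finset F[X]) (E : ℕ) (a : F[X] → ℕ → F[X]),
      (∀ P ∈ S, P.Monic ∧ Irreducible P) ∧
      (∀ P ∈ S, ∀ i, (a P i).degree < P.degree) ∧
      (∀ P i, (P ∉ S ∨ i = 0 ∨ E < i) → a P i = 0) ∧ v = pf S (fun _ => E) a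

lemma Dat.sh {N : F[X]} {v : RatFunc F} (h : Dat N v) : Sh v := by
  obtain ⟨S, e, a, h1, h2, h3, h4, rfl, rfl⟩ := h
  let a' : F[X] → ℕ → F[X] := fun P i => if P ∈ S ∧ 1 ≤ i ∧ i ≤ e P then a P i else 0
  refine ⟨S, S.sup e, a', h1, ?_, ?_, ?_⟩
  · intro P hP i
    simp only [a']
    split_ifs with h
    · exact h3 P hP i h.2.1 h.2.2
    · rw [degree_zero, bot_lt_iff_ne_bot, Ne, degree_eq_bot]
      exact (h1 P hP).1.ne_zero
  · intro P i h
    simp only [a']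
    rw [if_neg]
    rintro ⟨h5, h6, h7⟩
    have := Finset.le_sup (f := e) h5
    rcases h with h | h | h
    · exact h h5
    · omega
    · omega
  · rw [pf, pf]
    refine Finset.sum_congr rfl fun P hP => ?_
    have hsub : Finset.Icc 1 (e P) ⊆ Finset.Icc 1 (S.sup e) :=
      Finset.Icc_subset_Icc_right (Finset.le_sup (f := e) hP)
    rw [← Finset.sum_subset hsub]
    · refine Finset.sum_congr rfl fun i hi => ?_
      rw [Finset.mem_Icc] at hi
      simp only [a']
      rw [if_pos ⟨hP, hi⟩]
    · intro i _ hi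
      rw [Finset.mem_Icc] at hi
      simp only [a']
      rw [if_neg (fun h => hi h.2)]
      simp

lemma pf_extend {S S' : Finset F[X]} {E E' : ℕ} {a : F[X] → ℕ → F[X]} (hS : S ⊆ S') (hE : E ≤ E')
    (h : ∀ P i, (P ∉ S ∨ i = 0 ∨ E < i) → a P i = 0) :
    pf S (fun _ => E) a = pf S' (fun _ => E') a := by
  rw [pf, pf, ← Finset.sum_subset hS]
  · refine Finset.sum_congr rfl fun P _ => ?_
    refine Finset.sum_subset (Finset.Icc_subset_Icc_right hE) ?_
    intro i _ hi
    rw [Finset.mem_Icc] at hi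
    rw [h P i (Or.inr (by omega))]
    simp
  · intro P _ hP
    refine Finset.sum_eq_zero fun i _ => ?_
    rw [h P i (Or.inl hP)]
    simp

lemma pf_add {S : Finset F[X]} {e : F[X] → ℕ} {a b : F[X] → ℕ → F[X]} :
    pf S e a + pf S e b = pf S e (fun P i => a P i + b P i) := by
  rw [pf, pf, pf, ← Finset.sum_add_distrib]
  refine Finset.sum_congr rfl fun P _ => ?_
  rw [← Finset.sum_add_distrib]
  refine Finset.sum_congr rfl fun i _ => ?_
  rw [map_add, add_div]

lemma Sh.add {v v' : RatFunc F} (h : Sh v) (h' : Sh v') : Sh (v + v') := by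
  obtain ⟨S, E, a, h1, h2, h3, rfl⟩ := h
  obtain ⟨S', E', a', h1', h2', h3', rfl⟩ := h'
  have hU : ∀ P ∈ S ∪ S', P.Monic ∧ Irreducible P := by
    intro P hP
    rcases Finset.mem_union.1 hP with h | h
    · exact h1 P h
    · exact h1' P h
  refine ⟨S ∪ S', max E E', fun P i => a P i + a' P i, hU, ?_, ?_, ?_⟩
  · intro P hP i
    have hb : (⊥ : WithBot ℕ) < P.degree := by
      rw [bot_lt_iff_ne_bot, Ne, degree_eq_bot]
      exact (hU P hP).1.ne_zero
    refine (degree_add_le _ _).trans_lt (max_lt ?_ ?_)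
    · by_cases h : P ∈ S
      · exact h2 P h i
      · rw [h3 P i (Or.inl h), degree_zero]; exact hb
    · by_cases h : P ∈ S'
      · exact h2' P h i
      · rw [h3' P i (Or.inl h), degree_zero]; exact hb
  · intro P i h
    rw [Finset.mem_union, not_or, max_lt_iff] at h
    simp only []
    rw [h3 P i (by tauto), h3' P i (by tauto), add_zero]
  · rw [pf_extend Finset.subset_union_left (le_max_left E E') h3,
      pf_extend (a := a') Finset.subset_union_right (le_max_right E E') h3', pf_add]

lemma Sh.dat {v : RatFunc F} (h : Sh v) : ∃ N, Dat N v := by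
  obtain ⟨S, E, a, h1, h2, h3, rfl⟩ := h
  let S0 := S.filter fun P => ∃ i, a P i ≠ 0
  let e : F[X] → ℕ := fun P => ((Finset.Icc 1 E).filter fun i => a P i ≠ 0).sup id
  have hle : ∀ P, e P ≤ E := fun P => Finset.sup_le fun i hi => by
    rw [Finset.mem_filter, Finset.mem_Icc] at hi; exact hi.1.2
  have hmax : ∀ P i, a P i ≠ 0 → 1 ≤ i ∧ i ≤ e P := by
    intro P i hi
    have h4 : 1 ≤ i ∧ i ≤ E := by
      by_contra h5
      exact hi (h3 P i (by omega))
    refine ⟨h4.1, ?_⟩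
    exact Finset.le_sup (f := id) (Finset.mem_filter.2 ⟨Finset.mem_Icc.2 h4, hi⟩)
  refine ⟨pfN S0 e, S0, e, a, ?_, ?_, ?_, ?_, rfl, ?_⟩
  · intro P hP; exact h1 P (Finset.mem_filter.1 hP).1
  · intro P hP
    obtain ⟨i, hi⟩ := (Finset.mem_filter.1 hP).2
    have := hmax P i hi
    omega
  · intro P hP i _ _; exact h2 P (Finset.mem_filter.1 hP).1 i
  · intro P hP
    obtain ⟨i, hi⟩ := (Finset.mem_filter.1 hP).2
    have h4 := hmax P i hi
    have hne : ((Finset.Icc 1 E).filter fun i => a P i ≠ 0).Nonempty :=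
      ⟨i, Finset.mem_filter.2 ⟨Finset.mem_Icc.2 ⟨h4.1, h4.2.trans (hle P)⟩, hi⟩⟩
    obtain ⟨j, hj, hj2⟩ := Finset.exists_mem_eq_sup _ hne id
    have h5 : e P = j := hj2
    rw [h5]
    exact (Finset.mem_filter.1 hj).2
  · rw [pf, pf]
    rw [← Finset.sum_subset (Finset.filter_subset _ S : S0 ⊆ S)]
    · refine Finset.sum_congr rfl fun P _ => ?_
      symm
      refine Finset.sum_subset (Finset.Icc_subset_Icc_right (hle P)) ?_
      intro i hi hi2
      rw [Finset.mem_Icc] at hi hi2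
      have : a P i = 0 := by
        by_contra h0
        exact hi2 (hmax P i h0)
      rw [this]; simp
    · intro P hP hP2
      refine Finset.sum_eq_zero fun i _ => ?_
      have : a P i = 0 := by
        by_contra h0
        exact hP2 (Finset.mem_filter.2 ⟨hP, i, h0⟩)
      rw [this]; simp

lemma Dat.one {v : RatFunc F} (h : Dat 1 v) : v = 0 := by
  obtain ⟨S, e, a, h1, h2, h3, h4, h5, rfl⟩ := h
  have : S = ∅ := by
    by_contra hne
    obtain ⟨P, hP⟩ := Finset.nonempty_iff_ne_empty.2 hne
    have h6 : P ∣ 1 := by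
      rw [h5, pfN_eq hP]
      exact (dvd_pow_self P (by have := h2 P hP; omega)).mul_right _
    exact (h1 P hP).2.not_isUnit (isUnit_of_dvd_one h6)
  rw [this, pf, Finset.sum_empty]

/-- injectivity of the fractional parts -/
lemma sh_inj {v z : RatFunc F} (h : Sh v) {G : F[X]} (hz : v + aM G = z ^ 2 + z) : v = 0 := by
  obtain ⟨N, hN⟩ := h.dat
  have h1 := hN.inj hz
  subst h1
  exact hN.one

end M8
end EvenChar

namespace EvenChar
section M8b
open scoped Classical
set_option linter.unusedSectionVars false
set_option linter.unusedSimpArgs false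
set_option linter.style.haveILetI false
variable {F : Type} [Field F] [Fintype F] [CharP F 2]

local notation "aM" => algebraMap F[X] (RatFunc F)

lemma sqrt_mod {P : F[X]} (hP : P.Monic) (hPi : Irreducible P) (C : F[X]) :
    ∃ b : F[X], b.degree < P.degree ∧ P ∣ b ^ 2 + C := by
  haveI : Fact (Irreducible P) := ⟨hPi⟩
  haveI : Module.Finite F (AdjoinRoot P) := hP.finite_adjoinRoot
  haveI : Finite (AdjoinRoot P) := Module.finite_of_finite F
  haveI : CharP (AdjoinRoot P) 2 := charP_of_injective_algebraMap (algebraMap F (AdjoinRoot P)).injective 2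
  obtain ⟨y, hy⟩ := isSquare_of_charTwo' (AdjoinRoot.mk P C)
  obtain ⟨b, rfl⟩ := AdjoinRoot.mk_surjective y
  refine ⟨b %ₘ P, degree_modByMonic_lt _ hP, ?_⟩
  have h1 : AdjoinRoot.mk P (b ^ 2 + C) = 0 := by
    rw [map_add, map_pow, hy, pow_two, CharTwo.add_self_eq_zero]
  rw [AdjoinRoot.mk_eq_zero] at h1
  have h2 : P ∣ b - b %ₘ P := ⟨b /ₘ P, by linear_combination -(modByMonic_add_div b P)⟩
  have h3 : P ∣ b ^ 2 - (b %ₘ P) ^ 2 := h2.trans (sub_dvd_pow_sub_pow _ _ 2)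
  have := dvd_sub h1 h3
  convert this using 1
  ring

lemma local_nf {P : F[X]} (hP : P.Monic) (hPi : Irreducible P) (e : ℕ) : ∀ C : F[X],
    C.degree < (2 * e * P.natDegree : ℕ) → ∃ (b : F[X]) (a : ℕ → F[X]), (∀ i, (a i).degree < P.degree) ∧
    aM C / aM P ^ (2 * e) = (aM b / aM P ^ e) ^ 2 + aM b / aM P ^ e +
      ∑ i ∈ Finset.Icc 1 e, aM (a i) / aM P ^ (2 * i - 1) := by
  have hP0 : aM P ≠ 0 := aM_ne hP.ne_zero
  have hb : (0 : F[X]).degree < P.degree := by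
    rw [degree_zero, bot_lt_iff_ne_bot, Ne, degree_eq_bot]
    exact hP.ne_zero
  induction e with
  | zero =>
    intro C hC
    have : C = 0 := by
      rw [← degree_eq_bot]
      simpa using hC
    exact ⟨0, fun _ => 0, fun _ => hb, by simp [this]⟩
  | succ e ih =>
    intro C hC
    obtain ⟨b0, hb0, C', hC'⟩ := sqrt_mod hP hPi C
    -- `C + b0² + b0 P^(e+1) = P (C' + b0 P^e)`
    set D := C' + b0 * P ^ e with hD
    have hDeq : C + b0 ^ 2 + b0 * P ^ (e + 1) = P * D := by
      rw [hD]; linear_combination hC'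
    have hPd : P.degree = (P.natDegree : ℕ) := degree_eq_natDegree hP.ne_zero
    have hPpos : 0 < P.natDegree := hPi.natDegree_pos
    have hDdeg : (P * D).degree < (2 * (e + 1) * P.natDegree : ℕ) := by
      rw [← hDeq, ← mem_degreeLT]
      refine Submodule.add_mem _ (Submodule.add_mem _ (mem_degreeLT.2 hC) ?_) ?_
      · rw [mem_degreeLT]
        by_cases h0 : b0 = 0
        · rw [h0, zero_pow two_ne_zero, degree_zero]; exact WithBot.bot_lt_coe _
        have := natDegree_lt_natDegree h0 hb0
        rw [degree_eq_natDegree (pow_ne_zero 2 h0), natDegree_pow]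
        norm_cast
        nlinarith
      · rw [mem_degreeLT]
        by_cases h0 : b0 = 0
        · rw [h0, zero_mul, degree_zero]; exact WithBot.bot_lt_coe _
        have := natDegree_lt_natDegree h0 hb0
        rw [degree_eq_natDegree (mul_ne_zero h0 (pow_ne_zero _ hP.ne_zero)),
          natDegree_mul h0 (pow_ne_zero _ hP.ne_zero), hP.natDegree_pow]
        norm_cast
        nlinarith
    have hE : (D /ₘ P).degree < (2 * e * P.natDegree : ℕ) := by
      by_cases h0 : D /ₘ P = 0
      · rw [h0, degree_zero]; exact WithBot.bot_lt_coe _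
      have hD0 : D ≠ 0 := by rintro h1; rw [h1, zero_divByMonic] at h0; exact h0 rfl
      rw [degree_eq_natDegree (mul_ne_zero hP.ne_zero hD0), natDegree_mul hP.ne_zero hD0] at hDdeg
      rw [degree_eq_natDegree h0, natDegree_divByMonic D hP]
      norm_cast at hDdeg ⊢
      have h1 : 2 * (e + 1) * P.natDegree = 2 * e * P.natDegree + 2 * P.natDegree := by ring
      have h2 : P.natDegree ≤ D.natDegree := by
        by_contra hlt
        apply h0
        rw [divByMonic_eq_zero_iff hP]
        exact degree_lt_degree (not_le.1 hlt)
      omega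
    obtain ⟨b, a, ha, hba⟩ := ih (D /ₘ P) hE
    refine ⟨b0 + P * b, fun i => if i = e + 1 then D %ₘ P else a i, ?_, ?_⟩
    · intro i
      simp only []
      split_ifs
      · exact degree_modByMonic_lt _ hP
      · exact ha i
    · rw [Finset.sum_Icc_succ_top (by omega)]
      have hs : ∑ i ∈ Finset.Icc 1 e, aM (if i = e + 1 then D %ₘ P else a i) / aM P ^ (2 * i - 1) =
          ∑ i ∈ Finset.Icc 1 e, aM (a i) / aM P ^ (2 * i - 1) := by
        refine Finset.sum_congr rfl fun i hi => ?_
        rw [Finset.mem_Icc] at hi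
        rw [if_neg (by omega)]
      rw [hs]
      simp only [if_true]
      have hs2 : ∑ i ∈ Finset.Icc 1 e, aM (a i) / aM P ^ (2 * i - 1) =
        aM (D /ₘ P) / aM P ^ (2 * e) - (aM b / aM P ^ e) ^ 2 - aM b / aM P ^ e := by
        rw [hba]; ring
      rw [hs2, show 2 * (e + 1) - 1 = 2 * e + 1 by omega]
      have h1 : aM C = aM P * (aM (D %ₘ P) + aM P * aM (D /ₘ P)) - aM b0 ^ 2 - aM b0 * aM P ^ (e + 1) := by
        have h2 := congrArg aM hDeq
        rw [← modByMonic_add_div D P] at h2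
        simp only [map_add, map_mul, map_pow] at h2
        linear_combination h2
      have h2 := two_eq_zero_rat (F := F)
      rw [h1, map_add, map_mul]
      have hpe : aM P ^ e ≠ 0 := pow_ne_zero _ hP0
      have e1 : aM P ^ (2 * (e + 1)) = (aM P ^ e) ^ 2 * aM P ^ 2 := by ring
      have e2 : aM P ^ (e + 1) = aM P ^ e * aM P := by ring
      have e3 : aM P ^ (2 * e + 1) = (aM P ^ e) ^ 2 * aM P := by ring
      have e4 : aM P ^ (2 * e) = (aM P ^ e) ^ 2 := by ring
      rw [e1, e2, e3, e4]
      generalize aM P ^ e = p at *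
      have hL : (aM P * (aM (D %ₘ P) + aM P * aM (D /ₘ P)) - aM b0 ^ 2 - aM b0 * (p * aM P)) / (p ^ 2 * aM P ^ 2)
          = aM (D %ₘ P) / (p ^ 2 * aM P) + aM (D /ₘ P) / p ^ 2 - (aM b0 / (p * aM P)) ^ 2 - aM b0 / (p * aM P) := by
        field_simp
      have hR : (aM b0 + aM P * aM b) / (p * aM P) = aM b0 / (p * aM P) + aM b / p := by
        field_simp
      rw [hL, hR]
      linear_combination (-(aM b0 / (p * aM P)) ^ 2 - aM b0 / (p * aM P) - aM b0 / (p * aM P) * (aM b / p)) * h2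

lemma exists_pfN {N : F[X]} (hN : N.Monic) : ∃ (S : Finset F[X]) (e : F[X] → ℕ),
    (∀ P ∈ S, P.Monic ∧ Irreducible P) ∧ (∀ P ∈ S, 1 ≤ e P) ∧ N = pfN S e := by
  refine ⟨(UniqueFactorizationMonoid.normalizedFactors N).toFinset,
    fun P => (UniqueFactorizationMonoid.normalizedFactors N).count P, ?_, ?_, ?_⟩
  · intro P hP
    rw [Multiset.mem_toFinset] at hP
    have h1 := UniqueFactorizationMonoid.irreducible_of_normalized_factor P hP
    refine ⟨?_, h1⟩
    rw [← UniqueFactorizationMonoid.normalize_normalized_factor P hP]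
    exact monic_normalize h1.ne_zero
  · intro P hP
    rw [Multiset.mem_toFinset] at hP
    exact Multiset.one_le_count_iff_mem.2 hP
  · rw [pfN, ← Finset.prod_multiset_count, UniqueFactorizationMonoid.prod_normalizedFactors_eq hN.ne_zero,
      hN.normalize_eq_self]

lemma surj0 {N B : F[X]} (hN : N.Monic) (hB : B.degree < (2 * N.natDegree : ℕ)) (hM : MX N B) :
    ∃ (v : RatFunc F) (w : F[X]), Dat N v ∧ aM B = aM N ^ 2 * v + aM (w ^ 2 + N * w) := by
  obtain ⟨S, e, hS, he, rfl⟩ := exists_pfN hN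
  have hcop : Set.Pairwise (↑S : Set F[X]) fun P Q => IsCoprime (P ^ (2 * e P)) (Q ^ (2 * e Q)) := by
    intro P hP Q hQ hne
    apply IsCoprime.pow
    rw [(hS P hP).2.coprime_iff_not_dvd]
    intro hd
    exact hne (eq_of_monic_of_associated (hS P hP).1 (hS Q hQ).1
      ((hS P hP).2.associated_of_dvd (hS Q hQ).2 hd))
  obtain ⟨Q, C, hC, hQC⟩ := div_prod_eq_quo_add_sum_rem_div (RatFunc F) B
    (g := fun P : F[X] => P ^ (2 * e P)) (s := S) (fun P hP => (hS P hP).1.pow _) hcop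
  change aM B / ∏ P ∈ S, aM (P ^ (2 * e P)) = aM Q + ∑ P ∈ S, aM (C P) / aM (P ^ (2 * e P)) at hQC
  have hprod : ∏ P ∈ S, aM (P ^ (2 * e P)) = aM (pfN S e) ^ 2 := by
    rw [pfN, map_prod, ← Finset.prod_pow]
    refine Finset.prod_congr rfl fun P _ => ?_
    rw [map_pow, map_pow]; ring
  have hN0 : aM (pfN S e) ≠ 0 := aM_ne hN.ne_zero
  have hQ : Q = 0 := by
    have h1 : B - Q * (pfN S e) ^ 2 = ∑ P ∈ S, (∏ R ∈ S.erase P, R ^ e R) ^ 2 * C P := by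
      apply aM_inj
      rw [map_sub, map_sum, map_mul, map_pow]
      have h2 : aM B = (aM Q + ∑ P ∈ S, aM (C P) / aM (P ^ (2 * e P))) * aM (pfN S e) ^ 2 := by
        rw [← hQC, ← hprod]
        rw [div_mul_cancel₀]
        rw [hprod]
        exact pow_ne_zero 2 hN0
      rw [h2, add_mul, add_sub_cancel_left, Finset.sum_mul]
      refine Finset.sum_congr rfl fun P hP => ?_
      have hP0 : aM P ≠ 0 := aM_ne (hS P hP).1.ne_zero
      rw [pfN_eq hP]
      simp only [map_mul, map_pow]
      rw [div_mul_eq_mul_div, div_eq_iff (pow_ne_zero _ hP0)]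
      ring
    have h3 : (B - Q * (pfN S e) ^ 2).degree < (2 * (pfN S e).natDegree : ℕ) := by
      rw [h1, ← mem_degreeLT]
      refine Submodule.sum_mem _ fun P hP => ?_
      rw [mem_degreeLT]
      by_cases h0 : C P = 0
      · rw [h0, mul_zero, degree_zero]; exact WithBot.bot_lt_coe _
      have hPm := (hS P hP).1
      have h4 := natDegree_lt_natDegree h0 (hC P hP)
      rw [hPm.natDegree_pow] at h4
      have hMm : (∏ R ∈ S.erase P, R ^ e R).Monic :=
        monic_prod_of_monic _ _ fun R hR => (hS R (Finset.mem_of_mem_erase hR)).1.pow _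
      rw [degree_eq_natDegree (mul_ne_zero (pow_ne_zero _ hMm.ne_zero) h0),
        natDegree_mul (pow_ne_zero _ hMm.ne_zero) h0, hMm.natDegree_pow, pfN_eq hP,
        (hPm.pow _).natDegree_mul hMm, hPm.natDegree_pow]
      norm_cast
      nlinarith
    by_contra hQ0
    have h5 : (Q * (pfN S e) ^ 2).degree < (2 * (pfN S e).natDegree : ℕ) := by
      rw [← mem_degreeLT] at h3 hB ⊢
      have := Submodule.sub_mem _ hB h3
      rwa [sub_sub_cancel] at this
    rw [degree_eq_natDegree (mul_ne_zero hQ0 (pow_ne_zero _ hN.ne_zero)),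
      natDegree_mul hQ0 (pow_ne_zero _ hN.ne_zero), hN.natDegree_pow] at h5
    norm_cast at h5
    omega
  have hC' : ∀ P ∈ S, ∃ (b : F[X]) (a : ℕ → F[X]), (∀ i, (a i).degree < P.degree) ∧
    aM (C P) / aM P ^ (2 * e P) = (aM b / aM P ^ e P) ^ 2 + aM b / aM P ^ e P +
      ∑ i ∈ Finset.Icc 1 (e P), aM (a i) / aM P ^ (2 * i - 1) := by
    intro P hP
    apply local_nf (hS P hP).1 (hS P hP).2
    have h4 := hC P hP
    rwa [degree_eq_natDegree ((hS P hP).1.pow _).ne_zero, (hS P hP).1.natDegree_pow] at h4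
  choose! b a ha hba using hC'
  set v := pf S e a with hv
  set z := ∑ P ∈ S, aM (b P) / aM P ^ e P with hz
  have hBz : aM B = aM (pfN S e) ^ 2 * (v + (z ^ 2 + z)) := by
    rw [hprod, div_eq_iff (pow_ne_zero 2 hN0), hQ, map_zero, zero_add] at hQC
    rw [hQC, mul_comm]
    congr 1
    haveI : CharP (RatFunc F) 2 := charP_of_injective_algebraMap (algebraMap F (RatFunc F)).injective 2
    rw [hz, CharTwo.sum_sq, ← Finset.sum_add_distrib, hv, pf, ← Finset.sum_add_distrib]
    refine Finset.sum_congr rfl fun P hP => ?_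
    rw [map_pow, hba P hP]
    ring
  have hw : (aM (pfN S e) * z) ^ 2 + aM (pfN S e) * (aM (pfN S e) * z) = aM (B - pfB S e a) := by
    rw [map_sub, hBz, ← pf_eq hS]
    ring
  obtain ⟨w, hw1⟩ := int_rat hw
  have hBw : aM B = aM (pfN S e) ^ 2 * v + aM (w ^ 2 + pfN S e * w) := by
    simp only [map_add, map_mul, map_pow]
    rw [hw1, hBz]
    ring
  refine ⟨v, w, ⟨S, e, a, hS, he, fun P hP i _ _ => ha P hP i, ?_, rfl, rfl⟩, hBw⟩
  intro P hP h0
  have h1 := (pfB_sq (a := a) hS he hP (ha P hP _)).2 h0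
  refine hM P (hS P hP).1 (hS P hP).2 ⟨?_, w, ?_⟩
  · rw [pfN_eq hP]
    exact (dvd_pow_self P (by have := he P hP; omega)).mul_right _
  · convert h1 using 1
    apply aM_inj
    rw [map_add _ _ B, hBw, ← pf_eq hS]
    linear_combination aM (w ^ 2 + pfN S e * w) * two_eq_zero_rat (F := F)

end M8b
end EvenChar

namespace EvenChar
section M8c
open scoped Classical
set_option linter.unusedSectionVars false
set_option linter.unusedSimpArgs false
set_option linter.style.haveILetI false
variable {F : Type} [Field F] [Fintype F] [CharP F 2]
local notation "aM" => algebraMap F[X] (RatFunc F)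

/-- the Artin-Schreier map -/
def asMap : F →+ F where
  toFun x := x ^ 2 + x
  map_zero' := by simp
  map_add' x y := by rw [CharTwo.add_sq]; ring

lemma as_ker : Nat.card (asMap (F := F)).ker = 2 := by
  have : ((asMap (F := F)).ker : Set F) = ({0, 1} : Set F) := by
    ext x
    simp only [SetLike.mem_coe, AddMonoidHom.mem_ker, Set.mem_insert_iff, Set.mem_singleton_iff]
    change x ^ 2 + x = 0 ↔ _
    rw [show x ^ 2 + x = x * (x + 1) by ring, mul_eq_zero, CharTwo.add_eq_zero]
  rw [← SetLike.coe_sort_coe, this, Nat.card_coe_set_eq, Set.ncard_pair zero_ne_one]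

lemma as_cases {ξ : F} (hξ : ∀ x : F, x ^ 2 + x ≠ ξ) (d : F) :
    ∃ x α : F, (α = 0 ∨ α = ξ) ∧ d = x ^ 2 + x + α := by
  have h1 := (asMap (F := F)).ker.card_mul_index
  rw [AddSubgroup.index_ker, as_ker] at h1
  have h2 := (asMap (F := F)).range.card_mul_index
  have hpos : 0 < Nat.card (asMap (F := F)).range := Nat.card_pos
  have hi : (asMap (F := F)).range.index = 2 := by
    have : Nat.card (asMap (F := F)).range * (asMap (F := F)).range.index = Nat.card (asMap (F := F)).range * 2 := by
      rw [h2, ← h1, mul_comm]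
    exact Nat.eq_of_mul_eq_mul_left hpos this
  by_cases hd : d ∈ (asMap (F := F)).range
  · obtain ⟨x, hx⟩ := hd
    exact ⟨x, 0, Or.inl rfl, by rw [add_zero]; exact hx.symm⟩
  · have hx : ξ ∉ (asMap (F := F)).range := fun ⟨x, hx⟩ => hξ x hx
    have := (AddSubgroup.add_mem_iff_of_index_two hi (a := d) (b := ξ)).2 (by tauto)
    obtain ⟨x, hx⟩ := this
    refine ⟨x, ξ, Or.inr rfl, ?_⟩
    have : x ^ 2 + x = d + ξ := hx
    rw [this, add_assoc, CharTwo.add_self_eq_zero, add_zero]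

/-- odd part -/
def oddP (s : ℕ) (c : ℕ → F) : F[X] := ∑ i ∈ Finset.Icc 1 s, C (c i) * X ^ (2 * i - 1)

lemma oddP_succ (s : ℕ) (c : ℕ → F) : oddP (s + 1) c = oddP s c + C (c (s + 1)) * X ^ (2 * s + 1) := by
  unfold oddP
  rw [Finset.sum_Icc_succ_top (by omega)]
  congr 2

lemma oddP_congr {s : ℕ} {c d : ℕ → F} (h : ∀ i, i ≤ s → c i = d i) : oddP s c = oddP s d := by
  unfold oddP
  refine Finset.sum_congr rfl fun i hi => ?_
  rw [h i (Finset.mem_Icc.1 hi).2]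

lemma oddP_coeff_even (s : ℕ) (c : ℕ → F) (d : ℕ) : (oddP s c).coeff (2 * d) = 0 := by
  unfold oddP
  rw [finsetSum_coeff]
  refine Finset.sum_eq_zero fun i hi => ?_
  have := (Finset.mem_Icc.1 hi).1
  rw [coeff_C_mul, coeff_X_pow, if_neg (by omega), mul_zero]

lemma oddP_degree (s : ℕ) (c : ℕ → F) : (oddP s c).degree < (2 * s : ℕ) := by
  rw [← mem_degreeLT]
  refine Submodule.sum_mem _ fun i hi => ?_
  have := Finset.mem_Icc.1 hi
  rw [mem_degreeLT]
  refine (degree_C_mul_X_pow_le _ _).trans_lt ?_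
  exact_mod_cast (by omega : 2 * i - 1 < 2 * s)

lemma oddP_extend {s t : ℕ} (h : s ≤ t) (c : ℕ → F) :
    oddP s c = oddP t (fun i => if i ≤ s then c i else 0) := by
  unfold oddP
  symm
  rw [← Finset.sum_subset (Finset.Icc_subset_Icc_right h)]
  · refine Finset.sum_congr rfl fun i hi => ?_
    simp only
    rw [if_pos (Finset.mem_Icc.1 hi).2]
  · intro i hi hni
    rw [Finset.mem_Icc] at hi hni
    simp only
    rw [if_neg (by omega), C_0, zero_mul]

lemma oddP_add {s : ℕ} (c d : ℕ → F) : oddP s c + oddP s d = oddP s (fun i => c i + d i) := by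
  unfold oddP
  rw [← Finset.sum_add_distrib]
  refine Finset.sum_congr rfl fun i hi => ?_
  rw [C_add]; ring

lemma poly_nf {ξ : F} (hξ : ∀ x : F, x ^ 2 + x ≠ ξ) (s : ℕ) : ∀ Q : F[X], Q.degree < (2 * s + 1 : ℕ) →
    ∃ (w : F[X]) (α : F) (c : ℕ → F), (α = 0 ∨ α = ξ) ∧ w.degree < (s + 1 : ℕ) ∧
      Q = w ^ 2 + w + C α + oddP s c := by
  induction s with
  | zero =>
    intro Q hQ
    have hQ' : Q = C (Q.coeff 0) := by
      refine eq_C_of_degree_le_zero ?_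
      rw [degree_le_iff_coeff_zero]
      intro m hm
      refine coeff_eq_zero_of_degree_lt (hQ.trans_le ?_)
      have hm' : 0 < m := by exact_mod_cast hm
      exact_mod_cast (by omega : 2 * 0 + 1 ≤ m)
    obtain ⟨x, α, hα, hd⟩ := as_cases hξ (Q.coeff 0)
    refine ⟨C x, α, 0, hα, ?_, ?_⟩
    · refine degree_C_le.trans_lt ?_
      exact_mod_cast Nat.zero_lt_one
    · rw [hQ', hd]; simp [oddP]
  | succ s ih =>
    intro Q hQ
    obtain ⟨β, hβ⟩ : IsSquare (Q.coeff (2 * s + 2)) := FiniteField.isSquare_of_char_two (CharP.ringChar_of_prime_eq_zero Nat.prime_two (CharP.cast_eq_zero F 2)) _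
    set Q1 : F[X] := Q + ((C β * X ^ (s + 1)) ^ 2 + C β * X ^ (s + 1)) with hQ1
    set γ := Q1.coeff (2 * s + 1) with hγ
    set Q2 : F[X] := Q1 + C γ * X ^ (2 * s + 1) with hQ2
    have hd : Q2.degree < (2 * s + 1 : ℕ) := by
      rw [degree_lt_iff_coeff_zero]
      intro m hm
      have hQc : ∀ m, 2 * s + 3 ≤ m → Q.coeff m = 0 := by
        intro m hm
        exact coeff_eq_zero_of_degree_lt (hQ.trans_le (by exact_mod_cast (by omega)))
      have e1 : ∀ m, Q1.coeff m = Q.coeff m + ((if m = 2 * s + 2 then β ^ 2 else 0) + if m = s + 1 then β else 0) := by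
        intro m
        rw [hQ1, mul_pow, ← pow_mul, ← C_pow, coeff_add, coeff_add, coeff_C_mul, coeff_C_mul, coeff_X_pow, coeff_X_pow]
        simp only [mul_ite, mul_one, mul_zero, show (s + 1) * 2 = 2 * s + 2 by ring]
      rw [hQ2, coeff_add, coeff_C_mul, coeff_X_pow]
      rcases eq_or_ne m (2 * s + 1) with rfl | h1
      · rw [if_pos rfl, mul_one, ← hγ, CharTwo.add_self_eq_zero]
      · rw [if_neg h1, mul_zero, add_zero, e1]
        rcases eq_or_ne m (2 * s + 2) with rfl | h2
        · rw [if_pos rfl, if_neg (by omega), add_zero, hβ, sq, CharTwo.add_self_eq_zero]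
        · rw [if_neg h2, if_neg (by omega), hQc m (by omega)]; simp
    obtain ⟨w, α, c, hα, hw, hQQ⟩ := ih Q2 hd
    refine ⟨w + C β * X ^ (s + 1), α, fun i => if i ≤ s then c i else γ, hα, ?_, ?_⟩
    · refine (degree_add_le _ _).trans_lt (max_lt (hw.trans (by exact_mod_cast (by omega))) ?_)
      refine (degree_C_mul_X_pow_le _ _).trans_lt (by exact_mod_cast (by omega))
    · rw [oddP_succ, ← oddP_congr (c := c) (fun i hi => by rw [if_pos hi])]
      simp only [if_neg (show ¬ s + 1 ≤ s by omega)]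
      have : Q = Q2 + C γ * X ^ (2 * s + 1) + ((C β * X ^ (s + 1)) ^ 2 + C β * X ^ (s + 1)) := by
        rw [hQ2, hQ1]
        linear_combination (-(C γ * X ^ (2 * s + 1)) - ((C β * X ^ (s + 1)) ^ 2 + C β * X ^ (s + 1))) * two_eq_zero_poly (F := F)
      rw [this, hQQ, CharTwo.add_sq]
      ring

lemma Gfam_eq {ξ : F} {s : ℕ} {G : F[X]} : G ∈ Gfam ξ s ↔ ∃ (α : F) (c : ℕ → F), (α = 0 ∨ α = ξ) ∧ c s ≠ 0 ∧
    G = C α + oddP s c := Iff.rfl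

lemma poly_nf_top {ξ : F} (hξ : ∀ x : F, x ^ 2 + x ≠ ξ) {s : ℕ} {Q : F[X]} (hQ : Q.natDegree = 2 * s + 1) :
    ∃ w : F[X], w.degree < (s + 1 : ℕ) ∧ ∃ G ∈ Gfam ξ (s + 1), Q = w ^ 2 + w + G := by
  have hQ0 : Q ≠ 0 := by rintro rfl; simp at hQ
  have hd : (Q + C Q.leadingCoeff * X ^ (2 * s + 1) : F[X]).degree < ((2 * s + 1 : ℕ) : WithBot ℕ) := by
    rw [degree_lt_iff_coeff_zero]
    intro m hm
    rw [coeff_add, coeff_C_mul, coeff_X_pow]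
    rcases eq_or_ne m (2 * s + 1) with rfl | h1
    · rw [if_pos rfl, mul_one, leadingCoeff, hQ, CharTwo.add_self_eq_zero]
    · rw [if_neg h1, coeff_eq_zero_of_natDegree_lt (by omega)]; simp
  obtain ⟨w, α, c, hα, hw, h⟩ := poly_nf hξ s _ hd
  refine ⟨w, hw, C α + oddP (s + 1) (fun i => if i ≤ s then c i else Q.leadingCoeff), ?_, ?_⟩
  · refine ⟨α, _, hα, ?_, rfl⟩
    simp [hQ0]
  · rw [oddP_succ, ← oddP_congr (c := c) (fun i hi => by rw [if_pos hi])]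
    simp only [if_neg (show ¬ s + 1 ≤ s by omega)]
    linear_combination h - (C Q.leadingCoeff * X ^ (2 * s + 1)) * two_eq_zero_poly (F := F)

lemma poly_inj {ξ : F} (hξ : ∀ x : F, x ^ 2 + x ≠ ξ) {s : ℕ} {c : ℕ → F} {α : F} (hα : α = 0 ∨ α = ξ)
    {w : F[X]} (h : C α + oddP s c = w ^ 2 + w) : C α + oddP s c = 0 := by
  have hw : w.natDegree = 0 := by
    by_contra h0
    have h1 : (w ^ 2 + w).coeff (2 * w.natDegree) = w.leadingCoeff ^ 2 := by
      rw [coeff_add, coeff_pow_mul_natDegree, coeff_eq_zero_of_natDegree_lt (p := w) (by omega), add_zero]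
    rw [← h, coeff_add, oddP_coeff_even, coeff_C, if_neg (by omega), add_zero] at h1
    have : w.leadingCoeff = 0 := by
      exact pow_eq_zero_iff (two_ne_zero) |>.1 h1.symm
    rw [leadingCoeff_eq_zero] at this
    rw [this] at h0; simp at h0
  rw [natDegree_eq_zero] at hw
  obtain ⟨x, rfl⟩ := hw
  have h0 := congrArg (fun p => p.coeff 0) h
  have := oddP_coeff_even s c 0
  simp only [mul_zero] at this
  rw [show (C x ^ 2 + C x : F[X]) = C (x ^ 2 + x) by simp] at h h0
  simp only [coeff_add, this, add_zero, coeff_C, if_true] at h0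
  rcases hα with rfl | rfl
  · rw [h, ← h0]; simp
  · exact absurd h0.symm (hξ x)

lemma Gfam_inj {ξ : F} (hξ : ∀ x : F, x ^ 2 + x ≠ ξ) {s s' : ℕ} {G G' : F[X]} (hG : G ∈ Gfam ξ s) (hG' : G' ∈ Gfam ξ s')
    {w : F[X]} (h : G + G' = w ^ 2 + w) : G = G' := by
  obtain ⟨α, c, hα, -, rfl⟩ := Gfam_eq.1 hG
  obtain ⟨α', c', hα', -, rfl⟩ := Gfam_eq.1 hG'
  rw [← CharTwo.add_eq_zero]
  rw [oddP_extend (le_max_left s s'), oddP_extend (le_max_right s s') c'] at h ⊢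
  rw [add_add_add_comm, ← C_add, oddP_add] at h ⊢
  refine poly_inj hξ ?_ h
  rcases hα with rfl | rfl <;> rcases hα' with rfl | rfl <;> simp [CharTwo.add_self_eq_zero]

lemma Gfam_natDegree {ξ : F} {s : ℕ} {G : F[X]} (hG : G ∈ Gfam ξ (s + 1)) : G.natDegree = 2 * s + 1 := by
  obtain ⟨α, c, hα, hc, rfl⟩ := Gfam_eq.1 hG
  rw [oddP_succ, ← add_assoc, natDegree_add_eq_right_of_degree_lt, natDegree_C_mul_X_pow _ _ hc]
  rw [degree_C_mul_X_pow _ hc]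
  refine (degree_add_le _ _).trans_lt (max_lt ?_ ?_)
  · refine degree_C_le.trans_lt ?_
    exact_mod_cast (by omega : 0 < 2 * s + 1)
  · exact (oddP_degree s c).trans (by exact_mod_cast (by omega))

end M8c
end EvenChar

namespace EvenChar
section M8d
open scoped Classical
set_option linter.unusedSectionVars false
set_option linter.unusedSimpArgs false
set_option linter.style.haveILetI false
variable {F : Type} [Field F] [Fintype F] [CharP F 2]
local notation "aM" => algebraMap F[X] (RatFunc F)

/-- `u` has denominator level `N` -/
def Lev (N : F[X]) (u : RatFunc F) : Prop := ∃ v G, Dat N v ∧ u = v + aM G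

lemma sh_eq {v v' z : RatFunc F} {G : F[X]} (h : Sh v) (h' : Sh v') (hz : v + v' + aM G = z ^ 2 + z) : v = v' := by
  have := sh_inj (h.add h') hz
  linear_combination this - v' * two_eq_zero_rat (F := F)

lemma Lev.unique {N N' : F[X]} {u : RatFunc F} (h : Lev N u) (h' : Lev N' u) : N = N' := by
  obtain ⟨v, G, hv, rfl⟩ := h
  obtain ⟨v', G', hv', he⟩ := h'
  have : v = v' := by
    refine sh_eq (z := 0) (G := G + G') hv.sh hv'.sh ?_
    rw [map_add]
    linear_combination he + (v' + aM G') * two_eq_zero_rat (F := F)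
  subst this
  exact hv.unique hv'

lemma deg_w {N w : F[X]} {m : ℕ} (hN : N.natDegree ≤ m) (h : (w ^ 2 + N * w).degree < (2 * m + 2 : ℕ)) :
    w.degree < (m + 1 : ℕ) := by
  by_contra hc
  rw [not_lt] at hc
  have hw0 : w ≠ 0 := by rintro rfl; simp at hc
  rw [degree_eq_natDegree hw0] at hc
  have hc' : m + 1 ≤ w.natDegree := by exact_mod_cast hc
  have hd : (N * w).degree < (w ^ 2).degree := by
    rw [degree_pow, degree_eq_natDegree hw0, nsmul_eq_mul]
    refine degree_le_natDegree.trans_lt ?_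
    have := natDegree_mul_le (p := N) (q := w)
    have h2 : (N * w).natDegree < 2 * w.natDegree := by omega
    exact_mod_cast h2
  rw [add_comm, degree_add_eq_right_of_degree_lt hd, degree_pow, degree_eq_natDegree hw0, nsmul_eq_mul] at h
  have : 2 * w.natDegree < 2 * m + 2 := by exact_mod_cast h
  omega

/-- condition for family `I` -/
def PrI (g : ℕ) (N B : F[X]) : Prop := N.Monic ∧ N.natDegree < g + 1 ∧ B.natDegree = 2 * g + 1 ∧ MX N B

/-- condition for family `F'` -/
def PrF (ξ : F) (n : ℕ) (N B : F[X]) : Prop :=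
  N.Monic ∧ N.natDegree = n ∧ (B.natDegree = 2 * n ∧ B.leadingCoeff = ξ) ∧ MX N B

lemma mem_Ifam {ξ : F} {g : ℕ} {u : RatFunc F} : u ∈ Ifam ξ (g + 1) ↔ ∃ N v s G, Dat N v ∧ N.natDegree + s = g ∧
    G ∈ Gfam ξ (s + 1) ∧ u = v + aM G := by
  unfold Ifam Irs
  simp only [Set.mem_iUnion, Set.mem_ofPred_eq, exists_prop]
  constructor
  · rintro ⟨r, s, hs, hrs, v, hv, G, hG, rfl⟩
    obtain ⟨N, hN, hr⟩ := mem_Ffam_iff.1 hv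
    obtain ⟨s, rfl⟩ : ∃ t, s = t + 1 := ⟨s - 1, by omega⟩
    exact ⟨N, v, s, G, hN, by omega, hG, rfl⟩
  · rintro ⟨N, v, s, G, hN, hs, hG, rfl⟩
    exact ⟨N.natDegree, s + 1, by omega, by omega, v, mem_Ffam_iff.2 ⟨N, hN, rfl⟩, G, hG, rfl⟩

lemma mem_F'fam {ξ : F} {n : ℕ} {u : RatFunc F} : u ∈ F'fam ξ n ↔ ∃ N v, Dat N v ∧ N.natDegree = n ∧
    u = v + aM (C ξ) := by
  unfold F'fam
  rw [Set.mem_image]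
  simp only [RatFunc.algebraMap_C]
  constructor
  · rintro ⟨v, hv, rfl⟩
    obtain ⟨N, hN, hr⟩ := mem_Ffam_iff.1 hv
    exact ⟨N, v, hN, hr, rfl⟩
  · rintro ⟨N, v, hN, hr, rfl⟩
    exact ⟨v, mem_Ffam_iff.2 ⟨N, hN, hr⟩, rfl⟩

lemma fam_A {N B0 G : F[X]} {v : RatFunc F} (h1 : aM N ^ 2 * v = aM B0) :
    aM N ^ 2 * (v + aM G) = aM (B0 + N ^ 2 * G) := by
  rw [map_add, map_mul, map_pow, ← h1]; ring

lemma I_A {ξ : F} {g : ℕ} {u : RatFunc F} (hu : u ∈ Ifam ξ (g + 1)) :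
    ∃ N B, Lev N u ∧ aM N ^ 2 * u = aM B ∧ ∀ w : F[X], w.degree < (g + 1 : ℕ) → PrI g N (B + (w ^ 2 + N * w)) := by
  obtain ⟨N, v, s, G, hN, hs, hG, rfl⟩ := mem_Ifam.1 hu
  obtain ⟨B0, h1, h2, h3⟩ := hN.num
  refine ⟨N, B0 + N ^ 2 * G, ⟨v, G, hN, rfl⟩, fam_A h1, fun w hw => ?_⟩
  have hmx := (MX_of h3).add w G
  have hNm := hN.monic
  have hGd := Gfam_natDegree hG
  have hd : (N ^ 2 * G).natDegree = 2 * g + 1 := by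
    rw [(hNm.pow 2).natDegree_mul' (by rintro rfl; simp at hGd), hNm.natDegree_pow, hGd]; omega
  have hd' : (N ^ 2 * G).degree = (2 * g + 1 : ℕ) := by
    rw [degree_eq_natDegree (by intro h; rw [h] at hd; simp at hd), hd]
  refine ⟨hNm, by omega, ?_, ?_⟩
  · rw [show B0 + N ^ 2 * G + (w ^ 2 + N * w) = (B0 + (w ^ 2 + N * w)) + N ^ 2 * G by ring,
      natDegree_add_eq_right_of_degree_lt, hd]
    rw [hd', ← mem_degreeLT]
    refine Submodule.add_mem _ ?_ (Submodule.add_mem _ ?_ ?_) <;> rw [mem_degreeLT]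
    · refine h2.trans_le (by exact_mod_cast (by omega))
    · rw [degree_pow]
      rcases eq_or_ne w 0 with rfl | hw0
      · simp only [degree_zero, nsmul_eq_mul]; exact WithBot.bot_lt_coe _
      · rw [degree_eq_natDegree hw0] at hw ⊢
        rw [nsmul_eq_mul]
        have : w.natDegree < g + 1 := by exact_mod_cast hw
        exact_mod_cast (by omega : 2 * w.natDegree < 2 * g + 1)
    · rcases eq_or_ne w 0 with rfl | hw0
      · simp only [mul_zero, degree_zero]; exact WithBot.bot_lt_coe _
      · rw [degree_mul, degree_eq_natDegree hw0, degree_eq_natDegree hNm.ne_zero]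
        rw [degree_eq_natDegree hw0] at hw
        have : w.natDegree < g + 1 := by exact_mod_cast hw
        exact_mod_cast (by omega : N.natDegree + w.natDegree < 2 * g + 1)
  · convert hmx using 1; ring

lemma F_A {ξ : F} (h0 : ξ ≠ 0) {n : ℕ} {u : RatFunc F} (hu : u ∈ F'fam ξ n) :
    ∃ N B, Lev N u ∧ aM N ^ 2 * u = aM B ∧ ∀ w : F[X], w.degree < (n : ℕ) → PrF ξ n N (B + (w ^ 2 + N * w)) := by
  obtain ⟨N, v, hN, hs, rfl⟩ := mem_F'fam.1 hu
  obtain ⟨B0, h1, h2, h3⟩ := hN.num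
  refine ⟨N, B0 + N ^ 2 * C ξ, ⟨v, _, hN, rfl⟩, fam_A h1, fun w hw => ?_⟩
  have hmx := (MX_of h3).add w (C ξ)
  have hNm := hN.monic
  have hd : (N ^ 2 * C ξ).natDegree = 2 * n := by
    rw [natDegree_mul_C h0, hNm.natDegree_pow, hs]
  have hd' : (N ^ 2 * C ξ).degree = (2 * n : ℕ) := by
    rw [degree_eq_natDegree (mul_ne_zero (pow_ne_zero _ hNm.ne_zero) (by simpa using h0)), hd]
  have hlt : (B0 + (w ^ 2 + N * w)).degree < (N ^ 2 * C ξ).degree := by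
    rw [hd', ← mem_degreeLT]
    refine Submodule.add_mem _ ?_ (Submodule.add_mem _ ?_ ?_) <;> rw [mem_degreeLT]
    · rw [← hs]; exact h2
    · rw [degree_pow]
      rcases eq_or_ne w 0 with rfl | hw0
      · simp only [degree_zero, nsmul_eq_mul]; exact WithBot.bot_lt_coe _
      · rw [degree_eq_natDegree hw0] at hw ⊢
        rw [nsmul_eq_mul]
        have : w.natDegree < n := by exact_mod_cast hw
        exact_mod_cast (by omega : 2 * w.natDegree < 2 * n)
    · rcases eq_or_ne w 0 with rfl | hw0
      · simp only [mul_zero, degree_zero]; exact WithBot.bot_lt_coe _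
      · rw [degree_mul, degree_eq_natDegree hw0, degree_eq_natDegree hNm.ne_zero]
        rw [degree_eq_natDegree hw0] at hw
        have : w.natDegree < n := by exact_mod_cast hw
        exact_mod_cast (by omega : N.natDegree + w.natDegree < 2 * n)
  refine ⟨hNm, hs, ⟨?_, ?_⟩, ?_⟩
  · rw [show B0 + N ^ 2 * C ξ + (w ^ 2 + N * w) = (B0 + (w ^ 2 + N * w)) + N ^ 2 * C ξ by ring,
      natDegree_add_eq_right_of_degree_lt hlt, hd]
  · rw [show B0 + N ^ 2 * C ξ + (w ^ 2 + N * w) = (B0 + (w ^ 2 + N * w)) + N ^ 2 * C ξ by ring,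
      leadingCoeff_add_of_degree_lt hlt, leadingCoeff_mul, leadingCoeff_C, (hNm.pow 2).leadingCoeff, one_mul]
  · convert hmx using 1; ring

lemma surj1 {N R : F[X]} (hN : N.Monic) (hB : R.degree < (2 * N.natDegree : ℕ)) (hM : MX N R) :
    ∃ v w, Dat N v ∧ aM R = aM N ^ 2 * v + aM (w ^ 2 + N * w) ∧ (w ^ 2 + N * w).degree < (2 * N.natDegree : ℕ) := by
  obtain ⟨v, w, hv, h⟩ := surj0 hN hB hM
  refine ⟨v, w, hv, h, ?_⟩
  obtain ⟨B0, h1, h2, h3⟩ := hv.num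
  rw [h1, ← map_add] at h
  have h := aM_inj h
  have : w ^ 2 + N * w = R + B0 := by rw [h]; linear_combination (-B0) * two_eq_zero_poly (F := F)
  rw [this]
  exact (degree_add_le _ _).trans_lt (max_lt hB h2)

lemma I_B {ξ : F} (hξ : ∀ x : F, x ^ 2 + x ≠ ξ) {g : ℕ} {N B : F[X]} (h : PrI g N B) :
    ∃ u ∈ Ifam ξ (g + 1), ∃ w : F[X], w.degree < (g + 1 : ℕ) ∧ Lev N u ∧ aM B = aM N ^ 2 * u + aM (w ^ 2 + N * w) := by
  obtain ⟨hN, hr, hBd, hM⟩ := h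
  have hN2 := hN.pow 2
  set Q := B /ₘ N ^ 2 with hQ
  set R := B %ₘ N ^ 2 with hR
  have hBQ : R + N ^ 2 * Q = B := modByMonic_add_div B (N ^ 2)
  have hRd : R.degree < (2 * N.natDegree : ℕ) := by
    refine (degree_modByMonic_lt B hN2).trans_le ?_
    rw [degree_eq_natDegree hN2.ne_zero, hN.natDegree_pow]
  have hRM : MX N R := by
    have := hM.mod Q
    rwa [← hBQ, add_assoc, ← two_mul, two_eq_zero_poly, zero_mul, add_zero] at this
  obtain ⟨v, w0, hv, h1, h2⟩ := surj1 hN hRd hRM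
  have hQd : Q.natDegree = 2 * (g - N.natDegree) + 1 := by
    rw [hQ, natDegree_divByMonic B hN2, hN.natDegree_pow, hBd]; omega
  obtain ⟨w1, hw1, G, hG, hQG⟩ := poly_nf_top hξ hQd
  refine ⟨v + aM G, mem_Ifam.2 ⟨N, v, _, G, hv, by omega, hG, rfl⟩, w0 + N * w1, ?_, ⟨v, G, hv, rfl⟩, ?_⟩
  · have hw0 := deg_w le_rfl (h2.trans (by exact_mod_cast (by omega)))
    refine (degree_add_le _ _).trans_lt (max_lt (hw0.trans_le (by exact_mod_cast (by omega))) ?_)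
    rcases eq_or_ne w1 0 with rfl | hw10
    · simp only [mul_zero, degree_zero]; exact WithBot.bot_lt_coe _
    · rw [degree_mul, degree_eq_natDegree hw10, degree_eq_natDegree hN.ne_zero]
      rw [degree_eq_natDegree hw10] at hw1
      have : w1.natDegree < g - N.natDegree + 1 := by exact_mod_cast hw1
      exact_mod_cast (by omega : N.natDegree + w1.natDegree < g + 1)
  · rw [← hBQ, hQG, map_add, h1]
    simp only [map_add, map_mul, map_pow]
    linear_combination (-(aM w0 * aM N * aM w1)) * two_eq_zero_rat (F := F)

lemma F_B {ξ : F} (h0 : ξ ≠ 0) {n : ℕ} {N B : F[X]} (h : PrF ξ n N B) :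
    ∃ u ∈ F'fam ξ n, ∃ w : F[X], w.degree < (n : ℕ) ∧ Lev N u ∧ aM B = aM N ^ 2 * u + aM (w ^ 2 + N * w) := by
  obtain ⟨hN, hr, ⟨hBd, hBl⟩, hM⟩ := h
  have hRd : (B + N ^ 2 * C ξ).degree < (2 * N.natDegree : ℕ) := by
    have hB0 : B ≠ 0 := by rintro rfl; simp at hBl; exact h0 hBl.symm
    have hNx : (N ^ 2 * C ξ) ≠ 0 := mul_ne_zero (pow_ne_zero _ hN.ne_zero) (by simpa using h0)
    have := degree_sub_lt_left (p := B) (q := N ^ 2 * C ξ) ?_ hB0 ?_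
    · rwa [CharTwo.sub_eq_add, degree_eq_natDegree hB0, hBd, ← hr] at this
    · rw [degree_eq_natDegree hB0, hBd, degree_eq_natDegree hNx, natDegree_mul_C h0, hN.natDegree_pow, hr]
    · rw [hBl, leadingCoeff_mul, leadingCoeff_C, (hN.pow 2).leadingCoeff, one_mul]
  obtain ⟨v, w0, hv, h1, h2⟩ := surj1 hN hRd (hM.mod _)
  have hw0 := deg_w le_rfl (h2.trans (by exact_mod_cast (by omega)))
  obtain ⟨w, hw, he⟩ : ∃ w : F[X], w.degree < (n : ℕ) ∧ w ^ 2 + N * w = w0 ^ 2 + N * w0 := by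
    have hc : (w0 ^ 2 + N * w0).coeff (n + n) = w0.coeff n ^ 2 + w0.coeff n := by
      have hle : w0.natDegree ≤ n := by
        refine natDegree_le_of_degree_le ?_
        rw [hr] at hw0
        rw [degree_le_iff_coeff_zero]
        intro m hm
        have hm' : n < m := by exact_mod_cast hm
        exact coeff_eq_zero_of_degree_lt (hw0.trans_le (by exact_mod_cast hm'))
      rw [coeff_add, sq w0, coeff_mul_add_eq_of_natDegree_le hle hle, coeff_mul_add_eq_of_natDegree_le hr.le hle]
      have : N.coeff n = 1 := by rw [← hr]; exact hN
      rw [this]; ring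
    rw [coeff_eq_zero_of_degree_lt (h2.trans_le (by exact_mod_cast (by omega)))] at hc
    have hc' : w0.coeff n * (w0.coeff n + 1) = 0 := by rw [hc]; ring
    rcases mul_eq_zero.1 hc' with hc | hc
    · refine ⟨w0, ?_, rfl⟩
      rw [degree_lt_iff_coeff_zero]
      intro m hm
      rcases eq_or_lt_of_le hm with rfl | hm
      · exact hc
      · exact coeff_eq_zero_of_degree_lt (hw0.trans_le (by exact_mod_cast (by omega)))
    · refine ⟨w0 + N, ?_, ?_⟩
      · rw [degree_lt_iff_coeff_zero]
        intro m hm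
        rw [coeff_add]
        rcases eq_or_lt_of_le hm with rfl | hm
        · rw [show N.coeff n = 1 by rw [← hr]; exact hN, hc]
        · rw [coeff_eq_zero_of_degree_lt (hw0.trans_le (by exact_mod_cast (by omega))),
            coeff_eq_zero_of_natDegree_lt (by omega), add_zero]
      · linear_combination (N * w0 + N ^ 2) * two_eq_zero_poly (F := F)
  refine ⟨v + aM (C ξ), mem_F'fam.2 ⟨N, v, hv, hr, rfl⟩, w, hw, ⟨v, _, hv, rfl⟩, ?_⟩
  rw [he]
  have : aM B = aM (B + N ^ 2 * C ξ) + aM (N ^ 2 * C ξ) := by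
    rw [← map_add]; congr 1; linear_combination (-N ^ 2 * C ξ) * two_eq_zero_poly (F := F)
  rw [this, h1, map_mul, map_pow]; ring

lemma I_C {ξ : F} (hξ : ∀ x : F, x ^ 2 + x ≠ ξ) {n : ℕ} {u u' z : RatFunc F} (hu : u ∈ Ifam ξ (n + 1))
    (hu' : u' ∈ Ifam ξ (n + 1)) (h : u + u' = z ^ 2 + z) : u = u' := by
  obtain ⟨N, v, s, G, hN, hs, hG, rfl⟩ := mem_Ifam.1 hu
  obtain ⟨N', v', s', G', hN', hs', hG', rfl⟩ := mem_Ifam.1 hu'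
  have hv : v = v' := by
    refine sh_eq (z := z) (G := G + G') hN.sh hN'.sh ?_
    rw [map_add, ← h]; ring
  subst hv
  have h2 : z ^ 2 + aM 1 * z = aM (G + G') := by
    rw [map_one, one_mul, ← h, map_add]; linear_combination v * two_eq_zero_rat (F := F)
  obtain ⟨w, rfl⟩ := int_rat h2
  rw [← map_mul, ← map_pow, ← map_add] at h2
  have h3 := aM_inj h2
  rw [Gfam_inj hξ hG hG' (w := w) (by rw [← h3, one_mul])]

lemma F_C {ξ : F} {n : ℕ} {u u' z : RatFunc F} (hu : u ∈ F'fam ξ n)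
    (hu' : u' ∈ F'fam ξ n) (h : u + u' = z ^ 2 + z) : u = u' := by
  obtain ⟨N, v, hN, hs, rfl⟩ := mem_F'fam.1 hu
  obtain ⟨N', v', hN', hs', rfl⟩ := mem_F'fam.1 hu'
  have hv : v = v' := by
    refine sh_eq (z := z) (G := 0) hN.sh hN'.sh ?_
    rw [map_zero, ← h]; linear_combination (- aM (C ξ)) * two_eq_zero_rat (F := F)
  rw [hv]

end M8d
end EvenChar

namespace EvenChar
section M8e
open scoped Classical
set_option linter.unusedSectionVars false
set_option linter.unusedSimpArgs false
set_option linter.style.haveILetI false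
variable {F : Type} [Field F] [Fintype F] [CharP F 2]
local notation "aM" => algebraMap F[X] (RatFunc F)

lemma HD_aux {N B : F[X]} (hB : B ≠ 0)
    (h : ∀ a b : F[X], a ≠ 0 → b ≠ 0 → 
      ((2 * a.natDegree < 2 * b.natDegree + B.natDegree ∧ N.natDegree + a.natDegree < b.natDegree + B.natDegree) ∨
       (2 * b.natDegree + B.natDegree < 2 * a.natDegree ∧ N.natDegree + b.natDegree < a.natDegree)) ∨
      (2 * a.natDegree = 2 * b.natDegree + B.natDegree ∧ N.natDegree + b.natDegree = a.natDegree ∧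
        a.leadingCoeff ^ 2 + N.leadingCoeff * a.leadingCoeff * b.leadingCoeff + b.leadingCoeff ^ 2 * B.leadingCoeff ≠ 0)) :
    HD N B := by
  intro a b
  rcases eq_or_ne a 0 with rfl | ha
  · simp
  rcases eq_or_ne b 0 with rfl | hb
  · simp
  have e1 : (a ^ 2).degree = (2 * a.natDegree : ℕ) := by
    rw [degree_eq_natDegree (pow_ne_zero _ ha), natDegree_pow]
  have e2 : (b ^ 2 * B).degree = (2 * b.natDegree + B.natDegree : ℕ) := by
    rw [degree_eq_natDegree (mul_ne_zero (pow_ne_zero _ hb) hB), natDegree_mul (pow_ne_zero _ hb) hB, natDegree_pow]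
  have e3 : (N * a * b).natDegree ≤ N.natDegree + a.natDegree + b.natDegree :=
    natDegree_mul_le.trans (Nat.add_le_add_right natDegree_mul_le _)
  rcases h a b ha hb with (⟨h1, h2⟩ | ⟨h1, h2⟩) | ⟨h1, h2, h3⟩
  · have l1 : (a ^ 2 + N * a * b).degree < (b ^ 2 * B).degree := by
      refine (degree_add_le _ _).trans_lt (max_lt ?_ (degree_le_natDegree.trans_lt ?_))
      · rw [e1, e2]; exact_mod_cast h1
      · rw [e2]; exact_mod_cast (by omega)
    rw [degree_add_eq_right_of_degree_lt l1, max_eq_right]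
    rw [e1, e2]; exact_mod_cast h1.le
  · have l1 : (N * a * b + b ^ 2 * B).degree < (a ^ 2).degree := by
      refine (degree_add_le _ _).trans_lt (max_lt (degree_le_natDegree.trans_lt ?_) ?_)
      · rw [e1]; exact_mod_cast (by omega)
      · rw [e1, e2]; exact_mod_cast h1
    rw [add_assoc, degree_add_eq_left_of_degree_lt l1, max_eq_left]
    rw [e1, e2]; exact_mod_cast h1.le
  · rw [e1, e2, ← h1, max_self]
    have hc : (a ^ 2 + N * a * b + b ^ 2 * B).coeff (2 * a.natDegree) = 
        a.leadingCoeff ^ 2 + N.leadingCoeff * a.leadingCoeff * b.leadingCoeff + b.leadingCoeff ^ 2 * B.leadingCoeff := by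
      rw [coeff_add, coeff_add, coeff_pow_mul_natDegree]
      congr 1
      · congr 1
        rw [show 2 * a.natDegree = N.natDegree + a.natDegree + b.natDegree by omega,
          coeff_mul_add_eq_of_natDegree_le natDegree_mul_le le_rfl, coeff_mul_degree_add_degree]
        rfl
      · rw [h1, coeff_mul_add_eq_of_natDegree_le (natDegree_pow_le) le_rfl, coeff_pow_mul_natDegree]
        rfl
    refine le_antisymm ?_ (le_degree_of_ne_zero (by rw [hc]; exact h3))
    refine (degree_add_le _ _).trans (max_le ((degree_add_le _ _).trans (max_le e1.le ?_)) ?_)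
    · refine degree_le_natDegree.trans ?_
      exact_mod_cast (by omega)
    · rw [e2, h1]

lemma PrI.hd {g : ℕ} {N B : F[X]} (h : PrI g N B) : HD N B := by
  obtain ⟨-, h1, h2, -⟩ := h
  refine HD_aux (by rintro rfl; simp at h2) fun a b ha hb => Or.inl ?_
  omega

lemma PrF.hd {ξ : F} (hξ : ∀ x : F, x ^ 2 + x ≠ ξ) {n : ℕ} {N B : F[X]} (h : PrF ξ n N B) : HD N B := by
  obtain ⟨hN, h1, ⟨h2, h3⟩, -⟩ := h
  have h0 : ξ ≠ 0 := by intro h; exact hξ 0 (by rw [h]; simp)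
  refine HD_aux (by rintro rfl; simp at h3; exact h0 h3.symm) fun a b ha hb => ?_
  rcases lt_trichotomy a.natDegree (b.natDegree + n) with h | h | h
  · left; left; omega
  · right
    refine ⟨by omega, by omega, fun he => ?_⟩
    have hb' : b.leadingCoeff ≠ 0 := by simpa using hb
    refine hξ (a.leadingCoeff / b.leadingCoeff) ?_
    rw [hN.leadingCoeff, h3] at he
    field_simp
    linear_combination he - ξ * b.leadingCoeff ^ 2 * CharTwo.two_eq_zero (R := F)
  · left; right; omega

lemma PrF.pos {ξ : F} {n : ℕ} {N B : F[X]} (h : PrF ξ (n + 1) N B) : 0 < B.natDegree := by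
  rw [h.2.2.1.1]; omega

lemma PrI.pos {n : ℕ} {N B : F[X]} (h : PrI n N B) : 0 < B.natDegree := by
  rw [h.2.2.1]; omega

/-- change of generator -/
def ooEquiv (N B w : F[X]) : OO N B ≃+* OO N (B + (w ^ 2 + N * w)) where
  toFun z := ⟨z.re + w * z.im, z.im⟩
  invFun z := ⟨z.re + w * z.im, z.im⟩
  left_inv z := by
    refine QuadraticAlgebra.ext ?_ rfl
    change z.re + w * z.im + w * z.im = z.re
    linear_combination w * z.im * two_eq_zero_poly (F := F)
  right_inv z := by
    refine QuadraticAlgebra.ext ?_ rfl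
    change z.re + w * z.im + w * z.im = z.re
    linear_combination w * z.im * two_eq_zero_poly (F := F)
  map_mul' z z' := by
    refine QuadraticAlgebra.ext ?_ ?_
    · simp only [QuadraticAlgebra.re_mul, QuadraticAlgebra.im_mul]
      linear_combination (-w ^ 2 * z.im * z'.im) * two_eq_zero_poly (F := F)
    · simp only [QuadraticAlgebra.re_mul, QuadraticAlgebra.im_mul]
      linear_combination (-w * z.im * z'.im) * two_eq_zero_poly (F := F)
  map_add' z z' := by
    refine QuadraticAlgebra.ext ?_ ?_
    · simp only [QuadraticAlgebra.re_add, QuadraticAlgebra.im_add]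
      ring
    · simp only [QuadraticAlgebra.im_add]

/-- weighted number of reduced pairs -/
def HH (p : F[X] × F[X]) : ℝ :=
  haveI := Fintype.ofFinite (RP p.1 p.2)
  ∑ x : RP p.1 p.2, x.wt

lemma hsum {N B w : F[X]} {u : RatFunc F} (hN : N ≠ 0) (h : aM B = aM N ^ 2 * u + aM (w ^ 2 + N * w))
    (h1 : HD N B) (h2 : HD N (B + (w ^ 2 + N * w))) (m1 : MX N B) (hB : 0 < B.natDegree)
    (hB' : 0 < (B + (w ^ 2 + N * w)).natDegree) : (hClass u : ℝ) = HH (N, B) := by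
  set B' := B + (w ^ 2 + N * w) with hB'd
  have hu : aM N ^ 2 * u = aM B' := by
    rw [hB'd, map_add, h]; linear_combination (- aM (w ^ 2 + N * w)) * two_eq_zero_rat (F := F)
  have m2 : MX N B' := by
    have := m1.add w 0
    rwa [mul_zero, add_zero] at this
  have hB0 : B ≠ 0 := by rintro rfl; simp at hB
  have hB0' : B' ≠ 0 := by intro h; rw [h] at hB'; simp at hB'
  obtain ⟨i1, e1⟩ := hClass_eq hN hu h2 hB0' m2
  have hu2 : aM N ^ 2 * (aM B / aM N ^ 2) = aM B := by
    rw [mul_div_cancel₀ _ (pow_ne_zero _ (aM_ne hN))]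
  obtain ⟨i2, e2⟩ := hClass_eq hN hu2 h1 hB0 m1
  letI := Fintype.ofFinite (RP N B)
  have hcc := card_class h1 hB
  rw [e1, HH]
  rw [← Nat.card_congr (ClassGroup.mulEquiv (ooEquiv N B w)).toEquiv]
  rw [hcc]

end M8e
end EvenChar

namespace EvenChar
section M8f
open scoped Classical
set_option linter.unusedSectionVars false
set_option linter.unusedSimpArgs false
set_option linter.style.haveILetI false
variable {F : Type} [Field F] [Fintype F] [CharP F 2]
local notation "aM" => algebraMap F[X] (RatFunc F)

lemma fiber_count {U : Set (RatFunc F)} {Pr : F[X] → F[X] → Prop} {n c : ℕ} 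
    (hA : ∀ u ∈ U, ∃ N B, Lev N u ∧ aM N ^ 2 * u = aM B ∧ ∀ w : F[X], w.degree < (n : ℕ) → Pr N (B + (w ^ 2 + N * w)))
    (hB : ∀ N B, Pr N B → ∃ u ∈ U, ∃ w : F[X], w.degree < (n : ℕ) ∧ Lev N u ∧ aM B = aM N ^ 2 * u + aM (w ^ 2 + N * w))
    (hC : ∀ u ∈ U, ∀ u' ∈ U, ∀ z, u + u' = z ^ 2 + z → u = u')
    (hD : ∀ N B, Pr N B → N.Monic ∧ ((N.natDegree < n ∧ c = 2) ∨ (N.natDegree = n ∧ c = 1)))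
    (Pairs : Finset (F[X] × F[X])) (hP : ∀ p, p ∈ Pairs ↔ Pr p.1 p.2) :
    ∃ hU : U.Finite, ∀ (h : RatFunc F → ℝ) (H : F[X] × F[X] → ℝ),
      (∀ u ∈ U, ∀ N B w, Pr N B → Pr N (B + (w ^ 2 + N * w)) → aM B = aM N ^ 2 * u + aM (w ^ 2 + N * w) → h u = H (N, B)) →
      (Fintype.card F : ℝ) ^ n * ∑ u ∈ hU.toFinset, h u = c * ∑ p ∈ Pairs, H p := by
  choose! Nu Bu hL hE hPr using hA
  have hz : (0 : F[X]).degree < (n : ℕ) := by rw [degree_zero]; exact WithBot.bot_lt_coe _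
  have hPr0 : ∀ u ∈ U, Pr (Nu u) (Bu u) := fun u hu => by
    have := hPr u hu 0 hz
    simpa using this
  have hU : U.Finite := by
    refine Set.Finite.of_injOn (f := fun u => (Nu u, Bu u)) (t := (Pairs : Set (F[X] × F[X]))) ?_ ?_ Pairs.finite_toSet
    · intro u hu
      exact (hP _).2 (hPr0 u hu)
    · intro u hu u' hu' he
      simp only [Prod.mk.injEq] at he
      have hN := (hD _ _ (hPr0 u hu)).1
      have e1 := hE u hu
      have e2 := hE u' hu'
      rw [← he.1, ← he.2, ← e1] at e2
      exact (mul_left_cancel₀ (pow_ne_zero 2 (aM_ne hN.ne_zero)) e2).symm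
  refine ⟨hU, fun h H hH => ?_⟩
  set Φ : RatFunc F × F[X] → F[X] × F[X] := fun x => (Nu x.1, Bu x.1 + (x.2 ^ 2 + Nu x.1 * x.2)) with hΦ
  have step1 : ∑ x ∈ hU.toFinset ×ˢ polyLT F n, H (Φ x) = (Fintype.card F : ℝ) ^ n * ∑ u ∈ hU.toFinset, h u := by
    rw [Finset.sum_product, Finset.mul_sum]
    refine Finset.sum_congr rfl fun u hu => ?_
    rw [Set.Finite.mem_toFinset] at hu
    have : ∀ w ∈ polyLT F n, H (Φ (u, w)) = h u := by
      intro w hw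
      rw [mem_polyLT] at hw
      symm
      refine hH u hu (Nu u) _ w (hPr u hu w hw) ?_ ?_
      · have := hPr0 u hu
        convert this using 1
        linear_combination (w ^ 2 + Nu u * w) * two_eq_zero_poly (F := F)
      · rw [map_add, hE u hu]
    rw [Finset.sum_congr rfl this, Finset.sum_const, card_polyLT, nsmul_eq_mul]
    push_cast; rfl
  rw [← step1]
  have hmaps : ∀ x ∈ hU.toFinset ×ˢ polyLT F n, Φ x ∈ Pairs := by
    rintro ⟨u, w⟩ hx
    rw [Finset.mem_product, Set.Finite.mem_toFinset, mem_polyLT] at hx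
    exact (hP _).2 (hPr u hx.1 w hx.2)
  rw [← Finset.sum_fiberwise_of_maps_to hmaps, Finset.mul_sum]
  refine Finset.sum_congr rfl fun p hp => ?_
  rw [Finset.sum_congr rfl (g := fun _ => H p) (fun x hx => by rw [(Finset.mem_filter.1 hx).2]),
    Finset.sum_const, nsmul_eq_mul]
  congr 2
  obtain ⟨N, B⟩ := p
  have hpr := (hP _).1 hp
  obtain ⟨u0, hu0, w0, hw0, hlev, he⟩ := hB _ _ hpr
  have hNu : Nu u0 = N := (hL u0 hu0).unique hlev
  obtain ⟨hNm, hcase⟩ := hD _ _ hpr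
  simp only at hNm hcase hw0 he hlev hNu
  have hBu : B = Bu u0 + (w0 ^ 2 + N * w0) := by
    apply aM_inj
    rw [he, map_add (aM) (Bu u0), ← hE u0 hu0, hNu]
  have hfib : ∀ u w, ((u, w) ∈ (hU.toFinset ×ˢ polyLT F n).filter (fun x => Φ x = (N, B))) ↔
      u = u0 ∧ w.degree < (n : ℕ) ∧ (w = w0 ∨ w = w0 + N) := by
    intro u w
    rw [Finset.mem_filter, Finset.mem_product, Set.Finite.mem_toFinset, mem_polyLT]
    simp only [hΦ, Prod.mk.injEq]
    constructor
    · rintro ⟨⟨hu, hw⟩, h1, h2⟩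
      have hN0 := aM_ne hNm.ne_zero
      have huu : u = u0 := by
        refine hC u hu u0 hu0 (aM (w + w0) / aM N) ?_
        have h3 := hE u hu
        rw [h1] at h3
        have h4 := he
        rw [← h2, h1, map_add, ← h3] at h4
        field_simp
        simp only [map_add, map_mul, map_pow] at h4 ⊢
        linear_combination h4 + (aM N ^ 2 * u0 - aM w ^ 2 - aM N * aM w - aM w * aM w0) * two_eq_zero_rat (F := F)
      refine ⟨huu, hw, ?_⟩
      subst huu
      rw [hBu, h1] at h2
      have h5 := add_left_cancel h2
      have : (w + w0) * (w + w0 + N) = 0 := by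
        linear_combination h5 + (w0 ^ 2 + w * w0 + N * w0) * two_eq_zero_poly (F := F)
      rcases mul_eq_zero.1 this with h6 | h6
      · left; linear_combination h6 - w0 * two_eq_zero_poly (F := F)
      · right; linear_combination h6 - (w0 + N) * two_eq_zero_poly (F := F)
    · rintro ⟨rfl, hw, h1⟩
      refine ⟨⟨hu0, hw⟩, hNu, ?_⟩
      rw [hBu, hNu]
      rcases h1 with rfl | rfl
      · rfl
      · linear_combination (N * w0 + N ^ 2) * two_eq_zero_poly (F := F)
  rcases hcase with ⟨hlt, rfl⟩ | ⟨heq, rfl⟩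
  · have : (hU.toFinset ×ˢ polyLT F n).filter (fun x => Φ x = (N, B)) = {(u0, w0), (u0, w0 + N)} := by
      ext ⟨u, w⟩
      rw [hfib, Finset.mem_insert, Finset.mem_singleton, Prod.mk.injEq, Prod.mk.injEq]
      constructor
      · rintro ⟨h1, -, h2 | h2⟩
        · exact Or.inl ⟨h1, h2⟩
        · exact Or.inr ⟨h1, h2⟩
      · rintro (⟨h1, h2⟩ | ⟨h1, h2⟩)
        · exact ⟨h1, h2 ▸ hw0, Or.inl h2⟩
        · refine ⟨h1, ?_, Or.inr h2⟩
          rw [h2]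
          refine (degree_add_le _ _).trans_lt (max_lt hw0 ?_)
          rw [degree_eq_natDegree hNm.ne_zero]; exact_mod_cast hlt
    rw [this, Finset.card_pair]
    intro h
    rw [Prod.mk.injEq] at h
    exact hNm.ne_zero (by linear_combination -h.2)
  · have : (hU.toFinset ×ˢ polyLT F n).filter (fun x => Φ x = (N, B)) = {(u0, w0)} := by
      ext ⟨u, w⟩
      rw [hfib, Finset.mem_singleton, Prod.mk.injEq]
      constructor
      · rintro ⟨h1, h3, h2 | h2⟩
        · exact ⟨h1, h2⟩
        · exfalso
          rw [h2, degree_add_eq_right_of_degree_lt, degree_eq_natDegree hNm.ne_zero, heq] at h3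
          · exact lt_irrefl _ h3
          · rw [degree_eq_natDegree hNm.ne_zero, heq]; exact hw0
      · rintro ⟨h1, h2⟩
        exact ⟨h1, h2 ▸ hw0, Or.inl h2⟩
    rw [this, Finset.card_singleton]

end M8f
end EvenChar

namespace EvenChar
section M8g
open scoped Classical
set_option linter.unusedVariables false
set_option linter.unusedSectionVars false
set_option linter.unusedSimpArgs false
set_option linter.style.haveILetI false
variable {F : Type} [Field F] [Fintype F] [CharP F 2]
local notation "aM" => algebraMap F[X] (RatFunc F)

lemma bx_add {l : F} {m : ℕ} {p d : F[X]} (hp : p ∈ bx l m) (hd : d.degree < (m : ℕ)) : p + d ∈ bx l m := by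
  unfold bx at *
  rw [mem_sbox] at *
  rw [show p + d - C l * X ^ m = (p - C l * X ^ m) + d by ring]
  exact (degree_add_le _ _).trans_lt (max_lt hp hd)

/-- maximal pairs with prescribed degree and leading coefficient -/
def Pset (r m : ℕ) (l : F) : Finset (F[X] × F[X]) := (bx 1 r ×ˢ bx l m).filter (fun p => MX p.1 p.2)

/-- reduced pairs of degree `k` -/
def Tk (k : ℕ) (p : F[X] × F[X]) : Finset (F[X] × F[X]) :=
  (bx 1 k ×ˢ polyLT F k).filter (fun x => x.1 ∣ x.2 ^ 2 + p.1 * x.2 + p.2)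

variable (F) in
/-- weights -/
def wtk (m k : ℕ) : ℝ := if 2 * k < m then 1 else ((Fintype.card F : ℝ) + 1)⁻¹

lemma low_deg {N ρ : F[X]} {r k m : ℕ} (hN : N.Monic) (hr : N.natDegree = r) (hρ : ρ.degree < (k : ℕ)) (h1 : 2 * k ≤ m)
    (h2 : r + k ≤ m) : (ρ ^ 2 + N * ρ).degree < (m : ℕ) := by
  rcases eq_or_ne ρ 0 with rfl | h0
  · simp only [ne_eq, OfNat.ofNat_ne_zero, not_false_eq_true, zero_pow, mul_zero, add_zero, degree_zero]
    exact WithBot.bot_lt_coe _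
  rw [degree_eq_natDegree h0] at hρ
  have hk : ρ.natDegree < k := by exact_mod_cast hρ
  refine (degree_add_le _ _).trans_lt (max_lt ?_ ?_)
  · rw [degree_eq_natDegree (pow_ne_zero _ h0), natDegree_pow]
    exact_mod_cast (by omega)
  · rw [degree_mul, degree_eq_natDegree h0, degree_eq_natDegree hN.ne_zero]
    exact_mod_cast (by omega : N.natDegree + ρ.natDegree < m)

lemma MX_iff {N B w : F[X]} : MX N (B + (w ^ 2 + N * w)) ↔ MX N B := by
  have key : ∀ B : F[X], MX N B → MX N (B + (w ^ 2 + N * w)) := fun B h => by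
    have := h.add w 0
    rwa [mul_zero, add_zero] at this
  refine ⟨fun h => ?_, key B⟩
  have := key _ h
  convert this using 1
  linear_combination (-(w ^ 2 + N * w)) * two_eq_zero_poly (F := F)

lemma sum_Tk {r k m : ℕ} {l : F} (hl : l ≠ 0) (h1 : 2 * k ≤ m) (h2 : r + k ≤ m) :
    ∑ p ∈ Pset r m l, (Tk k p).card = ((smp r k (m - k) l).filter good).card * Fintype.card F ^ k := by
  have e1 : ∑ p ∈ Pset r m l, (Tk k p).card =
      ((Pset r m l ×ˢ (bx 1 k ×ˢ polyLT F k)).filter (fun y => y.2.1 ∣ y.2.2 ^ 2 + y.1.1 * y.2.2 + y.1.2)).card := by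
    simp only [Tk, Finset.card_filter, Finset.sum_product]
  rw [e1, ← card_polyLT, ← Finset.card_product]
  refine Finset.card_nbij' (fun y => ((y.1.1, y.2.1, (y.2.2 ^ 2 + y.1.1 * y.2.2 + y.1.2) / y.2.1), y.2.2))
    (fun z => ((z.1.1, z.1.2.1 * z.1.2.2 + (z.2 ^ 2 + z.1.1 * z.2)), (z.1.2.1, z.2))) ?_ ?_ ?_ ?_
  · rintro ⟨⟨N, B⟩, f, ρ⟩ hy
    simp only [Finset.coe_filter, Finset.mem_product, Set.mem_ofPred_eq, Pset, Finset.mem_filter] at hy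
    obtain ⟨⟨⟨⟨hN, hB⟩, hM⟩, hf, hρ⟩, c, hc⟩ := hy
    have hf' := mem_bx_one.1 hf
    have hN' := mem_bx_one.1 hN
    rw [mem_polyLT] at hρ
    have hcd : (ρ ^ 2 + N * ρ + B) / f = c := by
      rw [hc]; exact mul_div_cancel_left₀ c hf'.1.ne_zero
    have hfc : f * c ∈ bx l m := by
      rw [← hc, add_comm]
      exact bx_add hB (low_deg hN'.1 hN'.2 hρ h1 h2)
    rw [mem_bx hl] at hfc
    simp only [Finset.coe_product, Set.mem_prod, Finset.mem_coe, Finset.mem_filter, mem_smp, hcd]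
    refine ⟨⟨⟨hN, hf, ?_⟩, ?_⟩, mem_polyLT.2 hρ⟩
    · rw [mem_bx hl]
      have hc0 : c ≠ 0 := by rintro rfl; rw [mul_zero, leadingCoeff_zero] at hfc; exact hl hfc.2.symm
      rw [natDegree_mul hf'.1.ne_zero hc0, hf'.2, leadingCoeff_mul, hf'.1.leadingCoeff, one_mul] at hfc
      exact ⟨by omega, hfc.2⟩
    · have : MX N (f * c) := by
        rw [← hc, add_comm]; exact MX_iff.2 hM
      exact this
  · rintro ⟨⟨N, f, c⟩, ρ⟩ hz
    simp only [Finset.coe_product, Set.mem_prod, Finset.mem_coe, Finset.mem_filter, mem_smp] at hz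
    obtain ⟨⟨⟨hN, hf, hc⟩, hg⟩, hρ⟩ := hz
    have hf' := mem_bx_one.1 hf
    have hN' := mem_bx_one.1 hN
    have hρ' := mem_polyLT.1 hρ
    simp only [Finset.coe_filter, Finset.mem_product, Set.mem_ofPred_eq, Pset, Finset.mem_filter]
    refine ⟨⟨⟨⟨hN, ?_⟩, ?_⟩, hf, hρ⟩, ?_⟩
    · refine bx_add ?_ (low_deg hN'.1 hN'.2 hρ' h1 h2)
      rw [mem_bx hl] at hc ⊢
      have hc0 : c ≠ 0 := by rintro rfl; rw [leadingCoeff_zero] at hc; exact hl hc.2.symm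
      rw [natDegree_mul hf'.1.ne_zero hc0, hf'.2, leadingCoeff_mul, hf'.1.leadingCoeff, one_mul]
      exact ⟨by omega, hc.2⟩
    · have : MX N (f * c) := hg
      exact MX_iff.2 this
    · refine ⟨c, ?_⟩
      linear_combination (ρ ^ 2 + N * ρ) * two_eq_zero_poly (F := F)
  · rintro ⟨⟨N, B⟩, f, ρ⟩ hy
    simp only [Finset.coe_filter, Finset.mem_product, Set.mem_ofPred_eq, Pset, Finset.mem_filter] at hy
    obtain ⟨⟨⟨⟨hN, hB⟩, hM⟩, hf, hρ⟩, c, hc⟩ := hy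
    have hf' := mem_bx_one.1 hf
    have hcd : (ρ ^ 2 + N * ρ + B) / f = c := by
      rw [hc]; exact mul_div_cancel_left₀ c hf'.1.ne_zero
    simp only [hcd, ← hc, Prod.mk.injEq, true_and, and_true]
    linear_combination (ρ ^ 2 + N * ρ) * two_eq_zero_poly (F := F)
  · rintro ⟨⟨N, f, c⟩, ρ⟩ hz
    simp only [Finset.coe_product, Set.mem_prod, Finset.mem_coe, Finset.mem_filter, mem_smp] at hz
    obtain ⟨⟨⟨hN, hf, hc⟩, hg⟩, hρ⟩ := hz
    have hf' := mem_bx_one.1 hf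
    have : ρ ^ 2 + N * ρ + (f * c + (ρ ^ 2 + N * ρ)) = f * c := by
      linear_combination (ρ ^ 2 + N * ρ) * two_eq_zero_poly (F := F)
    simp only [this, Prod.mk.injEq, true_and, and_true]
    exact mul_div_cancel_left₀ c hf'.1.ne_zero

lemma HH_eq {m : ℕ} {p : F[X] × F[X]} (hp : p.2.natDegree = m) :
    HH p = ∑ k ∈ Finset.range (m / 2 + 1), wtk F m k * (Tk k p).card := by
  unfold HH
  letI := Fintype.ofFinite (RP p.1 p.2)
  have e1 : ∑ k ∈ Finset.range (m / 2 + 1), wtk F m k * (Tk k p).card =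
      ∑ y ∈ (Finset.range (m / 2 + 1)).sigma (fun k => Tk k p), wtk F m y.1 := by
    rw [Finset.sum_sigma]
    refine Finset.sum_congr rfl fun k _ => ?_
    simp only [Finset.sum_const, nsmul_eq_mul]
    rw [mul_comm]
  rw [e1]
  refine Finset.sum_nbij (fun x => ⟨x.1.1.natDegree, x.1⟩) ?_ ?_ ?_ ?_
  · rintro ⟨⟨f, ρ⟩, h1, h2, h3, h4⟩ -
    simp only at h1 h2 h3 h4
    simp only [Finset.mem_sigma, Finset.mem_range, Tk, Finset.mem_filter, Finset.mem_product, mem_bx_one, mem_polyLT, and_true]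
    refine ⟨by omega, ⟨h1, ?_⟩, h4⟩
    rwa [degree_eq_natDegree h1.ne_zero] at h3
  · intro x _ y _ h
    simp only [Sigma.mk.injEq, heq_eq_eq] at h
    exact Subtype.ext h.2
  · rintro ⟨k, f, ρ⟩ hy
    simp only [Finset.coe_sigma, Set.mem_sigma_iff, Finset.mem_coe, Finset.mem_range, Tk, Finset.mem_filter, Finset.mem_product, mem_bx_one, mem_polyLT] at hy
    obtain ⟨h1, ⟨⟨h2, rfl⟩, h3⟩, h4⟩ := hy
    refine ⟨⟨(f, ρ), h2, ?_, ?_, h4⟩, Finset.mem_coe.2 (Finset.mem_univ _), rfl⟩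
    · simp only; omega
    simp only
    rwa [degree_eq_natDegree h2.ne_zero]
  · rintro ⟨⟨f, ρ⟩, h1, h2, h3, h4⟩ -
    simp only [RP.wt, wtk, hp]

lemma good_card (r k m : ℕ) (l : F) : (((smp r k m l).filter good).card : ℝ) =
    Gc r k m l * ((Fintype.card F : ℝ) ^ r * ((Fintype.card F : ℝ) ^ k * (Fintype.card F : ℝ) ^ m)) := by
  rw [Gc, ← card_smp, div_mul_cancel₀ _ (card_smp_pos r k m l).ne']

lemma piece_H {r m : ℕ} {l : F} (hl : l ≠ 0) (h : r + m / 2 ≤ m) :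
    ∑ p ∈ Pset r m l, HH p = (Fintype.card F : ℝ) ^ r * (Fintype.card F : ℝ) ^ m *
      ∑ k ∈ Finset.range (m / 2 + 1), wtk F m k * ((Fintype.card F : ℝ) ^ k * Gc r k (m - k) l) := by
  have : ∀ p ∈ Pset r m l, HH p = ∑ k ∈ Finset.range (m / 2 + 1), wtk F m k * (Tk k p).card := by
    intro p hp
    refine HH_eq ?_
    simp only [Pset, Finset.mem_filter, Finset.mem_product, mem_bx hl] at hp
    exact hp.1.2.1
  rw [Finset.sum_congr rfl this, Finset.sum_comm, Finset.mul_sum]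
  refine Finset.sum_congr rfl fun k hk => ?_
  rw [Finset.mem_range] at hk
  rw [← Finset.mul_sum]
  have := sum_Tk (r := r) (k := k) (m := m) hl (by omega) (by omega)
  rw [← Nat.cast_sum, this]
  push_cast
  rw [good_card, show (Fintype.card F : ℝ) ^ m = (Fintype.card F : ℝ) ^ k * (Fintype.card F : ℝ) ^ (m - k) by
    rw [← pow_add]; congr 1; omega]
  ring

lemma piece_1 {r m : ℕ} {l : F} (hl : l ≠ 0) (h : r ≤ m) :
    ∑ p ∈ Pset r m l, (1 : ℝ) = (Fintype.card F : ℝ) ^ r * (Fintype.card F : ℝ) ^ m * Gc r 0 m l := by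
  have := sum_Tk (r := r) (k := 0) (m := m) hl (by omega) (by omega)
  have h1 : ∀ p ∈ Pset r m l, (Tk 0 p).card = 1 := by
    intro p _
    rw [Finset.card_eq_one]
    refine ⟨(1, 0), ?_⟩
    ext ⟨f, ρ⟩
    simp only [Tk, Finset.mem_filter, Finset.mem_product, mem_bx_one, mem_polyLT, Finset.mem_singleton, Prod.mk.injEq]
    constructor
    · rintro ⟨⟨⟨h1, h2⟩, h3⟩, -⟩
      refine ⟨h1.natDegree_eq_zero.1 h2, ?_⟩
      by_contra h0
      rw [degree_eq_natDegree h0] at h3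
      exact absurd (by exact_mod_cast h3 : ρ.natDegree < 0) (by omega)
    · rintro ⟨rfl, rfl⟩
      refine ⟨⟨⟨monic_one, natDegree_one⟩, ?_⟩, one_dvd _⟩
      rw [degree_zero]; exact WithBot.bot_lt_coe _
  rw [Finset.sum_congr rfl h1] at this
  have h2 := congrArg (fun n : ℕ => (n : ℝ)) this
  push_cast at h2
  rw [good_card] at h2
  simp only [Finset.sum_const, nsmul_eq_mul, mul_one, pow_zero, one_mul, Nat.sub_zero] at h2 ⊢
  rw [h2]; ring

end M8g
end EvenChar

namespace EvenChar
section M9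
open scoped Classical
set_option linter.unusedSectionVars false
set_option linter.unusedSimpArgs false
set_option linter.style.haveILetI false
variable {F : Type} [Field F] [Fintype F] [CharP F 2]
local notation "aM" => algebraMap F[X] (RatFunc F)

variable (F) in
/-- pairs for family `I` -/
def pairsI (g : ℕ) : Finset (F[X] × F[X]) :=
  (Finset.range (g + 1) ×ˢ Finset.univ.erase (0 : F)).biUnion (fun x => Pset x.1 (2 * g + 1) x.2)

lemma mem_pairsI {g : ℕ} (p : F[X] × F[X]) : p ∈ pairsI F g ↔ PrI g p.1 p.2 := by
  simp only [pairsI, Finset.mem_biUnion, Finset.mem_product, Finset.mem_range, Finset.mem_erase, Finset.mem_univ, and_true,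
    Pset, Finset.mem_filter, PrI, mem_bx_one]
  constructor
  · rintro ⟨⟨r, l⟩, ⟨h1, h2⟩, ⟨⟨h3, h4⟩, h5⟩, h6⟩
    rw [mem_bx h2] at h5
    simp only at *
    exact ⟨h3, by omega, h5.1, h6⟩
  · rintro ⟨h1, h2, h3, h4⟩
    have hl : p.2.leadingCoeff ≠ 0 := by
      rw [leadingCoeff_ne_zero]; intro h; rw [h] at h3; simp at h3
    exact ⟨(p.1.natDegree, p.2.leadingCoeff), ⟨h2, hl⟩, ⟨⟨h1, rfl⟩, (mem_bx hl).2 ⟨h3, rfl⟩⟩, h4⟩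

lemma sum_pairsI (g : ℕ) (H : F[X] × F[X] → ℝ) : ∑ p ∈ pairsI F g, H p =
    ∑ r ∈ Finset.range (g + 1), ∑ l ∈ Finset.univ.erase (0 : F), ∑ p ∈ Pset r (2 * g + 1) l, H p := by
  rw [pairsI, Finset.sum_biUnion, Finset.sum_product]
  rintro ⟨r, l⟩ hx ⟨r', l'⟩ hy hne
  rw [Finset.mem_coe, Finset.mem_product, Finset.mem_erase] at hx hy
  refine Finset.disjoint_left.2 fun p hp hp' => hne ?_
  simp only [Pset, Finset.mem_filter, Finset.mem_product, mem_bx_one, mem_bx hx.2.1, mem_bx hy.2.1] at hp hp'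
  rw [Prod.mk.injEq]
  exact ⟨hp.1.1.2.symm.trans hp'.1.1.2, hp.1.2.2.symm.trans hp'.1.2.2⟩

lemma mem_pairsF {ξ : F} (h0 : ξ ≠ 0) {n : ℕ} (p : F[X] × F[X]) : p ∈ Pset n (2 * n) ξ ↔ PrF ξ n p.1 p.2 := by
  simp only [Pset, Finset.mem_filter, Finset.mem_product, mem_bx_one, mem_bx h0, PrF]
  tauto

lemma qpos : (0 : ℝ) < Fintype.card F := by
  have := Fintype.card_pos (α := F)
  exact_mod_cast this

lemma tsum_eq_fin {U : Set (RatFunc F)} (hU : U.Finite) (h : RatFunc F → ℝ) :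
    ∑' u : U, h u.1 = ∑ u ∈ hU.toFinset, h u := by
  haveI := hU.fintype
  rw [tsum_fintype, ← Finset.sum_coe_sort hU.toFinset]
  exact Fintype.sum_equiv (Equiv.subtypeEquivRight (fun x => by simp)) _ _ (fun x => rfl)

lemma card_eq_fin {U : Set (RatFunc F)} (hU : U.Finite) :
    (Nat.card U : ℝ) = ∑ u ∈ hU.toFinset, (1 : ℝ) := by
  rw [Nat.card_coe_set_eq, Set.ncard_eq_toFinset_card _ hU]
  simp

lemma ratio_eq {a b c Q S T : ℝ} (hQ : Q ≠ 0) (hc : c ≠ 0) (h1 : Q * S = c * a) (h2 : Q * T = c * b) : S / T = a / b := by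
  have e1 : S = c / Q * a := by field_simp; linarith
  have e2 : T = c / Q * b := by field_simp; linarith
  rw [e1, e2, mul_div_mul_left _ _ (div_ne_zero hc hQ)]

lemma mainI {ξ : F} (hξ : ∀ x : F, x ^ 2 + x ≠ ξ) (g : ℕ) :
    (∑' u : (Ifam ξ (g + 1) : Set (RatFunc F)), (hClass u.1 : ℝ)) /
            (Nat.card (Ifam ξ (g + 1) : Set (RatFunc F)) : ℝ) = numI F g / denI F g := by
  obtain ⟨hU, key⟩ := fiber_count (U := Ifam ξ (g + 1)) (Pr := PrI g) (n := g + 1) (c := 2)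
    (fun u hu => I_A hu) (fun N B h => I_B hξ h) (fun u hu u' hu' z h => I_C hξ hu hu' h)
    (fun N B h => ⟨h.1, Or.inl ⟨h.2.1, rfl⟩⟩) (pairsI F g) mem_pairsI
  have k1 := key (fun u => (hClass u : ℝ)) HH (fun u hu N B w h1 h2 h3 =>
    hsum h1.1.ne_zero h3 h1.hd h2.hd h1.2.2.2 h1.pos h2.pos)
  have k2 := key (fun u => 1) (fun _ => 1) (fun u hu N B w h1 h2 h3 => rfl)
  rw [sum_pairsI] at k1 k2
  rw [tsum_eq_fin hU (fun u => (hClass u : ℝ)), card_eq_fin hU]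
  have hq := qpos (F := F)
  have s1 : ∑ r ∈ Finset.range (g + 1), ∑ l ∈ Finset.univ.erase (0 : F), ∑ p ∈ Pset r (2 * g + 1) l, HH p =
      (Fintype.card F : ℝ) ^ (2 * g + 1) * numI F g := by
    have : ∀ r ∈ Finset.range (g + 1), ∀ l ∈ Finset.univ.erase (0 : F), ∑ p ∈ Pset r (2 * g + 1) l, HH p =
        ∑ k ∈ Finset.range (g + 1), (Fintype.card F : ℝ) ^ (2 * g + 1) * ((Fintype.card F : ℝ) ^ r * (Fintype.card F : ℝ) ^ k *
    Gc r k (2 * g + 1 - k) l) := by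
      intro r hr l hl
      rw [Finset.mem_range] at hr
      rw [piece_H (Finset.mem_erase.1 hl).1 (by omega), show (2 * g + 1) / 2 = g by omega, Finset.mul_sum]
      refine Finset.sum_congr rfl fun k hk => ?_
      rw [Finset.mem_range] at hk
      rw [wtk, if_pos (by omega)]
      ring
    rw [Finset.sum_congr rfl fun r hr => Finset.sum_congr rfl fun l hl => this r hr l hl]
    rw [numI]
    simp only [Finset.mul_sum]
    rw [Finset.sum_comm (s := Finset.range (g + 1)) (t := Finset.range (g + 1))]
    refine Finset.sum_congr rfl fun r hr => ?_
    rw [Finset.sum_comm]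
  have s2 : ∑ r ∈ Finset.range (g + 1), ∑ l ∈ Finset.univ.erase (0 : F), ∑ p ∈ Pset r (2 * g + 1) l, (1 : ℝ) =
      (Fintype.card F : ℝ) ^ (2 * g + 1) * denI F g := by
    rw [denI, Finset.mul_sum]
    refine Finset.sum_congr rfl fun r hr => ?_
    rw [Finset.mul_sum]
    refine Finset.sum_congr rfl fun l hl => ?_
    rw [Finset.mem_range] at hr
    rw [piece_1 (Finset.mem_erase.1 hl).1 (by omega)]
    ring
  rw [s1] at k1
  rw [s2] at k2
  rw [ratio_eq (pow_ne_zero _ hq.ne') (by norm_num) k1 k2, mul_div_mul_left _ _ (pow_ne_zero _ hq.ne')]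

lemma mainF {ξ : F} (hξ : ∀ x : F, x ^ 2 + x ≠ ξ) (h0 : ξ ≠ 0) (g : ℕ) :
    (∑' u : (F'fam ξ (g + 1) : Set (RatFunc F)), (hClass u.1 : ℝ)) /
            (Nat.card (F'fam ξ (g + 1) : Set (RatFunc F)) : ℝ) = numF F ξ g / Gc (g + 1) 0 (2 * (g + 1)) ξ := by
  obtain ⟨hU, key⟩ := fiber_count (U := F'fam ξ (g + 1)) (Pr := PrF ξ (g + 1)) (n := g + 1) (c := 1)
    (fun u hu => F_A h0 hu) (fun N B h => F_B h0 h) (fun u hu u' hu' z h => F_C hu hu' h)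
    (fun N B h => ⟨h.1, Or.inr ⟨h.2.1, rfl⟩⟩) (Pset (g + 1) (2 * (g + 1)) ξ) (mem_pairsF h0)
  have k1 := key (fun u => (hClass u : ℝ)) HH (fun u hu N B w h1 h2 h3 =>
    hsum h1.1.ne_zero h3 (h1.hd hξ) (h2.hd hξ) h1.2.2.2 h1.pos h2.pos)
  have k2 := key (fun u => 1) (fun _ => 1) (fun u hu N B w h1 h2 h3 => rfl)
  rw [tsum_eq_fin hU (fun u => (hClass u : ℝ)), card_eq_fin hU]
  have hq := qpos (F := F)
  rw [piece_1 h0 (by omega)] at k2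
  rw [piece_H h0 (by omega), show (2 * (g + 1)) / 2 = g + 1 by omega] at k1
  have s1 : ∑ k ∈ Finset.range (g + 1 + 1), wtk F (2 * (g + 1)) k * ((Fintype.card F : ℝ) ^ k * Gc (g + 1) k (2 * (g + 1) - k) ξ) =
      numF F ξ g := by
    rw [Finset.sum_range_succ, numF, show 2 * (g + 1) - (g + 1) = g + 1 by omega]
    congr 1
    · refine Finset.sum_congr rfl fun k hk => ?_
      rw [Finset.mem_range] at hk
      rw [wtk, if_pos (by omega), one_mul]
    · rw [wtk, if_neg (by omega)]
      ring
  rw [s1] at k1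
  rw [ratio_eq (pow_ne_zero _ hq.ne') (by norm_num) k1 k2, mul_div_mul_left]
  exact mul_ne_zero (pow_ne_zero _ hq.ne') (pow_ne_zero _ hq.ne')

end M9
end EvenChar

namespace EvenChar

theorem statement8 {Fq : Type} [Field Fq] [Fintype Fq] (hchar : ringChar Fq = 2)
    (ξ : Fq) (hξ : ∀ x : Fq, x ^ 2 + x ≠ ξ) :
    Filter.Tendsto
      (fun g : ℕ =>
        ((∑' u : (Ifam ξ (g + 1) : Set (RatFunc Fq)), (hClass u.1 : ℝ)) /
            (Nat.card (Ifam ξ (g + 1) : Set (RatFunc Fq)) : ℝ)) /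
          (zetaR (Fintype.card Fq) 2 * eulerPR Fq 2 * (Fintype.card Fq : ℝ) ^ g))
      Filter.atTop (nhds 1) ∧
    Filter.Tendsto
      (fun g : ℕ =>
        ((∑' u : (F'fam ξ (g + 1) : Set (RatFunc Fq)), (hClass u.1 : ℝ)) /
            (Nat.card (F'fam ξ (g + 1) : Set (RatFunc Fq)) : ℝ)) /
          (2 * zetaR (Fintype.card Fq) 3 * eulerPR Fq 2 * (Fintype.card Fq : ℝ) ^ g))
      Filter.atTop (nhds 1) := by
  haveI : CharP Fq 2 := ringChar.of_eq hchar
  have h0 : ξ ≠ 0 := by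
    intro h
    exact hξ 0 (by rw [h]; ring)
  refine ⟨?_, ?_⟩
  · simp only [mainI hξ]
    exact limI
  · simp only [mainF hξ h0]
    exact limF h0

end EvenChar
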